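/- (Theorem 2, stability.) Assume the Neumann-measurement setting described in the context, with θ₁ ∈ [0, π/2). Suppose K ∈ ℝ^{1×N₀} and L ∈ ℝ^{N₀} are such that every complex eigenvalue μ of F₁ satisfies Re μ < −|c|; fix α₁, α₂, α₃, α₄ > 0 with 𝔠 := 1 − ½(|c|/α₁ + 1/α₂ + 1/α₃ + |c|/α₄) > 0; and suppose for the given N ≥ N₀ + 1 there exist ε ∈ (0, 1/2], a symmetric positive definite P, symmetric positive semidefinite Q₁, Q₂, and reals r₁, r₂, β, γ > 0 such that Ψ ≺ 0, Θ₁ ≺ 0, Θ₂ ≺ 0, Θ₃ < 0, Θ₄ < 0, and Θ₅ > 0. Then for any h > 0 there exist constants δ, M > 0 such that every classical solution of the closed-loop system (the PDE with output y_N(t) = z_x(t,0) interconnected with the controller), with admissible initial data (z₀ ∈ C⁰([−h,0]; L²(0,1)) with z₀ and u₀ Lipschitz, z₀(τ,·) ∈ H²(0,1), cos(θ₁) z₀(0,0) − sin(θ₁) z₀,ₓ(0,0) = 0, u₀(0) = Σ_{k=1}^{N₀} k_k ẑ_k(0), and ẑₙ constant on [−h,0]), satisfies for all t ≥ 0: ‖z(t,·)‖²_{H¹}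 + Σ_{n=1}^{N} ẑₙ(t)² ≤ M e^{−2δt} ( sup_{τ∈[−h,0]} ‖z₀(τ,·)‖²_{L²} + ‖z₀(0,·)‖²_{H¹} + ‖u₀‖²_∞ + Σ_{n=1}^{N} ẑₙ(0)² ). -/

import Mathlib

open Real Set Matrix MeasureTheory

noncomputable section

/-- One-sided/within derivative on the spatial interval `[0,1]`. -/
def dI (f : ℝ → ℝ) (x : ℝ) : ℝ := derivWithin f (Set.Icc 0 1) x

/-- `L²(0,1)` inner product. -/
def ip (f g : ℝ → ℝ) : ℝ := ∫ x in (0:ℝ)..1, f x * g x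

/-- The lifting function `a(x) = (2p(x) + 2xp'(x) - x²q̃(x))/(cos θ₂ + 2 sin θ₂)`. -/
def aFun (p qt : ℝ → ℝ) (θ₂ : ℝ) (x : ℝ) : ℝ :=
  (2 * p x + 2 * x * dI p x - x ^ 2 * qt x) / (Real.cos θ₂ + 2 * Real.sin θ₂)

/-- The lifting function `b(x) = -x²/(cos θ₂ + 2 sin θ₂)`. -/
def bFun (θ₂ : ℝ) (x : ℝ) : ℝ := -x ^ 2 / (Real.cos θ₂ + 2 * Real.sin θ₂)

/-- Input coefficient `βₙ = aₙ + (-λₙ + q_c) bₙ`. -/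
def betaC (p qt : ℝ → ℝ) (θ₂ q_c : ℝ) (lam : ℕ → ℝ) (phi : ℕ → ℝ → ℝ) (n : ℕ) : ℝ :=
  ip (aFun p qt θ₂) (phi n) + (-lam n + q_c) * ip (bFun θ₂) (phi n)

/-- Squared `L²`-norm `‖R_N f‖² = Σ_{n≥N+1} ⟨f,φₙ⟩²` of the residual `R_N f`. -/
def RN2 (f : ℝ → ℝ) (phi : ℕ → ℝ → ℝ) (N : ℕ) : ℝ := ∑' k : ℕ, (ip f (phi (N + 1 + k)))^2

/-- `A₀ = diag(-λ₁+q_c, …, -λ_{N₀}+q_c)`. -/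
def A0 (N₀ : ℕ) (lam : ℕ → ℝ) (q_c : ℝ) : Matrix (Fin N₀) (Fin N₀) ℝ :=
  Matrix.diagonal fun i => -lam (i.val + 1) + q_c

/-- `F₃ = A₁ = diag(-λ_{N₀+1}+q_c, …, -λ_N+q_c)`. -/
def A1 (N₀ N : ℕ) (lam : ℕ → ℝ) (q_c : ℝ) : Matrix (Fin (N - N₀)) (Fin (N - N₀)) ℝ :=
  Matrix.diagonal fun i => -lam (N₀ + i.val + 1) + q_c

/-- `𝔅₀ = (β₁,…,β_{N₀})ᵀ`. -/
def B0 (N₀ : ℕ) (p qt : ℝ → ℝ) (θ₂ q_c : ℝ) (lam : ℕ → ℝ) (phi : ℕ → ℝ → ℝ) :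
    Fin N₀ → ℝ :=
  fun i => betaC p qt θ₂ q_c lam phi (i.val + 1)

/-- `F₁ = [[A₀+𝔅₀K, LC₀],[0, A₀-LC₀]]`. -/
def F1 (N₀ : ℕ) (lam : ℕ → ℝ) (q_c : ℝ) (B0v C0v K L : Fin N₀ → ℝ) :
    Matrix (Fin N₀ ⊕ Fin N₀) (Fin N₀ ⊕ Fin N₀) ℝ :=
  Matrix.fromBlocks (A0 N₀ lam q_c + Matrix.vecMulVec B0v K) (Matrix.vecMulVec L C0v) 0
    (A0 N₀ lam q_c - Matrix.vecMulVec L C0v)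

/-- `F₂ = [LC̃₁; -LC̃₁]`. -/
def F2 (N₀ N : ℕ) (L : Fin N₀ → ℝ) (Ct : Fin (N - N₀) → ℝ) :
    Matrix (Fin N₀ ⊕ Fin N₀) (Fin (N - N₀)) ℝ :=
  Matrix.of fun i j => Sum.elim (fun a' => L a' * Ct j) (fun a' => -(L a' * Ct j)) i

/-- `ℒ = col(L,-L)`. -/
def Lv (N₀ : ℕ) (L : Fin N₀ → ℝ) : Fin N₀ ⊕ Fin N₀ → ℝ := Sum.elim L fun a' => -L a'

/-- `K̃ = [K 0]`. -/
def Kt (N₀ : ℕ) (K : Fin N₀ → ℝ) : Fin N₀ ⊕ Fin N₀ → ℝ := Sum.elim K 0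

/-- Index type of the matrix `Ψ` (blocks of sizes `2N₀`, `N-N₀`, `1`). -/
abbrev SIdx (N₀ N : ℕ) := ((Fin N₀ ⊕ Fin N₀) ⊕ Fin (N - N₀)) ⊕ Unit

/-- The row vector `E = K̃ [F₁ F₂ ℒ]`. -/
def Erow (N₀ N : ℕ) (F1m : Matrix (Fin N₀ ⊕ Fin N₀) (Fin N₀ ⊕ Fin N₀) ℝ)
    (F2m : Matrix (Fin N₀ ⊕ Fin N₀) (Fin (N - N₀)) ℝ)
    (Lvv Ktv : Fin N₀ ⊕ Fin N₀ → ℝ) : SIdx N₀ N → ℝ :=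
  Sum.elim (Sum.elim (Matrix.vecMul Ktv F1m) (Matrix.vecMul Ktv F2m)) fun _ => Ktv ⬝ᵥ Lvv

/-- The matrix `Ψ` of the LMI conditions. -/
def PsiM (N₀ N : ℕ)
    (P Q1 F1m : Matrix (Fin N₀ ⊕ Fin N₀) (Fin N₀ ⊕ Fin N₀) ℝ)
    (Q2 F3m : Matrix (Fin (N - N₀)) (Fin (N - N₀)) ℝ)
    (F2m : Matrix (Fin N₀ ⊕ Fin N₀) (Fin (N - N₀)) ℝ)
    (Lvv Ktv : Fin N₀ ⊕ Fin N₀ → ℝ) (E : SIdx N₀ N → ℝ)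
    (c r₁ βs γ α₂ α₃ RNa2 RNb2 : ℝ) : Matrix (SIdx N₀ N) (SIdx N₀ N) ℝ :=
  Matrix.fromBlocks
    (Matrix.fromBlocks
      (F1mᵀ * P + P * F1m + |c| • P + Q1 + (α₂ * γ * RNa2) • Matrix.vecMulVec Ktv Ktv)
      (P * F2m)
      ((P * F2m)ᵀ)
      (r₁ • ((2:ℝ) • F3m + |c| • (1 : Matrix (Fin (N - N₀)) (Fin (N - N₀)) ℝ)) + Q2))
    (Matrix.of fun i (_ : Unit) => Sum.elim (P.mulVec Lvv) (fun _ => 0) i)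
    (Matrix.of fun (_ : Unit) j => Sum.elim (P.mulVec Lvv) (fun _ => 0) j)
    (Matrix.of fun _ _ => -βs)
  + (2 * α₃ * γ * RNb2) • Matrix.vecMulVec E E

/-- The matrix `Θ₁`. -/
def Theta1 (N₀ : ℕ) (P Q1 : Matrix (Fin N₀ ⊕ Fin N₀) (Fin N₀ ⊕ Fin N₀) ℝ)
    (Ktv : Fin N₀ ⊕ Fin N₀ → ℝ) (c γ α₃ α₄ RNb2 : ℝ) :
    Matrix (Fin N₀ ⊕ Fin N₀) (Fin N₀ ⊕ Fin N₀) ℝ :=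
  |c| • P - Q1 + ((2*α₃*|c| + α₄) * γ * |c| * RNb2) • Matrix.vecMulVec Ktv Ktv

/-- The matrix `Θ₂`. -/
def Theta2 (N₀ N : ℕ) (Q2 : Matrix (Fin (N - N₀)) (Fin (N - N₀)) ℝ) (r₁ c : ℝ) :
    Matrix (Fin (N - N₀)) (Fin (N - N₀)) ℝ :=
  (r₁ * |c|) • (1 : Matrix (Fin (N - N₀)) (Fin (N - N₀)) ℝ) - Q2

theorem two_mul_le_sq_div_add (x y : ℝ) {r : ℝ} (hr : 0 < r) :
    2 * x * y ≤ x ^ 2 / r + r * y ^ 2 := by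
  have h : 0 ≤ (x - r * y) ^ 2 / r := by positivity
  have e : (x - r * y) ^ 2 / r = x ^ 2 / r + r * y ^ 2 - 2 * x * y := by
    field_simp
    ring
  linarith

/-- The data of a Lyapunov inequality for a finite-dimensional state coupled with a
diagonal sequence of modes. -/
structure ModalLMI (ι : Type) [Fintype ι] where
  (c qc γ δ σ ν β α₁ α₂ α₃ τ Ra Rb : ℝ)
  (P F : Matrix ι ι ℝ)
  (G κ : ι → ℝ)
  (lam a b φ μ : ℕ → ℝ)
  hγ : 0 < γ
  hν : 0 < ν
  hβ : 0 < β
  hα₁ : 0 < α₁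
  hα₂ : 0 < α₂
  hα₃ : 0 < α₃
  hτ : 0 < τ
  psd : P.PosSemidef
  trace_le : ∀ (m : ℕ) (w : ℕ → ℝ),
    (∑ k ∈ Finset.range m, φ k * w k) ^ 2 ≤ ∑ k ∈ Finset.range m, μ k * w k ^ 2
  a_le : ∀ m, ∑ k ∈ Finset.range m, a k ^ 2 ≤ Ra
  b_le : ∀ m, ∑ k ∈ Finset.range m, b k ^ 2 ≤ Rb
  dissip : ∀ (x : ι → ℝ) (ζ : ℝ),
    2 * (x ⬝ᵥ P *ᵥ (F *ᵥ x + ζ • G)) + ((1 + σ) * |c| + 2 * δ) * (x ⬝ᵥ P *ᵥ x)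
      + α₂ * γ * Ra * (κ ⬝ᵥ x) ^ 2 + 2 * α₃ * γ * Rb * (κ ⬝ᵥ (F *ᵥ x + ζ • G)) ^ 2
      + ν * (x ⬝ᵥ x) ≤ β * ζ ^ 2
  modes : ∀ k, β * μ k
      + γ * (-2 * lam k ^ 2 + 2 * qc * lam k + (|c| / α₁ + 1 / α₂ + 1 / α₃ + τ) * lam k ^ 2)
      + σ * (γ * α₁ * |c|) + 2 * δ * (γ * lam k) ≤ 0

namespace ModalLMI

variable {ι : Type} [Fintype ι] (S : ModalLMI ι)

/-- The quadratic Lyapunov function truncated to `m` modes. -/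
def energy (m : ℕ) (x : ι → ℝ) (w : ℕ → ℝ) : ℝ :=
  x ⬝ᵥ S.P *ᵥ x + S.γ * ∑ k ∈ Finset.range m, S.lam k * w k ^ 2

/-- The quadratic form integrated along the delay, truncated to `m` modes. -/
def hist (m : ℕ) (x : ι → ℝ) (w : ℕ → ℝ) : ℝ :=
  |S.c| * (x ⬝ᵥ S.P *ᵥ x) + S.γ * S.α₁ * |S.c| * ∑ k ∈ Finset.range m, w k ^ 2

theorem dot_symm (x y : ι → ℝ) : x ⬝ᵥ S.P *ᵥ y = y ⬝ᵥ S.P *ᵥ x := by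
  have hP : S.Pᵀ = S.P := by
    have := S.psd.1
    rwa [Matrix.IsHermitian, Matrix.conjTranspose_eq_transpose_of_trivial] at this
  rw [Matrix.dotProduct_mulVec, dotProduct_comm, ← Matrix.mulVec_transpose, hP]

theorem dot_nonneg (x : ι → ℝ) : 0 ≤ x ⬝ᵥ S.P *ᵥ x := by
  simpa using S.psd.dotProduct_mulVec_nonneg x

theorem two_mul_dot_le (x y : ι → ℝ) :
    2 * (x ⬝ᵥ S.P *ᵥ (S.c • y)) ≤ |S.c| * (x ⬝ᵥ S.P *ᵥ x) + |S.c| * (y ⬝ᵥ S.P *ᵥ y) := by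
  have h1 := S.dot_nonneg (x - y)
  have h2 := S.dot_nonneg (x + y)
  have hs := S.dot_symm x y
  simp only [Matrix.mulVec_sub, Matrix.mulVec_add, dotProduct_sub, dotProduct_add, sub_dotProduct,
    add_dotProduct] at h1 h2
  rw [Matrix.mulVec_smul, dotProduct_smul, smul_eq_mul]
  rcases abs_cases S.c with ⟨e, hc⟩ | ⟨e, hc⟩ <;> rw [e] <;> nlinarith

theorem two_mul_dotProduct_le (x y : ι → ℝ) {r : ℝ} (hr : 0 < r) :
    2 * (x ⬝ᵥ y) ≤ r * (x ⬝ᵥ x) + (y ⬝ᵥ y) / r := by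
  simp only [dotProduct, Finset.mul_sum, Finset.sum_div, ← Finset.sum_add_distrib]
  refine Finset.sum_le_sum fun i _ => ?_
  have := two_mul_le_sq_div_add (y i) (x i) hr
  calc _ = 2 * y i * x i := by ring
    _ ≤ _ := this
    _ = _ := by ring

theorem mode_le (k : ℕ) (w wh U V s g : ℝ) :
    2 * S.γ * (S.lam k * w * ((-S.lam k + S.qc) * w + S.c * wh + S.a k * U + S.b k * (V + s) + g))
      + 2 * S.δ * (S.γ * (S.lam k * w ^ 2)) + S.σ * (S.γ * S.α₁ * |S.c| * w ^ 2)
      + S.β * (S.μ k * w ^ 2)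
      ≤ S.γ * S.α₁ * |S.c| * wh ^ 2 + S.α₂ * S.γ * U ^ 2 * S.a k ^ 2
        + 2 * S.α₃ * S.γ * (V ^ 2 + s ^ 2) * S.b k ^ 2 + S.γ / S.τ * g ^ 2 := by
  have hγ := S.hγ
  have h1 : 2 * (S.lam k * w) * (S.c * wh) ≤
      |S.c| / S.α₁ * (S.lam k * w) ^ 2 + S.α₁ * |S.c| * wh ^ 2 := by
    have h := two_mul_le_sq_div_add |S.lam k * w| |wh| S.hα₁
    rw [sq_abs, sq_abs] at h
    calc 2 * (S.lam k * w) * (S.c * wh) ≤ |2 * (S.lam k * w) * (S.c * wh)| := le_abs_self _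
      _ = |S.c| * (2 * |S.lam k * w| * |wh|) := by
        rw [abs_mul, abs_mul, abs_mul S.c, abs_two]
        ring
      _ ≤ |S.c| * ((S.lam k * w) ^ 2 / S.α₁ + S.α₁ * wh ^ 2) :=
        mul_le_mul_of_nonneg_left h (abs_nonneg _)
      _ = _ := by ring
  have h2 := two_mul_le_sq_div_add (S.lam k * w) (S.a k * U) S.hα₂
  have h3 := two_mul_le_sq_div_add (S.lam k * w) (S.b k * (V + s)) S.hα₃
  have h4 := two_mul_le_sq_div_add g (S.lam k * w) S.hτ
  have h5 : (S.b k * (V + s)) ^ 2 ≤ 2 * (V ^ 2 + s ^ 2) * S.b k ^ 2 := by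
    nlinarith [mul_nonneg (sq_nonneg (S.b k)) (sq_nonneg (V - s))]
  have h6 := mul_le_mul_of_nonneg_left h5 S.hα₃.le
  have h7 := mul_le_mul_of_nonneg_right (S.modes k) (sq_nonneg w)
  have h8 := mul_le_mul_of_nonneg_left
    (add_le_add (add_le_add h1 h2) (add_le_add (h3.trans (add_le_add le_rfl h6)) h4)) hγ.le
  have e1 : (S.lam k * w) ^ 2 / S.α₂ = 1 / S.α₂ * (S.lam k ^ 2 * w ^ 2) := by ring
  have e2 : (S.lam k * w) ^ 2 / S.α₃ = 1 / S.α₃ * (S.lam k ^ 2 * w ^ 2) := by ring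
  have e3 : g ^ 2 / S.τ = 1 / S.τ * g ^ 2 := by ring
  have e4 : S.γ / S.τ * g ^ 2 = S.γ * (1 / S.τ * g ^ 2) := by ring
  rw [e1, e2, e3] at h8
  rw [e4]
  linarith

theorem deriv_le (m : ℕ) (x xh r : ι → ℝ) (w wh g : ℕ → ℝ) (s ζ : ℝ)
    (hζ : ζ = ∑ k ∈ Finset.range m, S.φ k * w k) :
    2 * (x ⬝ᵥ S.P *ᵥ (S.F *ᵥ x + ζ • S.G + S.c • xh + r))
      + 2 * S.γ * ∑ k ∈ Finset.range m, S.lam k * w k * ((-S.lam k + S.qc) * w k + S.c * wh k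
        + S.a k * (S.κ ⬝ᵥ x) + S.b k * (S.κ ⬝ᵥ (S.F *ᵥ x + ζ • S.G) + s) + g k)
      + 2 * S.δ * S.energy m x w + S.σ * S.hist m x w
      ≤ S.hist m xh wh + ((S.P *ᵥ r) ⬝ᵥ (S.P *ᵥ r) / S.ν + 2 * S.α₃ * S.γ * S.Rb * s ^ 2
        + S.γ / S.τ * ∑ k ∈ Finset.range m, g k ^ 2) := by
  have h1 := S.two_mul_dot_le x xh
  have h2 := two_mul_dotProduct_le x (S.P *ᵥ r) S.hν
  have h3 := S.dissip x ζ
  have h4 := Finset.sum_le_sum fun k (_ : k ∈ Finset.range m) =>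
    S.mode_le k (w k) (wh k) (S.κ ⬝ᵥ x) (S.κ ⬝ᵥ (S.F *ᵥ x + ζ • S.G)) s (g k)
  have h5 := S.trace_le m w
  have h6 := S.a_le m
  have h7 := S.b_le m
  set U := S.κ ⬝ᵥ x
  set V := S.κ ⬝ᵥ (S.F *ᵥ x + ζ • S.G)
  have hα₂ := S.hα₂
  have hα₃ := S.hα₃
  have hγ := S.hγ
  have h8 := mul_le_mul_of_nonneg_left h6 (by positivity : 0 ≤ S.α₂ * S.γ * U ^ 2)
  have h9 := mul_le_mul_of_nonneg_left h7 (by positivity : 0 ≤ 2 * S.α₃ * S.γ * (V ^ 2 + s ^ 2))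
  have h10 := mul_le_mul_of_nonneg_left h5 S.hβ.le
  rw [← hζ] at h10
  simp only [Finset.sum_add_distrib, ← Finset.mul_sum] at h4
  simp only [energy, hist]
  rw [Matrix.mulVec_add, Matrix.mulVec_add, dotProduct_add, dotProduct_add]
  linarith

end ModalLMI

/-- The primitive of `f` vanishing at `0`. -/
def prim (f : ℝ → ℝ) (t : ℝ) : ℝ := ∫ s in (0 : ℝ)..t, f s

/-- The backward moving average of `f` over a window of length `η`. -/
def movAvg (η : ℝ) (f : ℝ → ℝ) (t : ℝ) : ℝ := (prim f t - prim f (t - η)) / η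

theorem hasDerivAt_prim {f : ℝ → ℝ} (hf : Continuous f) (t : ℝ) : HasDerivAt (prim f) (f t) t :=
  intervalIntegral.integral_hasDerivAt_right (hf.intervalIntegrable _ _)
    (hf.stronglyMeasurableAtFilter _ _) hf.continuousAt

theorem continuous_prim {f : ℝ → ℝ} (hf : Continuous f) : Continuous (prim f) :=
  continuous_iff_continuousAt.2 fun t => (hasDerivAt_prim hf t).continuousAt

theorem hasDerivAt_movAvg {f : ℝ → ℝ} (hf : Continuous f) (η t : ℝ) :
    HasDerivAt (movAvg η f) ((f t - f (t - η)) / η) t := by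
  have h2 : HasDerivAt (fun s => prim f (s - η)) (f (t - η)) t := by
    simpa [Function.comp_def] using
      (hasDerivAt_prim hf (t - η)).comp t ((hasDerivAt_id t).sub_const η)
  exact ((hasDerivAt_prim hf t).sub h2).div_const η

theorem continuous_movAvg {f : ℝ → ℝ} (hf : Continuous f) (η : ℝ) : Continuous (movAvg η f) :=
  continuous_iff_continuousAt.2 fun t => (hasDerivAt_movAvg hf η t).continuousAt

theorem movAvg_eq {f : ℝ → ℝ} (hf : Continuous f) (η t : ℝ) :
    movAvg η f t = (∫ s in (t - η)..t, f s) / η := by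
  rw [movAvg, prim, prim, intervalIntegral.integral_interval_sub_left] <;>
    exact hf.intervalIntegrable _ _

theorem movAvg_sq_le {f : ℝ → ℝ} (hf : Continuous f) {η : ℝ} (hη : 0 < η) (t : ℝ) :
    movAvg η f t ^ 2 ≤ movAvg η (fun s => f s ^ 2) t := by
  set A := movAvg η f t with hA
  have h0 : 0 ≤ ∫ s in (t - η)..t, (f s - A) ^ 2 :=
    intervalIntegral.integral_nonneg (by linarith) fun s _ => sq_nonneg _
  have e : ∫ s in (t - η)..t, (f s - A) ^ 2 =
      (∫ s in (t - η)..t, f s ^ 2) - 2 * A * (∫ s in (t - η)..t, f s) + η * A ^ 2 := by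
    have : ∀ s, (f s - A) ^ 2 = f s ^ 2 - 2 * A * f s + A ^ 2 := fun s => by ring
    simp only [this]
    rw [intervalIntegral.integral_add, intervalIntegral.integral_sub,
      intervalIntegral.integral_const_mul, intervalIntegral.integral_const]
    · simp
    all_goals exact Continuous.intervalIntegrable (by fun_prop) _ _
  have e1 : (∫ s in (t - η)..t, f s) = η * A := by
    rw [hA, movAvg_eq hf]
    field_simp
  rw [movAvg_eq (by fun_prop), le_div_iff₀ hη]
  rw [e1] at e
  nlinarith

theorem abs_movAvg_le {f : ℝ → ℝ} (hf : Continuous f) {η t C : ℝ} (hη : 0 < η)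
    (hC : ∀ s ∈ Icc (t - η) t, |f s| ≤ C) : |movAvg η f t| ≤ C := by
  rw [movAvg_eq hf, abs_div, abs_of_pos hη, div_le_iff₀ hη]
  have := intervalIntegral.norm_integral_le_of_norm_le_const (a := t - η) (b := t) (f := f) (C := C)
    fun s hs => by
      rw [uIoc_of_le (by linarith)] at hs
      exact hC s ⟨hs.1.le, hs.2⟩
  simpa [abs_of_pos hη] using this

theorem tendsto_movAvg {f : ℝ → ℝ} (hf : Continuous f) (t : ℝ) :
    Filter.Tendsto (fun j : ℕ => movAvg (1 / ((j : ℝ) + 1)) f t) Filter.atTop (nhds (f t)) := by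
  rw [Metric.tendsto_atTop]
  intro ε hε
  obtain ⟨r, hr, h⟩ := Metric.continuousAt_iff.1 hf.continuousAt (ε / 2) (half_pos hε)
  obtain ⟨n, hn⟩ := exists_nat_one_div_lt hr
  refine ⟨n, fun j hj => ?_⟩
  have hη : 0 < 1 / ((j : ℝ) + 1) := by positivity
  have hη' : 1 / ((j : ℝ) + 1) < r := (Nat.one_div_le_one_div hj).trans_lt hn
  have := abs_movAvg_le (f := fun s => f s - f t) (by fun_prop) (t := t) (C := ε / 2) hη
    fun s hs => by
    have h3 : dist s t < r := by
      rw [Real.dist_eq, abs_lt]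
      constructor <;> linarith [hs.1, hs.2]
    exact (h h3).le
  have e : movAvg (1 / ((j : ℝ) + 1)) (fun s => f s - f t) t =
      movAvg (1 / ((j : ℝ) + 1)) f t - f t := by
    rw [movAvg_eq (by fun_prop), movAvg_eq hf, intervalIntegral.integral_sub
      (hf.intervalIntegrable _ _) (by simp), intervalIntegral.integral_const]
    simp only [smul_eq_mul]
    field_simp
    ring
  rw [e] at this
  rw [Real.dist_eq]
  linarith

theorem movAvg_zero {f : ℝ → ℝ} (hf : Continuous f) (h0 : ∀ t ≤ 0, f t = f 0) {η : ℝ}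
    (hη : 0 < η) : movAvg η f 0 = f 0 := by
  rw [movAvg_eq hf]
  have : ∫ s in (0 - η)..0, f s = ∫ s in (0 - η)..0, f 0 := by
    refine intervalIntegral.integral_congr fun s hs => ?_
    rw [uIcc_of_le (by linarith)] at hs
    exact h0 s hs.2
  rw [this, intervalIntegral.integral_const]
  simp only [smul_eq_mul]
  field_simp
  ring

/-- Sequences of continuous functions, bounded on `[0, T]` and converging pointwise there. -/
structure BddTendsto (T : ℝ) (F : ℕ → ℝ → ℝ) (f : ℝ → ℝ) : Prop where
  cont : ∀ j, Continuous (F j)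
  bdd : ∃ C, ∀ j, ∀ s ∈ Icc 0 T, |F j s| ≤ C
  lim : ∀ s ∈ Ioc 0 T, Filter.Tendsto (fun j => F j s) Filter.atTop (nhds (f s))

namespace BddTendsto

variable {T : ℝ} {F G : ℕ → ℝ → ℝ} {f g : ℝ → ℝ}

theorem integral (h : BddTendsto T F f) (hT : 0 ≤ T) :
    Filter.Tendsto (fun j => ∫ s in (0 : ℝ)..T, F j s) Filter.atTop
      (nhds (∫ s in (0 : ℝ)..T, f s)) := by
  obtain ⟨C, hC⟩ := h.bdd
  refine intervalIntegral.tendsto_integral_filter_of_dominated_convergence (fun _ => C)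
    (Filter.Eventually.of_forall fun j => (h.cont j).aestronglyMeasurable)
    (Filter.Eventually.of_forall fun j => Filter.Eventually.of_forall fun s hs => ?_)
    (by simp) (Filter.Eventually.of_forall fun s hs => ?_)
  · rw [uIoc_of_le hT] at hs
    exact hC j s ⟨hs.1.le, hs.2⟩
  · rw [uIoc_of_le hT] at hs
    exact h.lim s hs

theorem of_continuous (hf : Continuous f) : BddTendsto T (fun _ => f) f := by
  refine ⟨fun _ => hf, ?_, fun s _ => tendsto_const_nhds⟩
  obtain ⟨C, hC⟩ := isCompact_Icc.exists_bound_of_continuousOn (s := Icc 0 T) hf.continuousOn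
  exact ⟨C, fun _ s hs => hC s hs⟩

theorem add (hF : BddTendsto T F f) (hG : BddTendsto T G g) :
    BddTendsto T (fun j s => F j s + G j s) fun s => f s + g s := by
  obtain ⟨A, hA⟩ := hF.bdd
  obtain ⟨B, hB⟩ := hG.bdd
  exact ⟨fun j => (hF.cont j).add (hG.cont j),
    ⟨A + B, fun j s hs => (abs_add_le _ _).trans (add_le_add (hA j s hs) (hB j s hs))⟩,
    fun s hs => (hF.lim s hs).add (hG.lim s hs)⟩

theorem mul (hF : BddTendsto T F f) (hG : BddTendsto T G g) :
    BddTendsto T (fun j s => F j s * G j s) fun s => f s * g s := by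
  obtain ⟨A, hA⟩ := hF.bdd
  obtain ⟨B, hB⟩ := hG.bdd
  refine ⟨fun j => (hF.cont j).mul (hG.cont j), ⟨A * B, fun j s hs => ?_⟩,
    fun s hs => (hF.lim s hs).mul (hG.lim s hs)⟩
  rw [abs_mul]
  exact mul_le_mul (hA j s hs) (hB j s hs) (abs_nonneg _) ((abs_nonneg _).trans (hA j s hs))

theorem pow_two (hF : BddTendsto T F f) :
    BddTendsto T (fun j s => F j s ^ 2) fun s => f s ^ 2 := by
  simpa only [sq] using hF.mul hF

theorem const_mul (c : ℝ) (hF : BddTendsto T F f) :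
    BddTendsto T (fun j s => c * F j s) fun s => c * f s :=
  (of_continuous (f := fun _ => c) continuous_const).mul hF

theorem sum {κ : Type} (A : Finset κ) {F : κ → ℕ → ℝ → ℝ} {f : κ → ℝ → ℝ}
    (h : ∀ k, BddTendsto T (F k) (f k)) :
    BddTendsto T (fun j s => ∑ k ∈ A, F k j s) fun s => ∑ k ∈ A, f k s := by
  classical
  induction A using Finset.induction_on with
  | empty => simpa using of_continuous (T := T) (f := fun _ => (0 : ℝ)) continuous_const
  | insert a A ha ih => simpa only [Finset.sum_insert ha] using (h a).add ih

theorem movAvg {f : ℝ → ℝ} (hf : Continuous f) :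
    BddTendsto T (fun j => movAvg (1 / ((j : ℝ) + 1)) f) f := by
  refine ⟨fun j => continuous_movAvg hf _, ?_, fun s _ => tendsto_movAvg hf s⟩
  obtain ⟨C, hC⟩ := isCompact_Icc.exists_bound_of_continuousOn (s := Icc (-1) T) hf.continuousOn
  refine ⟨C, fun j s hs => abs_movAvg_le hf (by positivity) fun r hr => hC r ⟨?_, hr.2.trans hs.2⟩⟩
  have : 1 / ((j : ℝ) + 1) ≤ 1 := by
    rw [div_le_one (by positivity)]
    linarith [(Nat.cast_nonneg j : (0 : ℝ) ≤ j)]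
  linarith [hr.1, hs.1]

end BddTendsto

/-- The weight of the initial datum in a backward moving average. -/
def ramp (η t : ℝ) : ℝ := (min (t - η) 0 - min t 0) / η

theorem bddTendsto_ramp {T : ℝ} :
    BddTendsto T (fun j : ℕ => ramp (1 / ((j : ℝ) + 1))) fun _ => 0 := by
  refine ⟨fun j => by unfold ramp; fun_prop, ⟨1, fun j s hs => ?_⟩, fun s hs => ?_⟩
  · have hη : 0 < 1 / ((j : ℝ) + 1) := by positivity
    rw [ramp, abs_div, abs_of_pos hη, div_le_one hη, min_eq_right hs.1, sub_zero, abs_le]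
    constructor
    · exact le_min (by linarith [hs.1]) (by linarith)
    · exact (min_le_right _ _).trans hη.le
  · obtain ⟨n, hn⟩ := exists_nat_one_div_lt hs.1
    refine tendsto_const_nhds.congr' ?_
    filter_upwards [Filter.eventually_ge_atTop n] with j hj
    have := (Nat.one_div_le_one_div (α := ℝ) hj).trans_lt hn
    rw [ramp, min_eq_right hs.1.le, min_eq_right (by linarith)]
    simp

namespace ModalLMI

variable {ι : Type} [Fintype ι] (S : ModalLMI ι)

/-- A solution, in time-integrated form, of the modal system attached to `S`; all functions are
extended to negative times by their initial values. -/
structure WeakSol (x xh : ℝ → ι → ℝ) (w wh : ℕ → ℝ → ℝ) (d Z : ℝ → ℝ) (rX : ι → ℝ)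
    (rW : ℕ → ℝ) : Prop where
  cont_x : ∀ i, Continuous fun t => x t i
  cont_xh : ∀ i, Continuous fun t => xh t i
  cont_w : ∀ k, Continuous (w k)
  cont_wh : ∀ k, Continuous (wh k)
  cont_d : Continuous d
  cont_Z : Continuous Z
  x_neg : ∀ i, ∀ t ≤ 0, x t i = x 0 i
  w_neg : ∀ k, ∀ t ≤ 0, w k t = w k 0
  eq_x : ∀ t i, x t i = x 0 i + (S.F *ᵥ fun j => prim (fun s => x s j) t) i + Z t * S.G i
    + S.c * prim (fun s => xh s i) t - min t 0 * rX i
  eq_w : ∀ t k, w k t = w k 0 + (-S.lam k + S.qc) * prim (w k) t + S.c * prim (wh k) t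
    + S.a k * (S.κ ⬝ᵥ fun j => prim (fun s => x s j) t)
    + S.b k * (S.κ ⬝ᵥ (S.F *ᵥ (fun j => prim (fun s => x s j) t) + Z t • S.G) - S.c * prim d t)
    - min t 0 * rW k
  rW_bdd : ∃ R, ∀ m, ∑ k ∈ Finset.range m, rW k ^ 2 ≤ R
  trace_lim : ∀ t, Filter.Tendsto (fun m => ∑ k ∈ Finset.range m, S.φ k * prim (w k) t)
    Filter.atTop (nhds (Z t))
  trace_bdd : ∀ T, ∃ C, ∀ t ∈ Icc (-1) T, ∀ m,
    |∑ k ∈ Finset.range m, S.φ k * prim (w k) t| ≤ C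

theorem hasDerivAt_dot {x : ℝ → ι → ℝ} {x' : ι → ℝ} {t : ℝ}
    (hx : ∀ i, HasDerivAt (fun s => x s i) (x' i) t) :
    HasDerivAt (fun s => x s ⬝ᵥ S.P *ᵥ x s) (2 * (x t ⬝ᵥ S.P *ᵥ x')) t := by
  have h : HasDerivAt (fun s => x s ⬝ᵥ S.P *ᵥ x s)
      (∑ i, (x' i * (S.P *ᵥ x t) i + x t i * (S.P *ᵥ x') i)) t := by
    simp only [dotProduct, Matrix.mulVec]
    refine HasDerivAt.fun_sum fun i _ => (hx i).mul ?_
    exact HasDerivAt.fun_sum fun j _ => (hx j).const_mul _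
  have e : ∑ i, (x' i * (S.P *ᵥ x t) i + x t i * (S.P *ᵥ x') i) = 2 * (x t ⬝ᵥ S.P *ᵥ x') := by
    rw [Finset.sum_add_distrib]
    change x' ⬝ᵥ S.P *ᵥ x t + x t ⬝ᵥ S.P *ᵥ x' = _
    rw [S.dot_symm x' (x t)]
    ring
  rwa [e] at h

variable {S} {x xh : ℝ → ι → ℝ} {w wh : ℕ → ℝ → ℝ} {d Z : ℝ → ℝ} {rX : ι → ℝ} {rW : ℕ → ℝ}

namespace WeakSol

/-- The truncation error of the trace of the averaged modes. -/
def traceErr (S : ModalLMI ι) (w : ℕ → ℝ → ℝ) (Z : ℝ → ℝ) (η : ℝ) (m : ℕ) (t : ℝ) : ℝ :=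
  (Z t - Z (t - η)) / η - ∑ k ∈ Finset.range m, S.φ k * movAvg η (w k) t

theorem continuous_traceErr (h : S.WeakSol x xh w wh d Z rX rW) (η : ℝ) (m : ℕ) :
    Continuous (traceErr S w Z η m) := by
  have hZ := h.cont_Z
  refine Continuous.sub (by fun_prop) (continuous_finsetSum _ fun k _ => ?_)
  exact continuous_const.mul (continuous_movAvg (h.cont_w k) η)

theorem traceErr_eq (η : ℝ) (m : ℕ) (t : ℝ) : traceErr S w Z η m t =
    (Z t - ∑ k ∈ Finset.range m, S.φ k * prim (w k) t) / η
      - (Z (t - η) - ∑ k ∈ Finset.range m, S.φ k * prim (w k) (t - η)) / η := by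
  have : ∑ k ∈ Finset.range m, S.φ k * movAvg η (w k) t =
      (∑ k ∈ Finset.range m, S.φ k * prim (w k) t) / η
        - (∑ k ∈ Finset.range m, S.φ k * prim (w k) (t - η)) / η := by
    rw [Finset.sum_div, Finset.sum_div, ← Finset.sum_sub_distrib]
    exact Finset.sum_congr rfl fun k _ => by rw [movAvg]; ring
  rw [traceErr, this]
  ring

theorem bddTendsto_traceErr (h : S.WeakSol x xh w wh d Z rX rW) {η : ℝ} (hη : 0 < η)
    (hη1 : η ≤ 1) (T : ℝ) :
    BddTendsto T (fun m => traceErr S w Z η m) fun _ => 0 := by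
  refine ⟨h.continuous_traceErr η, ?_, fun t _ => ?_⟩
  · obtain ⟨C, hC⟩ := h.trace_bdd T
    have key : ∀ t ∈ Icc (-1) T, ∀ m,
        |Z t - ∑ k ∈ Finset.range m, S.φ k * prim (w k) t| ≤ 2 * C := by
      intro t ht m
      have h1 : |Z t| ≤ C :=
        le_of_tendsto (h.trace_lim t).abs (Filter.Eventually.of_forall fun m => hC t ht m)
      calc _ ≤ |Z t| + |∑ k ∈ Finset.range m, S.φ k * prim (w k) t| := abs_sub _ _
        _ ≤ 2 * C := by linarith [hC t ht m]
    refine ⟨2 * C / η + 2 * C / η, fun m t ht => ?_⟩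
    rw [traceErr_eq]
    refine (abs_sub _ _).trans (add_le_add ?_ ?_)
    · rw [abs_div, abs_of_pos hη]
      gcongr
      exact key t ⟨by linarith [ht.1], ht.2⟩ m
    · rw [abs_div, abs_of_pos hη]
      gcongr
      exact key (t - η) ⟨by linarith [ht.1], by linarith [ht.2]⟩ m
  · simp only [traceErr_eq]
    have h1 := ((h.trace_lim t).const_sub (Z t)).div_const η
    have h2 := ((h.trace_lim (t - η)).const_sub (Z (t - η))).div_const η
    simpa using h1.sub h2

theorem primVec_avg (F : Matrix ι ι ℝ) (η t : ℝ) :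
    (F *ᵥ fun j => movAvg η (fun s => x s j) t) =
      η⁻¹ • ((F *ᵥ fun j => prim (fun s => x s j) t) -
        F *ᵥ fun j => prim (fun s => x s j) (t - η)) := by
  rw [← Matrix.mulVec_sub, ← Matrix.mulVec_smul]
  congr 1
  funext j
  simp only [movAvg, Pi.smul_apply, Pi.sub_apply, smul_eq_mul]
  ring

theorem dot_avg (κ : ι → ℝ) (η t : ℝ) :
    (κ ⬝ᵥ fun j => movAvg η (fun s => x s j) t) =
      ((κ ⬝ᵥ fun j => prim (fun s => x s j) t) -
        κ ⬝ᵥ fun j => prim (fun s => x s j) (t - η)) / η := by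
  rw [← dotProduct_sub, div_eq_inv_mul, ← smul_eq_mul, ← dotProduct_smul]
  congr 1
  funext j
  simp only [movAvg, Pi.smul_apply, Pi.sub_apply, smul_eq_mul]
  ring

theorem hasDerivAt_avg_x (h : S.WeakSol x xh w wh d Z rX rW) (η : ℝ) (m : ℕ) (t : ℝ) (i : ι) :
    HasDerivAt (fun s => movAvg η (fun r => x r i) s)
      ((S.F *ᵥ (fun j => movAvg η (fun r => x r j) t)
        + (∑ k ∈ Finset.range m, S.φ k * movAvg η (w k) t) • S.G
        + S.c • (fun j => movAvg η (fun r => xh r j) t)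
        + (traceErr S w Z η m t • S.G + ramp η t • rX)) i) t := by
  convert hasDerivAt_movAvg (h.cont_x i) η t using 1
  rw [h.eq_x t i, h.eq_x (t - η) i, primVec_avg]
  simp only [traceErr, ramp, movAvg, Pi.add_apply, Pi.smul_apply, Pi.sub_apply, smul_eq_mul]
  ring

theorem hasDerivAt_avg_w (h : S.WeakSol x xh w wh d Z rX rW) (η : ℝ) (m : ℕ) (t : ℝ) (k : ℕ) :
    HasDerivAt (movAvg η (w k))
      ((-S.lam k + S.qc) * movAvg η (w k) t + S.c * movAvg η (wh k) t
        + S.a k * (S.κ ⬝ᵥ fun j => movAvg η (fun r => x r j) t)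
        + S.b k * (S.κ ⬝ᵥ (S.F *ᵥ (fun j => movAvg η (fun r => x r j) t)
          + (∑ k ∈ Finset.range m, S.φ k * movAvg η (w k) t) • S.G)
          + ((S.κ ⬝ᵥ S.G) * traceErr S w Z η m t - S.c * movAvg η d t))
        + ramp η t * rW k) t := by
  convert hasDerivAt_movAvg (h.cont_w k) η t using 1
  rw [h.eq_w t k, h.eq_w (t - η) k, dot_avg, primVec_avg]
  simp only [traceErr, ramp, dotProduct_add, dotProduct_smul, dotProduct_sub, smul_eq_mul]
  simp only [movAvg]
  ring

theorem continuous_energy {x : ℝ → ι → ℝ} {w : ℕ → ℝ → ℝ} (hx : ∀ i, Continuous fun t => x t i)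
    (hw : ∀ k, Continuous (w k)) (m : ℕ) :
    Continuous fun t => S.energy m (x t) fun k => w k t := by
  simp only [energy, dotProduct, Matrix.mulVec]
  fun_prop

theorem continuous_hist {x : ℝ → ι → ℝ} {w : ℕ → ℝ → ℝ} (hx : ∀ i, Continuous fun t => x t i)
    (hw : ∀ k, Continuous (w k)) (m : ℕ) :
    Continuous fun t => S.hist m (x t) fun k => w k t := by
  simp only [hist, dotProduct, Matrix.mulVec]
  fun_prop

theorem bddTendsto_dot {T : ℝ} {X : ℕ → ℝ → ι → ℝ} {x : ℝ → ι → ℝ}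
    (h : ∀ i, BddTendsto T (fun j s => X j s i) fun s => x s i) :
    BddTendsto T (fun j s => X j s ⬝ᵥ S.P *ᵥ X j s) fun s => x s ⬝ᵥ S.P *ᵥ x s := by
  simp only [dotProduct, Matrix.mulVec]
  exact BddTendsto.sum _ fun i => (h i).mul (BddTendsto.sum _ fun j => (h j).const_mul _)

/-- The energy inequality for the averaged, truncated system. -/
theorem avg_energy_le (h : S.WeakSol x xh w wh d Z rX rW) (hRb : 0 ≤ S.Rb) {Wh : ℝ → ℝ}
    (hWh : Continuous Wh) (hWh_le : ∀ m t, ∑ k ∈ Finset.range m, wh k t ^ 2 ≤ Wh t) {V₀ R : ℝ}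
    (hV₀ : ∀ m, S.energy m (x 0) (fun k => w k 0) ≤ V₀)
    (hR : ∀ m, ∑ k ∈ Finset.range m, rW k ^ 2 ≤ R) {η T : ℝ} (hη : 0 < η) (hT : 0 ≤ T) (m : ℕ) :
    Real.exp (2 * S.δ * T) * S.energy m (fun i => movAvg η (fun r => x r i) T)
        (fun k => movAvg η (w k) T)
      + ∫ s in (0 : ℝ)..T, Real.exp (2 * S.δ * s) * (S.σ * S.hist m
          (fun i => movAvg η (fun r => x r i) s) (fun k => movAvg η (w k) s))
      ≤ V₀ + ∫ s in (0 : ℝ)..T, Real.exp (2 * S.δ * s) *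
        (|S.c| * ((fun i => movAvg η (fun r => xh r i) s) ⬝ᵥ
            S.P *ᵥ (fun i => movAvg η (fun r => xh r i) s))
          + S.γ * S.α₁ * |S.c| * movAvg η Wh s
          + (2 * ((S.P *ᵥ S.G) ⬝ᵥ (S.P *ᵥ S.G)) / S.ν
              + 4 * S.α₃ * S.γ * S.Rb * (S.κ ⬝ᵥ S.G) ^ 2) * traceErr S w Z η m s ^ 2
          + (2 * ((S.P *ᵥ rX) ⬝ᵥ (S.P *ᵥ rX)) / S.ν + S.γ / S.τ * R) * ramp η s ^ 2
          + 4 * S.α₃ * S.γ * S.Rb * S.c ^ 2 * movAvg η d s ^ 2) := by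
  set xη : ℝ → ι → ℝ := fun t i => movAvg η (fun r => x r i) t with hxη
  set xhη : ℝ → ι → ℝ := fun t i => movAvg η (fun r => xh r i) t with hxhη
  set wη : ℕ → ℝ → ℝ := fun k => movAvg η (w k) with hwη
  set ζ : ℝ → ℝ := fun t => ∑ k ∈ Finset.range m, S.φ k * wη k t with hζ
  set e : ℝ → ℝ := traceErr S w Z η m with he
  have cx : ∀ i, Continuous fun t => xη t i := fun i => continuous_movAvg (h.cont_x i) η
  have cxh : ∀ i, Continuous fun t => xhη t i := fun i => continuous_movAvg (h.cont_xh i) η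
  have cw : ∀ k, Continuous (wη k) := fun k => continuous_movAvg (h.cont_w k) η
  have cwh : ∀ k, Continuous (movAvg η (wh k)) := fun k => continuous_movAvg (h.cont_wh k) η
  have cWh : Continuous (movAvg η Wh) := continuous_movAvg hWh η
  have cd : Continuous (movAvg η d) := continuous_movAvg h.cont_d η
  have ce : Continuous e := h.continuous_traceErr η m
  have cζ : Continuous ζ := continuous_finsetSum _ fun k _ => continuous_const.mul (cw k)
  have cr : Continuous (ramp η) := by unfold ramp; fun_prop
  set x' : ℝ → ι → ℝ := fun t => S.F *ᵥ xη t + ζ t • S.G + S.c • xhη t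
    + (e t • S.G + ramp η t • rX) with hx'
  set w' : ℕ → ℝ → ℝ := fun k t => (-S.lam k + S.qc) * wη k t + S.c * movAvg η (wh k) t
        + S.a k * (S.κ ⬝ᵥ xη t)
        + S.b k * (S.κ ⬝ᵥ (S.F *ᵥ xη t + ζ t • S.G)
          + ((S.κ ⬝ᵥ S.G) * e t - S.c * movAvg η d t))
        + ramp η t * rW k with hw'
  have dx : ∀ t i, HasDerivAt (fun s => xη s i) (x' t i) t := fun t i => h.hasDerivAt_avg_x η m t i
  have dw : ∀ t k, HasDerivAt (wη k) (w' k t) t := fun t k => h.hasDerivAt_avg_w η m t k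
  have cx' : ∀ i, Continuous fun t => x' t i := by
    intro i
    simp only [hx', Pi.add_apply, Pi.smul_apply, Matrix.mulVec, dotProduct, smul_eq_mul]
    fun_prop
  have cw' : ∀ k, Continuous (w' k) := by
    intro k
    simp only [hw', dotProduct, Matrix.mulVec, Pi.add_apply, Pi.smul_apply, smul_eq_mul]
    fun_prop
  set D : ℝ → ℝ := fun t => Real.exp (2 * S.δ * t) * (2 * (xη t ⬝ᵥ S.P *ᵥ x' t)
    + 2 * S.γ * (∑ k ∈ Finset.range m, S.lam k * wη k t * w' k t)
    + 2 * S.δ * S.energy m (xη t) (fun k => wη k t)) with hD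
  have dE : ∀ t, HasDerivAt
      (fun t => Real.exp (2 * S.δ * t) * S.energy m (xη t) (fun k => wη k t)) (D t) t := by
    intro t
    have h1 : HasDerivAt (fun t => Real.exp (2 * S.δ * t))
        (Real.exp (2 * S.δ * t) * (2 * S.δ)) t := by
      simpa using ((hasDerivAt_id t).const_mul (2 * S.δ)).exp
    have h2 : HasDerivAt (fun t => S.energy m (xη t) (fun k => wη k t))
        (2 * (xη t ⬝ᵥ S.P *ᵥ x' t)
          + S.γ * ∑ k ∈ Finset.range m, S.lam k * ((2 : ℕ) * wη k t ^ (2 - 1) * w' k t)) t := by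
      simp only [energy]
      exact (S.hasDerivAt_dot (dx t)).add
        ((HasDerivAt.fun_sum fun k _ => ((dw t k).pow 2).const_mul _).const_mul _)
    refine (h1.mul h2).congr_deriv ?_
    have : ∑ k ∈ Finset.range m, S.lam k * ((2 : ℕ) * wη k t ^ (2 - 1) * w' k t) =
        2 * ∑ k ∈ Finset.range m, S.lam k * wη k t * w' k t := by
      rw [Finset.mul_sum]
      exact Finset.sum_congr rfl fun k _ => by norm_num; ring
    simp only [this, hD]
    ring
  have cD : Continuous D := by
    have := continuous_energy (S := S) cx cw m
    simp only [hD, dotProduct, Matrix.mulVec]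
    fun_prop
  have cH := continuous_hist (S := S) cx cw m
  have cE : Continuous fun s : ℝ => Real.exp (2 * S.δ * s) := by fun_prop
  have FTC := intervalIntegral.integral_eq_sub_of_hasDerivAt (a := 0) (b := T)
    (fun t _ => dE t) (cD.intervalIntegrable _ _)
  have E0 : S.energy m (xη 0) (fun k => wη k 0) = S.energy m (x 0) (fun k => w k 0) := by
    have e1 : xη 0 = x 0 := by
      funext i
      exact movAvg_zero (h.cont_x i) (h.x_neg i) hη
    have e2 : (fun k => wη k 0) = fun k => w k 0 := by
      funext k
      exact movAvg_zero (h.cont_w k) (h.w_neg k) hη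
    rw [e1, e2]
  simp only [mul_zero, Real.exp_zero, one_mul] at FTC
  rw [E0] at FTC
  have hV := hV₀ m
  have cB : Continuous fun s => xhη s ⬝ᵥ S.P *ᵥ xhη s := by
    simp only [dotProduct, Matrix.mulVec]
    fun_prop
  have main : (∫ s in (0 : ℝ)..T, D s)
      + (∫ s in (0 : ℝ)..T, Real.exp (2 * S.δ * s) * (S.σ * S.hist m (xη s) (fun k => wη k s)))
      ≤ ∫ s in (0 : ℝ)..T, Real.exp (2 * S.δ * s) *
        (|S.c| * (xhη s ⬝ᵥ S.P *ᵥ xhη s)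
          + S.γ * S.α₁ * |S.c| * movAvg η Wh s
          + (2 * ((S.P *ᵥ S.G) ⬝ᵥ (S.P *ᵥ S.G)) / S.ν
              + 4 * S.α₃ * S.γ * S.Rb * (S.κ ⬝ᵥ S.G) ^ 2) * e s ^ 2
          + (2 * ((S.P *ᵥ rX) ⬝ᵥ (S.P *ᵥ rX)) / S.ν + S.γ / S.τ * R) * ramp η s ^ 2
          + 4 * S.α₃ * S.γ * S.Rb * S.c ^ 2 * movAvg η d s ^ 2) := by
    rw [← intervalIntegral.integral_add (cD.intervalIntegrable _ _)
      (Continuous.intervalIntegrable (by fun_prop) _ _)]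
    refine intervalIntegral.integral_mono_on hT (Continuous.intervalIntegrable (by fun_prop) _ _)
      (Continuous.intervalIntegrable (by fun_prop) _ _) fun s _ => ?_
    rw [hD]
    simp only
    rw [← mul_add]
    refine mul_le_mul_of_nonneg_left ?_ (Real.exp_pos _).le
    have key := S.deriv_le m (xη s) (xhη s) (e s • S.G + ramp η s • rX) (fun k => wη k s)
      (fun k => movAvg η (wh k) s) (fun k => ramp η s * rW k)
      ((S.κ ⬝ᵥ S.G) * e s - S.c * movAvg η d s) (ζ s) rfl
    refine key.trans ?_
    have k1 : ∑ k ∈ Finset.range m, movAvg η (wh k) s ^ 2 ≤ movAvg η Wh s := by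
      refine (Finset.sum_le_sum fun k _ => movAvg_sq_le (h.cont_wh k) hη s).trans ?_
      have ci : ∀ k ∈ Finset.range m, IntervalIntegrable (fun r => wh k r ^ 2) volume (s - η) s :=
        fun k _ => ((h.cont_wh k).pow 2).intervalIntegrable _ _
      rw [Finset.sum_congr rfl fun k _ => movAvg_eq (f := fun r => wh k r ^ 2)
        ((h.cont_wh k).pow 2) η s, movAvg_eq hWh,
        ← Finset.sum_div, ← intervalIntegral.integral_finsetSum ci]
      refine div_le_div_of_nonneg_right ?_ hη.le
      have cs : Continuous fun r => ∑ k ∈ Finset.range m, wh k r ^ 2 :=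
        continuous_finsetSum _ fun k _ => (h.cont_wh k).pow 2
      exact intervalIntegral.integral_mono_on (by linarith) (cs.intervalIntegrable _ _)
        (hWh.intervalIntegrable _ _) fun r _ => hWh_le m r
    have hγ := S.hγ
    have hα₁ := S.hα₁
    have hα₃ := S.hα₃
    have hν := S.hν
    have hτ := S.hτ
    have k2 := mul_le_mul_of_nonneg_left k1 (by positivity : 0 ≤ S.γ * S.α₁ * |S.c|)
    have k3 : (S.P *ᵥ (e s • S.G + ramp η s • rX)) ⬝ᵥ (S.P *ᵥ (e s • S.G + ramp η s • rX)) / S.ν ≤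
        2 * ((S.P *ᵥ S.G) ⬝ᵥ (S.P *ᵥ S.G)) / S.ν * e s ^ 2
          + 2 * ((S.P *ᵥ rX) ⬝ᵥ (S.P *ᵥ rX)) / S.ν * ramp η s ^ 2 := by
      have : (S.P *ᵥ (e s • S.G + ramp η s • rX)) ⬝ᵥ (S.P *ᵥ (e s • S.G + ramp η s • rX)) ≤
        2 * ((S.P *ᵥ S.G) ⬝ᵥ (S.P *ᵥ S.G)) * e s ^ 2
          + 2 * ((S.P *ᵥ rX) ⬝ᵥ (S.P *ᵥ rX)) * ramp η s ^ 2 := by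
        rw [Matrix.mulVec_add, Matrix.mulVec_smul, Matrix.mulVec_smul]
        simp only [dotProduct, Finset.mul_sum, Finset.sum_mul, ← Finset.sum_add_distrib]
        refine Finset.sum_le_sum fun i _ => ?_
        simp only [Pi.add_apply, Pi.smul_apply, smul_eq_mul]
        nlinarith [sq_nonneg (e s * (S.P *ᵥ S.G) i - ramp η s * (S.P *ᵥ rX) i)]
      refine (div_le_div_of_nonneg_right this hν.le).trans_eq ?_
      ring
    have k4 : 2 * S.α₃ * S.γ * S.Rb * ((S.κ ⬝ᵥ S.G) * e s - S.c * movAvg η d s) ^ 2 ≤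
        4 * S.α₃ * S.γ * S.Rb * (S.κ ⬝ᵥ S.G) ^ 2 * e s ^ 2
          + 4 * S.α₃ * S.γ * S.Rb * S.c ^ 2 * movAvg η d s ^ 2 := by
      have hk : 0 ≤ 2 * S.α₃ * S.γ * S.Rb := by positivity
      have := mul_le_mul_of_nonneg_left (show ((S.κ ⬝ᵥ S.G) * e s - S.c * movAvg η d s) ^ 2 ≤
        2 * ((S.κ ⬝ᵥ S.G) ^ 2 * e s ^ 2) + 2 * (S.c ^ 2 * movAvg η d s ^ 2) by
          nlinarith [sq_nonneg ((S.κ ⬝ᵥ S.G) * e s + S.c * movAvg η d s)]) hk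
      linarith
    have k5 : S.γ / S.τ * ∑ k ∈ Finset.range m, (ramp η s * rW k) ^ 2 ≤
        S.γ / S.τ * R * ramp η s ^ 2 := by
      have : ∑ k ∈ Finset.range m, (ramp η s * rW k) ^ 2 ≤ R * ramp η s ^ 2 := by
        simp only [mul_pow]
        rw [← Finset.mul_sum, mul_comm]
        exact mul_le_mul_of_nonneg_right (hR m) (sq_nonneg _)
      have := mul_le_mul_of_nonneg_left this (by positivity : 0 ≤ S.γ / S.τ)
      linarith
    simp only [hist]
    linarith
  linarith

end WeakSol
end ModalLMI

namespace ModalLMI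

variable {ι : Type} [Fintype ι] {S : ModalLMI ι}

theorem energy_mono (hlam : ∀ k, 0 ≤ S.lam k) (x : ι → ℝ) (w : ℕ → ℝ) :
    Monotone fun m => S.energy m x w := by
  have hγ := S.hγ
  intro m n hmn
  refine add_le_add le_rfl (mul_le_mul_of_nonneg_left ?_ hγ.le)
  exact Finset.sum_le_sum_of_subset_of_nonneg (Finset.range_mono hmn) fun k _ _ =>
    mul_nonneg (hlam k) (sq_nonneg _)

theorem hist_mono (x : ι → ℝ) (w : ℕ → ℝ) : Monotone fun m => S.hist m x w := by
  have hγ := S.hγ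
  have hα₁ := S.hα₁
  intro m n hmn
  refine add_le_add le_rfl (mul_le_mul_of_nonneg_left ?_ (by positivity))
  exact Finset.sum_le_sum_of_subset_of_nonneg (Finset.range_mono hmn) fun k _ _ => sq_nonneg _

namespace WeakSol

variable {x xh : ℝ → ι → ℝ} {w wh : ℕ → ℝ → ℝ} {d Z : ℝ → ℝ} {rX : ι → ℝ} {rW : ℕ → ℝ}

theorem avg_energy_le_of_tendsto (h : S.WeakSol x xh w wh d Z rX rW) (hRb : 0 ≤ S.Rb)
    (hσ : 0 ≤ S.σ) (hlam : ∀ k, 0 ≤ S.lam k) {Wh : ℝ → ℝ}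
    (hWh : Continuous Wh) (hWh_le : ∀ m t, ∑ k ∈ Finset.range m, wh k t ^ 2 ≤ Wh t) {V₀ R : ℝ}
    (hV₀ : ∀ m, S.energy m (x 0) (fun k => w k 0) ≤ V₀)
    (hR : ∀ m, ∑ k ∈ Finset.range m, rW k ^ 2 ≤ R) {η T : ℝ} (hη : 0 < η) (hη1 : η ≤ 1)
    (hT : 0 ≤ T) (n : ℕ) :
    Real.exp (2 * S.δ * T) * S.energy n (fun i => movAvg η (fun r => x r i) T)
        (fun k => movAvg η (w k) T)
      + ∫ s in (0 : ℝ)..T, Real.exp (2 * S.δ * s) * (S.σ * S.hist n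
          (fun i => movAvg η (fun r => x r i) s) (fun k => movAvg η (w k) s))
      ≤ V₀ + ∫ s in (0 : ℝ)..T, Real.exp (2 * S.δ * s) *
        (|S.c| * ((fun i => movAvg η (fun r => xh r i) s) ⬝ᵥ
            S.P *ᵥ (fun i => movAvg η (fun r => xh r i) s))
          + S.γ * S.α₁ * |S.c| * movAvg η Wh s
          + (2 * ((S.P *ᵥ S.G) ⬝ᵥ (S.P *ᵥ S.G)) / S.ν
              + 4 * S.α₃ * S.γ * S.Rb * (S.κ ⬝ᵥ S.G) ^ 2) * 0 ^ 2
          + (2 * ((S.P *ᵥ rX) ⬝ᵥ (S.P *ᵥ rX)) / S.ν + S.γ / S.τ * R) * ramp η s ^ 2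
          + 4 * S.α₃ * S.γ * S.Rb * S.c ^ 2 * movAvg η d s ^ 2) := by
  have cx : ∀ i, Continuous (movAvg η fun r => x r i) := fun i => continuous_movAvg (h.cont_x i) η
  have cxh : ∀ i, Continuous (movAvg η fun r => xh r i) :=
    fun i => continuous_movAvg (h.cont_xh i) η
  have cw : ∀ k, Continuous (movAvg η (w k)) := fun k => continuous_movAvg (h.cont_w k) η
  have cd := continuous_movAvg h.cont_d η
  have cWh := continuous_movAvg hWh η
  have lim := Filter.Tendsto.const_add V₀ <| BddTendsto.integral
    (BddTendsto.mul (BddTendsto.of_continuous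
      (f := fun s => Real.exp (2 * S.δ * s)) (by fun_prop))
    (((((BddTendsto.of_continuous (T := T) (f := fun s =>
        |S.c| * ((fun i => movAvg η (fun r => xh r i) s) ⬝ᵥ
            S.P *ᵥ (fun i => movAvg η (fun r => xh r i) s))
          + S.γ * S.α₁ * |S.c| * movAvg η Wh s)
        (by simp only [dotProduct, Matrix.mulVec]; fun_prop)).add
      ((h.bddTendsto_traceErr hη hη1 T).pow_two.const_mul
        (2 * ((S.P *ᵥ S.G) ⬝ᵥ (S.P *ᵥ S.G)) / S.ν
              + 4 * S.α₃ * S.γ * S.Rb * (S.κ ⬝ᵥ S.G) ^ 2)))).add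
      (BddTendsto.of_continuous (f := fun s => (2 * ((S.P *ᵥ rX) ⬝ᵥ (S.P *ᵥ rX)) / S.ν
        + S.γ / S.τ * R) * ramp η s ^ 2) (by unfold ramp; fun_prop))).add
      (BddTendsto.of_continuous (f := fun s => 4 * S.α₃ * S.γ * S.Rb * S.c ^ 2
        * movAvg η d s ^ 2) (by fun_prop)))) hT
  refine ge_of_tendsto lim ?_
  filter_upwards [Filter.eventually_ge_atTop n] with m hm
  refine le_trans ?_ (h.avg_energy_le hRb hWh hWh_le hV₀ hR hη hT m)
  refine add_le_add (mul_le_mul_of_nonneg_left (energy_mono hlam _ _ hm) (Real.exp_pos _).le) ?_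
  have cH := fun l => continuous_hist (S := S) cx cw l
  refine intervalIntegral.integral_mono_on hT (Continuous.intervalIntegrable ?_ _ _)
    (Continuous.intervalIntegrable ?_ _ _) fun s _ => mul_le_mul_of_nonneg_left
      (mul_le_mul_of_nonneg_left (hist_mono _ _ hm) hσ) (Real.exp_pos _).le
  · exact Continuous.mul (by fun_prop) (continuous_const.mul (cH n))
  · exact Continuous.mul (by fun_prop) (continuous_const.mul (cH m))

/-- The energy inequality of a solution of the modal system, in integrated form. -/
theorem energy_le (h : S.WeakSol x xh w wh d Z rX rW) (hRb : 0 ≤ S.Rb)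
    (hσ : 0 ≤ S.σ) (hlam : ∀ k, 0 ≤ S.lam k) {Wh : ℝ → ℝ}
    (hWh : Continuous Wh) (hWh_le : ∀ m t, ∑ k ∈ Finset.range m, wh k t ^ 2 ≤ Wh t) {V₀ : ℝ}
    (hV₀ : ∀ m, S.energy m (x 0) (fun k => w k 0) ≤ V₀) {T : ℝ} (hT : 0 ≤ T) (n : ℕ) :
    Real.exp (2 * S.δ * T) * S.energy n (x T) (fun k => w k T)
      + ∫ s in (0 : ℝ)..T, Real.exp (2 * S.δ * s) * (S.σ * S.hist n (x s) (fun k => w k s))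
      ≤ V₀ + ∫ s in (0 : ℝ)..T, Real.exp (2 * S.δ * s) *
        (|S.c| * (xh s ⬝ᵥ S.P *ᵥ xh s) + S.γ * S.α₁ * |S.c| * Wh s
          + 4 * S.α₃ * S.γ * S.Rb * S.c ^ 2 * d s ^ 2) := by
  obtain ⟨R, hR⟩ := h.rW_bdd
  set η : ℕ → ℝ := fun j => 1 / ((j : ℝ) + 1) with hη
  have η0 : ∀ j, 0 < η j := fun j => by positivity
  have η1 : ∀ j, η j ≤ 1 := fun j => by
    rw [hη, div_le_one (by positivity)]
    linarith [(Nat.cast_nonneg j : (0 : ℝ) ≤ j)]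
  have hE : Continuous fun s : ℝ => Real.exp (2 * S.δ * s) := by fun_prop
  have limR := Filter.Tendsto.const_add V₀ <| BddTendsto.integral
    ((BddTendsto.of_continuous (T := T) hE).mul
      ((((((bddTendsto_dot (S := S) fun i => BddTendsto.movAvg (h.cont_xh i)).const_mul |S.c|).add
        ((BddTendsto.movAvg hWh).const_mul (S.γ * S.α₁ * |S.c|))).add
      ((BddTendsto.of_continuous (f := fun _ => (0 : ℝ)) continuous_const).pow_two.const_mul
        (2 * ((S.P *ᵥ S.G) ⬝ᵥ (S.P *ᵥ S.G)) / S.ν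
              + 4 * S.α₃ * S.γ * S.Rb * (S.κ ⬝ᵥ S.G) ^ 2))).add
      (bddTendsto_ramp.pow_two.const_mul (2 * ((S.P *ᵥ rX) ⬝ᵥ (S.P *ᵥ rX)) / S.ν
        + S.γ / S.τ * R))).add
      ((BddTendsto.movAvg h.cont_d).pow_two.const_mul (4 * S.α₃ * S.γ * S.Rb * S.c ^ 2)))) hT
  have tE : Filter.Tendsto (fun j => S.energy n (fun i => movAvg (η j) (fun r => x r i) T)
      fun k => movAvg (η j) (w k) T) Filter.atTop (nhds (S.energy n (x T) fun k => w k T)) := by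
    have t1 := fun i => tendsto_movAvg (h.cont_x i) T
    have t2 := fun k => tendsto_movAvg (h.cont_w k) T
    simp only [energy, dotProduct, Matrix.mulVec]
    exact (tendsto_finsetSum _ fun i _ => (t1 i).mul (tendsto_finsetSum _ fun j _ =>
      (t1 j).const_mul _)).add ((tendsto_finsetSum _ fun k _ =>
        ((t2 k).pow 2).const_mul _).const_mul _)
  have bH : BddTendsto T (fun j s => S.hist n (fun i => movAvg (η j) (fun r => x r i) s)
      fun k => movAvg (η j) (w k) s) fun s => S.hist n (x s) fun k => w k s := by
    simp only [hist]
    exact ((bddTendsto_dot fun i => BddTendsto.movAvg (h.cont_x i)).const_mul _).add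
      ((BddTendsto.sum _ fun k => (BddTendsto.movAvg (h.cont_w k)).pow_two).const_mul _)
  have limL := (tE.const_mul (Real.exp (2 * S.δ * T))).add
    (((BddTendsto.of_continuous (T := T) hE).mul (bH.const_mul S.σ)).integral hT)
  have := le_of_tendsto_of_tendsto' limL limR fun j =>
    h.avg_energy_le_of_tendsto hRb hσ hlam hWh hWh_le hV₀ hR (η0 j) (η1 j) hT n
  simpa using this

end WeakSol
end ModalLMI

namespace ModalLMI.WeakSol

variable {ι : Type} [Fintype ι] {S : ModalLMI ι}
variable {x xh : ℝ → ι → ℝ} {w wh : ℕ → ℝ → ℝ} {d Z : ℝ → ℝ} {rX : ι → ℝ} {rW : ℕ → ℝ}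

/-- Exponential decay of the energy when `xh` and `wh` are delayed copies of `x` and `w`. -/
theorem exp_mul_energy_le (hs : S.WeakSol x xh w wh d Z rX rW) (hRb : 0 ≤ S.Rb)
    (hlam : ∀ k, 0 ≤ S.lam k) (hδ : 0 ≤ S.δ) {h : ℝ} (hh : 0 < h)
    (hσ : S.σ = Real.exp (2 * S.δ * h)) {W Wh : ℝ → ℝ} (hW : Continuous W) (hWh : Continuous Wh)
    (hWsum : ∀ t, HasSum (fun k => w k t ^ 2) (W t))
    (hWh_le : ∀ m t, ∑ k ∈ Finset.range m, wh k t ^ 2 ≤ Wh t)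
    (hxlate : ∀ s ≥ h, xh s = x (s - h)) (hWlate : ∀ s ≥ h, Wh s = W (s - h))
    (hdlate : ∀ s ≥ h, d s = 0) {V₀ B : ℝ} (hB0 : 0 ≤ B)
    (hB : ∀ s ∈ Icc 0 h, |S.c| * (xh s ⬝ᵥ S.P *ᵥ xh s) + S.γ * S.α₁ * |S.c| * Wh s
          + 4 * S.α₃ * S.γ * S.Rb * S.c ^ 2 * d s ^ 2 ≤ B)
    (hV₀ : ∀ m, S.energy m (x 0) (fun k => w k 0) ≤ V₀) {T : ℝ} (hT : 0 ≤ T) (n : ℕ) :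
    Real.exp (2 * S.δ * T) * S.energy n (x T) (fun k => w k T)
      ≤ V₀ + h * Real.exp (2 * S.δ * h) * B := by
  have hγ := S.hγ
  have hα₁ := S.hα₁
  have hσ0 : 0 ≤ S.σ := hσ ▸ (Real.exp_pos _).le
  set H : ℝ → ℝ := fun s => |S.c| * (x s ⬝ᵥ S.P *ᵥ x s) + S.γ * S.α₁ * |S.c| * W s with hH
  set g : ℝ → ℝ := fun s => |S.c| * (xh s ⬝ᵥ S.P *ᵥ xh s) + S.γ * S.α₁ * |S.c| * Wh s
          + 4 * S.α₃ * S.γ * S.Rb * S.c ^ 2 * d s ^ 2 with hg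
  have cE : Continuous fun s : ℝ => Real.exp (2 * S.δ * s) := by fun_prop
  have cx := hs.cont_x
  have cxh := hs.cont_xh
  have cd := hs.cont_d
  have cHx : Continuous H := by
    simp only [hH, dotProduct, Matrix.mulVec]
    fun_prop
  have cg : Continuous g := by
    simp only [hg, dotProduct, Matrix.mulVec]
    fun_prop
  have hW0 : ∀ s, 0 ≤ W s := fun s => (hWsum s).nonneg fun k => sq_nonneg _
  have H0 : ∀ s, 0 ≤ H s := fun s => by
    have := S.dot_nonneg (x s)
    have := hW0 s
    simp only [hH]
    positivity
  have hist_le : ∀ m s, S.hist m (x s) (fun k => w k s) ≤ H s := fun m s => by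
    refine add_le_add le_rfl (mul_le_mul_of_nonneg_left ?_ (by positivity))
    exact sum_le_hasSum _ (fun k _ => sq_nonneg _) (hWsum s)
  have hist_nonneg : ∀ m s, 0 ≤ S.hist m (x s) (fun k => w k s) := fun m s => by
    have := S.dot_nonneg (x s)
    have := Finset.sum_nonneg fun k (_ : k ∈ Finset.range m) => sq_nonneg (w k s)
    simp only [hist]
    positivity
  have bH : BddTendsto T (fun m s => S.hist m (x s) fun k => w k s) H := by
    refine ⟨fun m => continuous_hist cx hs.cont_w m, ?_, fun s _ => ?_⟩
    · obtain ⟨C, hC⟩ := isCompact_Icc.exists_bound_of_continuousOn (s := Icc 0 T)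
        cHx.continuousOn
      refine ⟨C, fun m s hsT => ?_⟩
      rw [abs_of_nonneg (hist_nonneg m s)]
      exact (hist_le m s).trans ((le_abs_self _).trans (hC s hsT))
    · exact ((hWsum s).tendsto_sum_nat.const_mul _).const_add _
  have key : Real.exp (2 * S.δ * T) * S.energy n (x T) (fun k => w k T)
      + S.σ * ∫ s in (0 : ℝ)..T, Real.exp (2 * S.δ * s) * H s
      ≤ V₀ + ∫ s in (0 : ℝ)..T, Real.exp (2 * S.δ * s) * g s := by
    have lim := (((BddTendsto.of_continuous (T := T) cE).mul
      (bH.const_mul S.σ)).integral hT).const_add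
        (Real.exp (2 * S.δ * T) * S.energy n (x T) (fun k => w k T))
    have e : ∀ s, Real.exp (2 * S.δ * s) * (S.σ * H s) = S.σ * (Real.exp (2 * S.δ * s) * H s) :=
      fun s => by ring
    simp only [e, intervalIntegral.integral_const_mul] at lim
    refine le_of_tendsto lim ?_
    filter_upwards [Filter.eventually_ge_atTop n] with m hm
    refine le_trans (add_le_add (mul_le_mul_of_nonneg_left (energy_mono hlam _ _ hm)
      (Real.exp_pos _).le) le_rfl) ?_
    simpa only [e, intervalIntegral.integral_const_mul, hg] using
      hs.energy_le hRb hσ0 hlam hWh hWh_le hV₀ hT m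
  have early : ∀ T' ∈ Icc 0 h, ∫ s in (0 : ℝ)..T', Real.exp (2 * S.δ * s) * g s ≤
      h * Real.exp (2 * S.δ * h) * B := by
    intro T' hT'
    have h1 : ∫ s in (0 : ℝ)..T', Real.exp (2 * S.δ * s) * g s ≤
        ∫ s in (0 : ℝ)..T', Real.exp (2 * S.δ * h) * B := by
      refine intervalIntegral.integral_mono_on hT'.1 ((cE.mul cg).intervalIntegrable _ _)
        (by simp) fun s hsT => ?_
      have hsh : s ≤ h := hsT.2.trans hT'.2
      refine (mul_le_mul_of_nonneg_left (hB s ⟨hsT.1, hsh⟩) (Real.exp_pos _).le).trans ?_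
      gcongr
    refine h1.trans ?_
    rw [intervalIntegral.integral_const, smul_eq_mul, sub_zero, mul_assoc h]
    exact mul_le_mul_of_nonneg_right hT'.2 (mul_nonneg (Real.exp_pos _).le hB0)
  have goal : ∫ s in (0 : ℝ)..T, Real.exp (2 * S.δ * s) * g s ≤
      h * Real.exp (2 * S.δ * h) * B + S.σ * ∫ s in (0 : ℝ)..T, Real.exp (2 * S.δ * s) * H s := by
    have i1 : ∀ a b : ℝ, IntervalIntegrable (fun s => Real.exp (2 * S.δ * s) * g s) volume a b :=
      fun a b => (cE.mul cg).intervalIntegrable a b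
    have i2 : ∀ a b : ℝ, IntervalIntegrable (fun s => Real.exp (2 * S.δ * s) * H s) volume a b :=
      fun a b => (cE.mul cHx).intervalIntegrable a b
    have p2 : ∀ a b : ℝ, a ≤ b → 0 ≤ ∫ s in a..b, Real.exp (2 * S.δ * s) * H s := fun a b hab =>
      intervalIntegral.integral_nonneg hab fun s _ => mul_nonneg (Real.exp_pos _).le (H0 s)
    rcases le_total T h with hTh | hTh
    · have := mul_nonneg hσ0 (p2 0 T hT)
      linarith [early T ⟨hT, hTh⟩]
    · rw [← intervalIntegral.integral_add_adjacent_intervals (i1 0 h) (i1 h T)]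
      refine add_le_add (early h ⟨hh.le, le_rfl⟩) ?_
      have e : ∫ s in h..T, Real.exp (2 * S.δ * s) * g s =
          ∫ s in h..T, (fun r => S.σ * (Real.exp (2 * S.δ * r) * H r)) (s - h) := by
        refine intervalIntegral.integral_congr fun s hsT => ?_
        rw [uIcc_of_le hTh] at hsT
        simp only [hg, hH, hxlate s hsT.1, hWlate s hsT.1, hdlate s hsT.1]
        rw [hσ, ← mul_assoc (Real.exp _) (Real.exp _), ← Real.exp_add]
        ring_nf
      rw [e, intervalIntegral.integral_comp_sub_right
        (fun r => S.σ * (Real.exp (2 * S.δ * r) * H r)) h, sub_self,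
        intervalIntegral.integral_const_mul]
      refine mul_le_mul_of_nonneg_left ?_ hσ0
      rw [← intervalIntegral.integral_add_adjacent_intervals (i2 0 (T - h)) (i2 (T - h) T)]
      linarith [p2 (T - h) T (by linarith)]
  linarith

end ModalLMI.WeakSol

theorem Matrix.dotProduct_mulVec_le {n : Type} [Fintype n] (M : Matrix n n ℝ) :
    ∃ C > 0, ∀ x, x ⬝ᵥ M *ᵥ x ≤ C * (x ⬝ᵥ x) := by
  refine ⟨∑ i, ∑ j, |M i j| + 1, by positivity, fun x => ?_⟩
  have h0 : 0 ≤ x ⬝ᵥ x := Finset.sum_nonneg fun i _ => mul_self_nonneg _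
  have key : ∀ i j, x i * (M i j * x j) ≤ |M i j| * (x ⬝ᵥ x) := by
    intro i j
    have hi : x i * x i ≤ x ⬝ᵥ x :=
      Finset.single_le_sum (f := fun i => x i * x i) (fun i _ => mul_self_nonneg _)
        (Finset.mem_univ i)
    have hj : x j * x j ≤ x ⬝ᵥ x :=
      Finset.single_le_sum (f := fun i => x i * x i) (fun i _ => mul_self_nonneg _)
        (Finset.mem_univ j)
    have h1 : |x i * x j| ≤ x ⬝ᵥ x := by
      rw [abs_le]
      constructor <;> nlinarith [sq_nonneg (x i + x j), sq_nonneg (x i - x j)]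
    calc x i * (M i j * x j) ≤ |x i * (M i j * x j)| := le_abs_self _
      _ = |M i j| * |x i * x j| := by rw [← abs_mul]; ring_nf
      _ ≤ _ := mul_le_mul_of_nonneg_left h1 (abs_nonneg _)
  calc x ⬝ᵥ M *ᵥ x = ∑ i, ∑ j, x i * (M i j * x j) := by
        simp only [dotProduct, Matrix.mulVec, Finset.mul_sum]
    _ ≤ ∑ i, ∑ j, |M i j| * (x ⬝ᵥ x) :=
        Finset.sum_le_sum fun i _ => Finset.sum_le_sum fun j _ => key i j
    _ = (∑ i, ∑ j, |M i j|) * (x ⬝ᵥ x) := by simp only [Finset.sum_mul]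
    _ ≤ _ := by linarith

theorem Matrix.PosDef.exists_coercive {n : Type} [Fintype n] {M : Matrix n n ℝ} (hM : M.PosDef) :
    ∃ C > 0, ∀ x, C * (x ⬝ᵥ x) ≤ x ⬝ᵥ M *ᵥ x := by
  have hc : IsCompact {x : n → ℝ | x ⬝ᵥ x = 1} := by
    refine Metric.isCompact_of_isClosed_isBounded
      (isClosed_eq (by simp only [dotProduct]; fun_prop) continuous_const) ?_
    refine Metric.isBounded_closedBall (x := (0 : n → ℝ)) (r := 1) |>.subset fun x hx => ?_
    rw [mem_closedBall_zero_iff, pi_norm_le_iff_of_nonneg zero_le_one]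
    intro i
    have hi : x i * x i ≤ x ⬝ᵥ x :=
      Finset.single_le_sum (f := fun i => x i * x i) (fun i _ => mul_self_nonneg _)
        (Finset.mem_univ i)
    rw [mem_ofPred_eq] at hx
    rw [Real.norm_eq_abs, ← sq_le_one_iff_abs_le_one]
    nlinarith
  have pos : ∀ x : n → ℝ, x ≠ 0 → 0 < x ⬝ᵥ M *ᵥ x := fun x hx => by
    simpa using hM.dotProduct_mulVec_pos hx
  rcases Set.eq_empty_or_nonempty {x : n → ℝ | x ⬝ᵥ x = 1} with he | hne
  · refine ⟨1, one_pos, fun x => ?_⟩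
    by_cases hx : x = 0
    · simp [hx]
    · exfalso
      have hp : 0 < x ⬝ᵥ x := by
        refine lt_of_le_of_ne (Finset.sum_nonneg fun i _ => mul_self_nonneg _) fun h => hx ?_
        exact dotProduct_self_eq_zero.1 h.symm
      have : (Real.sqrt (x ⬝ᵥ x))⁻¹ • x ∈ {x : n → ℝ | x ⬝ᵥ x = 1} := by
        rw [mem_ofPred_eq, smul_dotProduct, dotProduct_smul, smul_eq_mul, smul_eq_mul, ← mul_assoc,
          ← mul_inv, Real.mul_self_sqrt hp.le, inv_mul_cancel₀ hp.ne']
      rw [he] at this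
      exact this
  · obtain ⟨y, hy, hmin⟩ := hc.exists_isMinOn hne (f := fun x => x ⬝ᵥ M *ᵥ x)
      (by simp only [dotProduct, Matrix.mulVec]; fun_prop)
    refine ⟨y ⬝ᵥ M *ᵥ y, pos y ?_, fun x => ?_⟩
    · rintro rfl
      simp at hy
    · by_cases hx : x = 0
      · simp [hx]
      have hp : 0 < x ⬝ᵥ x := by
        refine lt_of_le_of_ne (Finset.sum_nonneg fun i _ => mul_self_nonneg _) fun h => hx ?_
        exact dotProduct_self_eq_zero.1 h.symm
      have h1 : (Real.sqrt (x ⬝ᵥ x))⁻¹ • x ∈ {x : n → ℝ | x ⬝ᵥ x = 1} := by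
        rw [mem_ofPred_eq, smul_dotProduct, dotProduct_smul, smul_eq_mul, smul_eq_mul, ← mul_assoc,
          ← mul_inv, Real.mul_self_sqrt hp.le, inv_mul_cancel₀ hp.ne']
      have h2 : y ⬝ᵥ M *ᵥ y ≤ ((Real.sqrt (x ⬝ᵥ x))⁻¹ • x) ⬝ᵥ M *ᵥ ((Real.sqrt (x ⬝ᵥ x))⁻¹ • x) :=
        hmin h1
      rw [Matrix.mulVec_smul, smul_dotProduct, dotProduct_smul, smul_eq_mul, smul_eq_mul,
        ← mul_assoc, ← mul_inv, Real.mul_self_sqrt hp.le, inv_mul_eq_div, le_div_iff₀ hp] at h2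
      exact h2

theorem sq_dotProduct_le {n : Type} [Fintype n] (x y : n → ℝ) :
    (x ⬝ᵥ y) ^ 2 ≤ (x ⬝ᵥ x) * (y ⬝ᵥ y) := by
  simpa only [dotProduct, sq] using Finset.sum_mul_sq_le_sq_mul_sq Finset.univ x y

theorem modes_le {β M γ cf qc r₂ Λ l ε R δ : ℝ} (hβ : 0 < β) (hM : 0 ≤ M) (hΛ : 0 < Λ)
    (hl : Λ ≤ l) (hε : ε ≤ 1 / 2) (hr₂ : 0 ≤ r₂)
    (h4 : 2 * γ * (-cf * Λ + qc) + β * M * Λ ^ ((1 : ℝ) / 2 + ε) + r₂ / Λ + 2 * δ * γ ≤ 0)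
    (h5 : 0 < 2 * γ * cf - β * M / Λ ^ ((1 : ℝ) / 2 - ε)) (hR : R ≤ r₂) :
    β * (M * l ^ ((3 : ℝ) / 2 + ε)) + γ * (-2 * cf * l ^ 2 + 2 * qc * l) + R + 2 * δ * (γ * l)
      ≤ 0 := by
  have hl0 : 0 < l := hΛ.trans_le hl
  set z : ℝ := -((1 : ℝ) / 2 - ε) with hz
  have e1 : l ^ ((3 : ℝ) / 2 + ε) = l ^ 2 * l ^ z := by
    rw [← Real.rpow_natCast, ← Real.rpow_add hl0, hz]
    norm_num
    ring_nf
  have e2 : Λ ^ ((1 : ℝ) / 2 + ε) = Λ * Λ ^ z := by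
    nth_rewrite 2 [← Real.rpow_one Λ]
    rw [← Real.rpow_add hΛ, hz]
    ring_nf
  have e3 : β * M / Λ ^ ((1 : ℝ) / 2 - ε) = β * M * Λ ^ z := by
    rw [hz, Real.rpow_neg hΛ.le, div_eq_mul_inv]
  have h6 : l ^ z ≤ Λ ^ z := Real.rpow_le_rpow_of_nonpos hΛ hl (by linarith)
  rw [e2] at h4
  rw [e3] at h5
  rw [e1]
  have h7 := mul_le_mul_of_nonneg_left h6 (by positivity : 0 ≤ β * M * l ^ 2)
  have h8 := mul_nonneg (mul_nonneg hl0.le (sub_nonneg.2 hl)) h5.le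
  have h9 := mul_le_mul_of_nonneg_left h4 hl0.le
  have h10 : r₂ ≤ l * (r₂ / Λ) := by
    rw [mul_div_assoc', le_div_iff₀ hΛ]
    nlinarith
  linarith

theorem psi_form_le {N₀ N : ℕ} {P Q1 F1m : Matrix (Fin N₀ ⊕ Fin N₀) (Fin N₀ ⊕ Fin N₀) ℝ}
    {Q2 F3m : Matrix (Fin (N - N₀)) (Fin (N - N₀)) ℝ}
    {F2m : Matrix (Fin N₀ ⊕ Fin N₀) (Fin (N - N₀)) ℝ} {l k : Fin N₀ ⊕ Fin N₀ → ℝ}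
    {c r₁ βs γ α₂ α₃ Ra Rb : ℝ} (hP : P.PosDef)
    (hPsi : (-(PsiM N₀ N P Q1 F1m Q2 F3m F2m l k (Erow N₀ N F1m F2m l k)
      c r₁ βs γ α₂ α₃ Ra Rb)).PosDef) (X : Fin N₀ ⊕ Fin N₀ → ℝ) (Y : Fin (N - N₀) → ℝ) (ζ : ℝ) :
    2 * (X ⬝ᵥ P *ᵥ (F1m *ᵥ X + F2m *ᵥ Y + ζ • l)) + |c| * (X ⬝ᵥ P *ᵥ X) + X ⬝ᵥ Q1 *ᵥ X
      + α₂ * γ * Ra * (k ⬝ᵥ X) ^ 2 + 2 * r₁ * (Y ⬝ᵥ F3m *ᵥ Y) + r₁ * |c| * (Y ⬝ᵥ Y)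
      + Y ⬝ᵥ Q2 *ᵥ Y + 2 * α₃ * γ * Rb * (k ⬝ᵥ (F1m *ᵥ X + F2m *ᵥ Y + ζ • l)) ^ 2
      ≤ βs * ζ ^ 2 := by
  have h := hPsi.posSemidef.dotProduct_mulVec_nonneg (Sum.elim (Sum.elim X Y) fun _ => ζ)
  have hPt : Pᵀ = P := by
    have := hP.1
    rwa [Matrix.IsHermitian, Matrix.conjTranspose_eq_transpose_of_trivial] at this
  have sym : ∀ U V, U ⬝ᵥ P *ᵥ V = V ⬝ᵥ P *ᵥ U := fun U V => by
    rw [Matrix.dotProduct_mulVec, dotProduct_comm, ← Matrix.mulVec_transpose, hPt]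
  have e1 : (Matrix.of fun (i : (Fin N₀ ⊕ Fin N₀) ⊕ Fin (N - N₀)) (_ : Unit) =>
      Sum.elim (P.mulVec l) (fun _ => 0) i) *ᵥ (fun _ => ζ) = ζ • Sum.elim (P *ᵥ l) fun _ => 0 := by
    funext i
    simp [Matrix.mulVec, dotProduct, mul_comm]
  have e2 : (Matrix.of fun (_ : Unit) (j : (Fin N₀ ⊕ Fin N₀) ⊕ Fin (N - N₀)) =>
      Sum.elim (P.mulVec l) (fun _ => 0) j) *ᵥ (Sum.elim X Y) = fun _ => P *ᵥ l ⬝ᵥ X := by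
    funext i
    simp [Matrix.mulVec, dotProduct]
  have e3 : (Matrix.of fun (_ _ : Unit) => -βs) *ᵥ (fun _ => ζ) = fun _ => -βs * ζ := by
    funext i
    simp [Matrix.mulVec, dotProduct]
  have e4 : Erow N₀ N F1m F2m l k ⬝ᵥ (Sum.elim (Sum.elim X Y) fun _ => ζ) =
      k ⬝ᵥ (F1m *ᵥ X + F2m *ᵥ Y + ζ • l) := by
    simp only [Erow, sumElim_dotProduct_sumElim, dotProduct_add, Matrix.dotProduct_mulVec,
      dotProduct_smul]
    simp [dotProduct, mul_comm]
  have e5 : ∀ U : Unit → ℝ, (fun _ : Unit => ζ) ⬝ᵥ U = ζ * U () := fun U => by simp [dotProduct]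
  have e6 : X ⬝ᵥ F1mᵀ *ᵥ P *ᵥ X = X ⬝ᵥ P *ᵥ F1m *ᵥ X := by
    rw [sym X, Matrix.mulVec_transpose, dotProduct_comm, ← Matrix.dotProduct_mulVec,
      dotProduct_comm]
  have e7 : Y ⬝ᵥ (P * F2m)ᵀ *ᵥ X = X ⬝ᵥ P *ᵥ F2m *ᵥ Y := by
    rw [Matrix.mulVec_transpose, dotProduct_comm, ← Matrix.dotProduct_mulVec, Matrix.mulVec_mulVec]
  rw [star_trivial, Matrix.neg_mulVec, dotProduct_neg, PsiM, Matrix.add_mulVec, dotProduct_add,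
    Matrix.smul_mulVec, dotProduct_smul, Matrix.vecMulVec_mulVec] at h
  simp only [Matrix.fromBlocks_mulVec, Sum.elim_comp_inl, Sum.elim_comp_inr,
    sumElim_dotProduct_sumElim, e1, e2, e3, e4, e5] at h
  have e8 : Y ⬝ᵥ (fun _ => (0 : ℝ)) = 0 := dotProduct_zero Y
  simp only [Matrix.add_mulVec, Matrix.smul_mulVec, Matrix.vecMulVec_mulVec, dotProduct_add,
    Matrix.one_mulVec, dotProduct_smul, smul_eq_mul, sumElim_dotProduct_sumElim, e6, e7,
    ← Matrix.mulVec_mulVec, op_smul_eq_smul, e8, Pi.add_apply] at h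
  rw [dotProduct_comm _ (Erow N₀ N F1m F2m l k), e4, dotProduct_comm X k,
    dotProduct_comm (P *ᵥ l) X] at h
  simp only [Matrix.mulVec_add, Matrix.mulVec_smul, dotProduct_add, dotProduct_smul,
    smul_eq_mul] at h ⊢
  linarith

/-- Index type of the finite-dimensional part of the closed-loop state. -/
abbrev StateIdx (N₀ N : ℕ) := (Fin N₀ ⊕ Fin N₀) ⊕ (Fin (N - N₀) ⊕ Fin (N - N₀))

/-- The weight matrix of the finite-dimensional part of the state. -/
def stateP {N₀ N : ℕ} (P : Matrix (Fin N₀ ⊕ Fin N₀) (Fin N₀ ⊕ Fin N₀) ℝ) (r₁ r : ℝ) :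
    Matrix (StateIdx N₀ N) (StateIdx N₀ N) ℝ :=
  Matrix.fromBlocks P 0 0 (Matrix.fromBlocks (r₁ • 1) 0 0 (r • 1))

/-- The dynamics of the finite-dimensional part of the state. -/
def stateF {N₀ N : ℕ} (F1m : Matrix (Fin N₀ ⊕ Fin N₀) (Fin N₀ ⊕ Fin N₀) ℝ)
    (F2m : Matrix (Fin N₀ ⊕ Fin N₀) (Fin (N - N₀)) ℝ) (d B : Fin (N - N₀) → ℝ)
    (k : Fin N₀ ⊕ Fin N₀ → ℝ) : Matrix (StateIdx N₀ N) (StateIdx N₀ N) ℝ :=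
  Matrix.fromBlocks F1m (Matrix.fromCols F2m 0) (Matrix.fromRows 0 (Matrix.vecMulVec B k))
    (Matrix.fromBlocks (Matrix.diagonal d) 0 0 (Matrix.diagonal d))

/-- Extension by zero of a vector to the finite-dimensional part of the state. -/
def stateV {N₀ N : ℕ} (v : Fin N₀ ⊕ Fin N₀ → ℝ) : StateIdx N₀ N → ℝ := Sum.elim v 0

section

variable {N₀ N : ℕ} (P : Matrix (Fin N₀ ⊕ Fin N₀) (Fin N₀ ⊕ Fin N₀) ℝ) (r₁ r : ℝ)
  (F1m : Matrix (Fin N₀ ⊕ Fin N₀) (Fin N₀ ⊕ Fin N₀) ℝ)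
  (F2m : Matrix (Fin N₀ ⊕ Fin N₀) (Fin (N - N₀)) ℝ) (d B : Fin (N - N₀) → ℝ)
  (k v : Fin N₀ ⊕ Fin N₀ → ℝ)
  (X X' : Fin N₀ ⊕ Fin N₀ → ℝ) (Y Y' W W' : Fin (N - N₀) → ℝ)

theorem stateP_dot : Sum.elim X (Sum.elim Y W) ⬝ᵥ stateP P r₁ r *ᵥ Sum.elim X' (Sum.elim Y' W') =
    X ⬝ᵥ P *ᵥ X' + (r₁ * (Y ⬝ᵥ Y') + r * (W ⬝ᵥ W')) := by
  simp only [stateP, Matrix.fromBlocks_mulVec, Sum.elim_comp_inl, Sum.elim_comp_inr,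
    sumElim_dotProduct_sumElim, Matrix.zero_mulVec, add_zero, zero_add, Matrix.smul_mulVec,
    Matrix.one_mulVec, dotProduct_smul, smul_eq_mul]

theorem stateF_mulVec : stateF F1m F2m d B k *ᵥ Sum.elim X (Sum.elim Y W) =
    Sum.elim (F1m *ᵥ X + F2m *ᵥ Y) (Sum.elim (fun i => d i * Y i)
      fun i => B i * (k ⬝ᵥ X) + d i * W i) := by
  simp only [stateF, Matrix.fromBlocks_mulVec, Sum.elim_comp_inl, Sum.elim_comp_inr,
    Matrix.fromCols_mulVec, Matrix.fromRows_mulVec, Matrix.zero_mulVec, add_zero, zero_add,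
    Matrix.vecMulVec_mulVec]
  congr 1
  funext i
  rcases i with i | i
  · simp [Matrix.mulVec_diagonal]
  · simp [Matrix.mulVec_diagonal, mul_comm]

theorem stateV_dot : stateV v ⬝ᵥ Sum.elim X (Sum.elim Y W) = v ⬝ᵥ X := by
  rw [stateV, sumElim_dotProduct_sumElim, zero_dotProduct, add_zero]

end

theorem dissip_le {N₀ N : ℕ} {P Q1 F1m : Matrix (Fin N₀ ⊕ Fin N₀) (Fin N₀ ⊕ Fin N₀) ℝ}
    {Q2 : Matrix (Fin (N - N₀)) (Fin (N - N₀)) ℝ}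
    {F2m : Matrix (Fin N₀ ⊕ Fin N₀) (Fin (N - N₀)) ℝ} {l k : Fin N₀ ⊕ Fin N₀ → ℝ}
    {d B : Fin (N - N₀) → ℝ} {c r₁ βs γ α₂ α₃ Ra Rb κ₀ C ϑ r ω ν : ℝ} (hP : P.PosDef) (hκ : 0 ≤ κ₀)
    (hPsi : (-(PsiM N₀ N P Q1 F1m Q2 (Matrix.diagonal d) F2m l k (Erow N₀ N F1m F2m l k)
      c r₁ βs γ α₂ α₃ Ra Rb)).PosDef)
    (hQ1 : ∀ X, κ₀ * (X ⬝ᵥ X) + |c| * (X ⬝ᵥ P *ᵥ X) ≤ X ⬝ᵥ Q1 *ᵥ X)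
    (hQ2 : ∀ Y, κ₀ * (Y ⬝ᵥ Y) + r₁ * |c| * (Y ⬝ᵥ Y) ≤ Y ⬝ᵥ Q2 *ᵥ Y)
    (hC : ∀ X, X ⬝ᵥ P *ᵥ X ≤ C * (X ⬝ᵥ X)) (hd : ∀ i, d i ≤ -(|c| + ω)) (hω : 0 < ω)
    (hr : 0 < r) (hϑ0 : 0 ≤ ϑ) (h1 : r * ((B ⬝ᵥ B) * (k ⬝ᵥ k)) ≤ κ₀ / 4 * ω)
    (h2 : ϑ * C ≤ κ₀ / 4) (h3 : ϑ * r₁ ≤ κ₀ / 4) (h4 : ϑ ≤ ω / 2) (h5 : ν ≤ κ₀ / 4)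
    (h6 : ν ≤ r * ω / 2) (x : StateIdx N₀ N → ℝ) (ζ : ℝ) :
    2 * (x ⬝ᵥ stateP P r₁ r *ᵥ (stateF F1m F2m d B k *ᵥ x + ζ • stateV l))
      + (2 * |c| + ϑ) * (x ⬝ᵥ stateP P r₁ r *ᵥ x)
      + α₂ * γ * Ra * (stateV k ⬝ᵥ x) ^ 2
      + 2 * α₃ * γ * Rb * (stateV k ⬝ᵥ (stateF F1m F2m d B k *ᵥ x + ζ • stateV l)) ^ 2
      + ν * (x ⬝ᵥ x) ≤ βs * ζ ^ 2 := by
  obtain ⟨X, Y, W, rfl⟩ : ∃ X Y W, x = Sum.elim X (Sum.elim Y W) :=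
    ⟨x ∘ Sum.inl, x ∘ Sum.inr ∘ Sum.inl, x ∘ Sum.inr ∘ Sum.inr, by
      funext i; rcases i with i | i | i <;> rfl⟩
  have eG : ζ • stateV (N := N) l = Sum.elim (ζ • l) (Sum.elim 0 0) := by
    funext i
    rcases i with i | i | i <;> simp [stateV]
  have eF : stateF F1m F2m d B k *ᵥ Sum.elim X (Sum.elim Y W) + ζ • stateV l =
      Sum.elim (F1m *ᵥ X + F2m *ᵥ Y + ζ • l) (Sum.elim (fun i => d i * Y i)
      fun i => B i * (k ⬝ᵥ X) + d i * W i) := by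
    rw [stateF_mulVec, eG]
    funext i
    rcases i with i | i | i <;> simp
  rw [eF, stateP_dot, stateP_dot, stateV_dot, stateV_dot, sumElim_dotProduct_sumElim,
    sumElim_dotProduct_sumElim]
  have key := psi_form_le hP hPsi X Y ζ
  have eY : Y ⬝ᵥ Matrix.diagonal d *ᵥ Y = Y ⬝ᵥ fun i => d i * Y i := by
    congr 1
    funext i
    rw [Matrix.mulVec_diagonal]
  rw [eY] at key
  have eW : (W ⬝ᵥ fun i => B i * (k ⬝ᵥ X) + d i * W i) =
      (W ⬝ᵥ B) * (k ⬝ᵥ X) + W ⬝ᵥ fun i => d i * W i := by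
    simp only [dotProduct, mul_add, Finset.sum_add_distrib, Finset.sum_mul, mul_assoc]
  have hWd : (W ⬝ᵥ fun i => d i * W i) ≤ -(|c| + ω) * (W ⬝ᵥ W) := by
    simp only [dotProduct, Finset.mul_sum]
    refine Finset.sum_le_sum fun i _ => ?_
    nlinarith [mul_le_mul_of_nonneg_right (hd i) (mul_self_nonneg (W i))]
  have hX0 : 0 ≤ X ⬝ᵥ X := Finset.sum_nonneg fun i _ => mul_self_nonneg _
  have hY0 : 0 ≤ Y ⬝ᵥ Y := Finset.sum_nonneg fun i _ => mul_self_nonneg _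
  have hW0 : 0 ≤ W ⬝ᵥ W := Finset.sum_nonneg fun i _ => mul_self_nonneg _
  have cross : 2 * ((W ⬝ᵥ B) * (k ⬝ᵥ X)) ≤
      ω * (W ⬝ᵥ W) + (B ⬝ᵥ B) * (k ⬝ᵥ k) * (X ⬝ᵥ X) / ω := by
    have a1 := sq_dotProduct_le W B
    have a2 := sq_dotProduct_le k X
    have hB0 : 0 ≤ B ⬝ᵥ B := Finset.sum_nonneg fun i _ => mul_self_nonneg _
    have hk0 : 0 ≤ k ⬝ᵥ k := Finset.sum_nonneg fun i _ => mul_self_nonneg _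
    have a3 : ((W ⬝ᵥ B) * (k ⬝ᵥ X)) ^ 2 ≤ (W ⬝ᵥ W) * ((B ⬝ᵥ B) * (k ⬝ᵥ k) * (X ⬝ᵥ X)) := by
      rw [mul_pow]
      refine (mul_le_mul a1 a2 (sq_nonneg _) (by positivity)).trans_eq (by ring)
    set m := (B ⬝ᵥ B) * (k ⬝ᵥ k) * (X ⬝ᵥ X) with hm
    have hm0 : 0 ≤ m := by positivity
    have a4 : (2 * ((W ⬝ᵥ B) * (k ⬝ᵥ X))) ^ 2 ≤ (ω * (W ⬝ᵥ W) + m / ω) ^ 2 := by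
      have : ω * (W ⬝ᵥ W) * (m / ω) = (W ⬝ᵥ W) * m := by field_simp
      nlinarith [sq_nonneg (ω * (W ⬝ᵥ W) - m / ω)]
    exact (le_abs_self _).trans (abs_le_of_sq_le_sq a4 (by positivity))
  have q1 := hQ1 X
  have q2 := hQ2 Y
  have c1 := mul_le_mul_of_nonneg_left cross hr.le
  have c2 : r * ((B ⬝ᵥ B) * (k ⬝ᵥ k) * (X ⬝ᵥ X) / ω) ≤ κ₀ / 4 * (X ⬝ᵥ X) := by
    rw [mul_div_assoc', div_le_iff₀ hω]
    nlinarith [mul_le_mul_of_nonneg_right h1 hX0]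
  have c3 := mul_le_mul_of_nonneg_left (hC X) hϑ0
  have c4 := mul_le_mul_of_nonneg_right h2 hX0
  have c5 := mul_le_mul_of_nonneg_right h3 hY0
  have c6 := mul_le_mul_of_nonneg_right (mul_le_mul_of_nonneg_left h4 hr.le) hW0
  have c7 := mul_le_mul_of_nonneg_right h5 hX0
  have c8 := mul_le_mul_of_nonneg_right h5 hY0
  have c9 := mul_le_mul_of_nonneg_right h6 hW0
  have c10 := mul_le_mul_of_nonneg_left hWd hr.le
  have c11 := mul_nonneg hκ hX0
  have c12 := mul_nonneg hκ hY0
  rw [eW]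
  linarith

theorem stateP_posDef {N₀ N : ℕ} {P : Matrix (Fin N₀ ⊕ Fin N₀) (Fin N₀ ⊕ Fin N₀) ℝ} (hP : P.PosDef)
    {r₁ r : ℝ} (hr₁ : 0 < r₁) (hr : 0 < r) : (stateP (N := N) P r₁ r).PosDef := by
  refine Matrix.PosDef.of_dotProduct_mulVec_pos ?_ fun x hx => ?_
  · rw [Matrix.IsHermitian, stateP, Matrix.fromBlocks_conjTranspose,
      Matrix.fromBlocks_conjTranspose,
      hP.1.eq]
    simp
  · obtain ⟨X, Y, W, rfl⟩ : ∃ X Y W, x = Sum.elim X (Sum.elim Y W) :=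
      ⟨x ∘ Sum.inl, x ∘ Sum.inr ∘ Sum.inl, x ∘ Sum.inr ∘ Sum.inr, by
        funext i; rcases i with i | i | i <;> rfl⟩
    rw [star_trivial, stateP_dot]
    have hY : 0 ≤ Y ⬝ᵥ Y := Finset.sum_nonneg fun i _ => mul_self_nonneg _
    have hW : 0 ≤ W ⬝ᵥ W := Finset.sum_nonneg fun i _ => mul_self_nonneg _
    have hX := hP.posSemidef.dotProduct_mulVec_nonneg X
    rw [star_trivial] at hX
    by_contra hcon
    have h1 : X ⬝ᵥ P *ᵥ X = 0 := by nlinarith [mul_nonneg hr₁.le hY, mul_nonneg hr.le hW]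
    have h2 : Y ⬝ᵥ Y = 0 := by nlinarith [mul_nonneg hr₁.le hY, mul_nonneg hr.le hW]
    have h3 : W ⬝ᵥ W = 0 := by nlinarith [mul_nonneg hr₁.le hY, mul_nonneg hr.le hW]
    have hX0 : X = 0 := by
      by_contra hne
      have := hP.dotProduct_mulVec_pos hne
      rw [star_trivial] at this
      linarith
    rw [dotProduct_self_eq_zero] at h2 h3
    subst hX0 h2 h3
    exact hx (by funext i; rcases i with i | i | i <;> rfl)

theorem exists_modalLMI {N₀ N : ℕ} {P Q1 F1m : Matrix (Fin N₀ ⊕ Fin N₀) (Fin N₀ ⊕ Fin N₀) ℝ}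
    {Q2 : Matrix (Fin (N - N₀)) (Fin (N - N₀)) ℝ}
    {F2m : Matrix (Fin N₀ ⊕ Fin N₀) (Fin (N - N₀)) ℝ} {l k : Fin N₀ ⊕ Fin N₀ → ℝ}
    {d : Fin (N - N₀) → ℝ} (B : Fin (N - N₀) → ℝ)
    {c qc r₁ r₂ βs γ α₁ α₂ α₃ α₄ cf Ra Rb M ε s ω : ℝ}
    {lam a b φ : ℕ → ℝ} (hc : c ≠ 0) (hP : P.PosDef) (hr₁ : 0 < r₁) (hr₂ : 0 < r₂) (hβs : 0 < βs)
    (hγ : 0 < γ) (hα₁ : 0 < α₁) (hα₂ : 0 < α₂) (hα₃ : 0 < α₃) (hα₄ : 0 < α₄)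
    (hcf : cf = 1 - (|c| / α₁ + 1 / α₂ + 1 / α₃ + |c| / α₄) / 2)
    (hPsi : (-(PsiM N₀ N P Q1 F1m Q2 (Matrix.diagonal d) F2m l k (Erow N₀ N F1m F2m l k)
      c r₁ βs γ α₂ α₃ Ra Rb)).PosDef)
    (hT1 : (-(|c| • P - Q1 + s • Matrix.vecMulVec k k)).PosDef) (hs : 0 ≤ s)
    (hT2 : (-(Theta2 N₀ N Q2 r₁ c)).PosDef) (hT3 : γ * α₁ * |c| - r₂ < 0)
    (hω : 0 < ω) (hd : ∀ i, d i ≤ -(|c| + ω)) {Λ : ℝ} (hΛ : 0 < Λ) (hlam : ∀ n, Λ ≤ lam n)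
    (hε : ε ≤ 1 / 2)
    (hT4 : 2 * γ * (-cf * Λ + qc) + βs * M * Λ ^ ((1 : ℝ) / 2 + ε) + r₂ / Λ < 0)
    (hT5 : 0 < 2 * γ * cf - βs * M / Λ ^ ((1 : ℝ) / 2 - ε))
    (hM : HasSum (fun n => φ n ^ 2 / lam n ^ ((3 : ℝ) / 2 + ε)) M)
    (ha : ∀ m, ∑ n ∈ Finset.range m, a n ^ 2 ≤ Ra)
    (hb : ∀ m, ∑ n ∈ Finset.range m, b n ^ 2 ≤ Rb) {h : ℝ} (hh : 0 < h) :
    ∃ δ > 0, ∃ r > 0, ∃ S : ModalLMI (StateIdx N₀ N), S.c = c ∧ S.qc = qc ∧ S.γ = γ ∧ S.δ = δ ∧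
      S.σ = Real.exp (2 * δ * h) ∧ S.α₁ = α₁ ∧ S.α₃ = α₃ ∧ S.Rb = Rb ∧ S.P = stateP P r₁ r ∧
      S.F = stateF F1m F2m d B k ∧ S.G = stateV l ∧ S.κ = stateV k ∧ S.lam = lam ∧ S.a = a ∧
      S.b = b ∧ S.φ = φ := by
  obtain ⟨κ₁, hκ₁, h1⟩ := hT1.exists_coercive
  obtain ⟨κ₂, hκ₂, h2⟩ := hT2.exists_coercive
  obtain ⟨C, hC0, hC⟩ := P.dotProduct_mulVec_le
  set κ₀ := min κ₁ κ₂ with hκ₀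
  have hκ : 0 < κ₀ := lt_min hκ₁ hκ₂
  have hQ1 : ∀ X, κ₀ * (X ⬝ᵥ X) + |c| * (X ⬝ᵥ P *ᵥ X) ≤ X ⬝ᵥ Q1 *ᵥ X := by
    intro X
    have e := h1 X
    have e0 : κ₀ * (X ⬝ᵥ X) ≤ κ₁ * (X ⬝ᵥ X) :=
      mul_le_mul_of_nonneg_right (min_le_left _ _) (Finset.sum_nonneg fun i _ => mul_self_nonneg _)
    simp only [Matrix.neg_mulVec, Matrix.add_mulVec, Matrix.sub_mulVec, Matrix.smul_mulVec,
      dotProduct_neg, dotProduct_add, dotProduct_sub, dotProduct_smul, smul_eq_mul,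
      Matrix.vecMulVec_mulVec, op_smul_eq_mul] at e
    rw [dotProduct_comm X k] at e
    nlinarith [mul_nonneg hs (mul_self_nonneg (k ⬝ᵥ X))]
  have hQ2 : ∀ Y, κ₀ * (Y ⬝ᵥ Y) + r₁ * |c| * (Y ⬝ᵥ Y) ≤ Y ⬝ᵥ Q2 *ᵥ Y := by
    intro X
    have e := h2 X
    have e0 : κ₀ * (X ⬝ᵥ X) ≤ κ₂ * (X ⬝ᵥ X) :=
      mul_le_mul_of_nonneg_right (min_le_right _ _) (Finset.sum_nonneg fun i _ => mul_self_nonneg _)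
    simp only [Theta2, Matrix.neg_mulVec, Matrix.sub_mulVec, Matrix.smul_mulVec,
      dotProduct_neg, dotProduct_sub, dotProduct_smul, smul_eq_mul, Matrix.one_mulVec] at e
    linarith
  have hBB : 0 ≤ (B ⬝ᵥ B) * (k ⬝ᵥ k) := mul_nonneg
    (Finset.sum_nonneg fun i _ => mul_self_nonneg _)
    (Finset.sum_nonneg fun i _ => mul_self_nonneg _)
  set r := κ₀ / 4 * ω / ((B ⬝ᵥ B) * (k ⬝ᵥ k) + 1) with hr
  have hr0 : 0 < r := by positivity
  have hrB : r * ((B ⬝ᵥ B) * (k ⬝ᵥ k)) ≤ κ₀ / 4 * ω := by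
    rw [hr, div_mul_eq_mul_div, div_le_iff₀ (by positivity)]
    nlinarith [mul_pos hκ hω]
  have small : ∀ {f : ℝ → ℝ} {y : ℝ}, Continuous f → f 0 < y →
      ∀ᶠ δ in nhdsWithin (0 : ℝ) (Ioi 0), f δ ≤ y := fun {f} {y} hf hy =>
    (((hf.tendsto 0).mono_left nhdsWithin_le_nhds).eventually
      (gt_mem_nhds hy)).mono fun _ => le_of_lt
  have ev : ∀ᶠ δ in nhdsWithin (0 : ℝ) (Ioi 0),
      ((Real.exp (2 * δ * h) - 1) * |c| + 2 * δ) * C ≤ κ₀ / 4 ∧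
      ((Real.exp (2 * δ * h) - 1) * |c| + 2 * δ) * r₁ ≤ κ₀ / 4 ∧
      ((Real.exp (2 * δ * h) - 1) * |c| + 2 * δ) ≤ ω / 2 ∧
      Real.exp (2 * δ * h) * (γ * α₁ * |c|) ≤ r₂ ∧
      2 * γ * (-cf * Λ + qc) + βs * M * Λ ^ ((1 : ℝ) / 2 + ε) + r₂ / Λ + 2 * δ * γ ≤ 0 := by
    refine (small (by fun_prop) ?_).and ((small (by fun_prop) ?_).and ((small (by fun_prop) ?_).and
      ((small (by fun_prop) ?_).and (small (by fun_prop) ?_))))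
    · simpa using hκ
    · simpa using hκ
    · simpa using hω
    · simp only [mul_zero, zero_mul, Real.exp_zero]; linarith
    · simpa using hT4
  obtain ⟨δ, ⟨e1, e2, e3, e4, e5⟩, hδ⟩ := (ev.and self_mem_nhdsWithin).exists
  have hδ0 : 0 < δ := hδ
  have hϑ : 0 ≤ (Real.exp (2 * δ * h) - 1) * |c| + 2 * δ := by
    have : 1 ≤ Real.exp (2 * δ * h) := Real.one_le_exp (by positivity)
    have := mul_nonneg (sub_nonneg.2 this) (abs_nonneg c)
    linarith
  have hM0 : 0 ≤ M := hM.nonneg fun n => div_nonneg (sq_nonneg _)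
    (Real.rpow_nonneg (hΛ.le.trans (hlam n)) _)
  refine ⟨δ, hδ0, r, hr0, {
    c := c, qc := qc, γ := γ, δ := δ, σ := Real.exp (2 * δ * h), ν := min (κ₀ / 4) (r * ω / 2)
    β := βs, α₁ := α₁, α₂ := α₂, α₃ := α₃, τ := |c| / α₄, Ra := Ra, Rb := Rb
    P := stateP P r₁ r, F := stateF F1m F2m d B k, G := stateV l, κ := stateV k
    lam := lam, a := a, b := b, φ := φ, μ := fun n => M * lam n ^ ((3 : ℝ) / 2 + ε)
    hγ := hγ, hν := lt_min (by positivity) (by positivity), hβ := hβs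
    hα₁ := hα₁, hα₂ := hα₂, hα₃ := hα₃, hτ := div_pos (abs_pos.2 hc) hα₄
    psd := (stateP_posDef hP hr₁ hr0).posSemidef
    trace_le := ?_, a_le := ha, b_le := hb, dissip := ?_, modes := ?_ },
    rfl, rfl, rfl, rfl, rfl, rfl, rfl, rfl, rfl, rfl, rfl, rfl, rfl, rfl, rfl, rfl⟩
  · intro m w
    have hl : ∀ n, 0 < lam n ^ ((3 : ℝ) / 2 + ε) := fun n =>
      Real.rpow_pos_of_pos (hΛ.trans_le (hlam n)) _
    have cs := Finset.sum_mul_sq_le_sq_mul_sq (Finset.range m)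
      (fun n => φ n / √(lam n ^ ((3 : ℝ) / 2 + ε))) (fun n => √(lam n ^ ((3 : ℝ) / 2 + ε)) * w n)
    simp only [mul_pow, div_pow, Real.sq_sqrt (hl _).le] at cs
    have e : ∀ n, φ n / √(lam n ^ ((3 : ℝ) / 2 + ε)) * (√(lam n ^ ((3 : ℝ) / 2 + ε)) * w n)
        = φ n * w n := fun n => by
      rw [← mul_assoc, div_mul_cancel₀ _ (Real.sqrt_pos.2 (hl n)).ne']
    simp only [e] at cs
    refine cs.trans ((mul_le_mul_of_nonneg_right (hM.summable.sum_le_tsum _ fun n _ => ?_)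
      (Finset.sum_nonneg fun n _ => mul_nonneg (hl n).le (sq_nonneg _))).trans_eq ?_)
    · exact div_nonneg (sq_nonneg _) (hl n).le
    · rw [hM.tsum_eq, Finset.mul_sum]
      exact Finset.sum_congr rfl fun n _ => by ring
  · intro x ζ
    have := dissip_le hP hκ.le hPsi hQ1 hQ2 hC hd hω hr0 hϑ hrB e1 e2 e3 (min_le_left _ (r * ω / 2))
      (min_le_right (κ₀ / 4) _) x ζ
    refine le_trans (le_of_eq ?_) this
    ring
  · intro n
    have := modes_le hβs hM0 hΛ (hlam n) hε hr₂.le e5 hT5 e4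
    refine le_trans (le_of_eq ?_) this
    rw [hcf]
    ring

/-- The Sturm–Liouville differential expression on `[0,1]`. -/
def LOp (p q f : ℝ → ℝ) (x : ℝ) : ℝ := -(dI (fun y => p y * dI f y) x) + q x * f x

section interval

variable {f g p q : ℝ → ℝ}

theorem hasDerivWithinAt_dI (hf : ContDiffOn ℝ 1 f (Icc 0 1)) {x : ℝ} (hx : x ∈ Icc (0 : ℝ) 1) :
    HasDerivWithinAt f (dI f x) (Icc 0 1) x :=
  (hf.differentiableOn one_ne_zero x hx).hasDerivWithinAt

theorem HasDerivWithinAt.dI_eq {x f' : ℝ} (hx : x ∈ Icc (0 : ℝ) 1)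
    (h : HasDerivWithinAt f f' (Icc 0 1) x) : dI f x = f' :=
  h.derivWithin (uniqueDiffOn_Icc zero_lt_one x hx)

theorem contDiffOn_dI (hf : ContDiffOn ℝ 2 f (Icc 0 1)) : ContDiffOn ℝ 1 (dI f) (Icc 0 1) :=
  hf.derivWithin (uniqueDiffOn_Icc zero_lt_one) (by norm_num)

theorem continuousOn_dI (hf : ContDiffOn ℝ 1 f (Icc 0 1)) :
    ContinuousOn (dI f) (Icc 0 1) :=
  hf.continuousOn_derivWithin (uniqueDiffOn_Icc zero_lt_one) le_rfl

theorem ContinuousOn.ii (hf : ContinuousOn f (Icc 0 1)) : IntervalIntegrable f volume 0 1 := by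
  refine ContinuousOn.intervalIntegrable ?_
  rwa [uIcc_of_le zero_le_one]

theorem ip_comm (f g : ℝ → ℝ) : ip f g = ip g f := by
  simp only [ip, mul_comm]

theorem ip_congr {f' g' : ℝ → ℝ} (hf : ∀ x ∈ Icc (0 : ℝ) 1, f x = f' x)
    (hg : ∀ x ∈ Icc (0 : ℝ) 1, g x = g' x) : ip f g = ip f' g' := by
  refine intervalIntegral.integral_congr fun x hx => ?_
  rw [uIcc_of_le zero_le_one] at hx
  simp only [hf x hx, hg x hx]

theorem ip_add_left {f' : ℝ → ℝ} (hf : ContinuousOn f (Icc 0 1)) (hf' : ContinuousOn f' (Icc 0 1))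
    (hg : ContinuousOn g (Icc 0 1)) : ip (fun x => f x + f' x) g = ip f g + ip f' g := by
  simp only [ip, add_mul]
  exact intervalIntegral.integral_add (hf.mul hg).ii (hf'.mul hg).ii

theorem ip_const_mul_left (r : ℝ) : ip (fun x => r * f x) g = r * ip f g := by
  simp only [ip, mul_assoc, intervalIntegral.integral_const_mul]

theorem ip_add_right {g' : ℝ → ℝ} (hf : ContinuousOn f (Icc 0 1)) (hg : ContinuousOn g (Icc 0 1))
    (hg' : ContinuousOn g' (Icc 0 1)) : ip f (fun x => g x + g' x) = ip f g + ip f g' := by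
  rw [ip_comm, ip_add_left hg hg' hf, ip_comm g, ip_comm g']

theorem ip_const_mul_right (r : ℝ) : ip f (fun x => r * g x) = r * ip f g := by
  rw [ip_comm, ip_const_mul_left, ip_comm]

theorem ip_self (f : ℝ → ℝ) : ip f f = ∫ x in (0 : ℝ)..1, f x ^ 2 := by
  simp only [ip, sq]

theorem ip_self_nonneg (f : ℝ → ℝ) : 0 ≤ ip f f :=
  intervalIntegral.integral_nonneg zero_le_one fun _ _ => mul_self_nonneg _

theorem ip_dI_left (hf : ContDiffOn ℝ 1 f (Icc 0 1)) (hg : ContDiffOn ℝ 1 g (Icc 0 1)) :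
    ip (dI f) g = f 1 * g 1 - f 0 * g 0 - ip f (dI g) := by
  have hu : uIcc (0 : ℝ) 1 = Icc 0 1 := uIcc_of_le zero_le_one
  have := intervalIntegral.integral_deriv_mul_eq_sub_of_hasDeriv_right (u := f) (v := g)
    (u' := dI f) (v' := dI g) (a := 0) (b := 1) (by rw [hu]; exact hf.continuousOn)
    (by rw [hu]; exact hg.continuousOn)
    (fun x hx => ((hasDerivWithinAt_dI hf (by simpa using Ioo_subset_Icc_self hx)).hasDerivAt
      (Icc_mem_nhds (by simpa using hx.1) (by simpa using hx.2))).hasDerivWithinAt)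
    (fun x hx => ((hasDerivWithinAt_dI hg (by simpa using Ioo_subset_Icc_self hx)).hasDerivAt
      (Icc_mem_nhds (by simpa using hx.1) (by simpa using hx.2))).hasDerivWithinAt)
    (continuousOn_dI hf).ii (continuousOn_dI hg).ii
  rw [intervalIntegral.integral_add ((continuousOn_dI hf).fun_mul hg.continuousOn).ii
    (hf.continuousOn.fun_mul (continuousOn_dI hg)).ii] at this
  simp only [ip]
  linarith

theorem contDiffOn_flux (hp : ContDiffOn ℝ 1 p (Icc 0 1)) (hf : ContDiffOn ℝ 2 f (Icc 0 1)) :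
    ContDiffOn ℝ 1 (fun y => p y * dI f y) (Icc 0 1) := hp.mul (contDiffOn_dI hf)

theorem continuousOn_LOp (hp : ContDiffOn ℝ 1 p (Icc 0 1)) (hq : ContinuousOn q (Icc 0 1))
    (hf : ContDiffOn ℝ 2 f (Icc 0 1)) : ContinuousOn (LOp p q f) (Icc 0 1) :=
  (continuousOn_dI (contDiffOn_flux hp hf)).neg.add (hq.mul hf.continuousOn)

theorem ip_LOp_left (hp : ContDiffOn ℝ 1 p (Icc 0 1)) (hq : ContinuousOn q (Icc 0 1))
    (hf : ContDiffOn ℝ 2 f (Icc 0 1)) (hg : ContDiffOn ℝ 1 g (Icc 0 1)) :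
    ip (LOp p q f) g = (∫ x in (0 : ℝ)..1, (p x * (dI f x * dI g x) + q x * (f x * g x)))
      + p 0 * dI f 0 * g 0 - p 1 * dI f 1 * g 1 := by
  have hfl := contDiffOn_flux hp hf
  have h := ip_dI_left hfl hg
  have e : ip (LOp p q f) g = -ip (dI fun y => p y * dI f y) g
      + ∫ x in (0 : ℝ)..1, q x * (f x * g x) := by
    simp only [ip, ← intervalIntegral.integral_neg]
    have h1 : ContinuousOn (fun x => -(dI (fun y => p y * dI f y) x * g x)) (Icc 0 1) :=
      ((continuousOn_dI hfl).mul hg.continuousOn).neg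
    have h2 : ContinuousOn (fun x => q x * (f x * g x)) (Icc 0 1) :=
      hq.mul (hf.continuousOn.mul hg.continuousOn)
    rw [← intervalIntegral.integral_add h1.ii h2.ii]
    exact intervalIntegral.integral_congr fun x _ => by simp only [LOp]; ring
  have e2 : ip (fun y => p y * dI f y) (dI g) = ∫ x in (0 : ℝ)..1, p x * (dI f x * dI g x) := by
    simp only [ip, mul_assoc]
  rw [e, h, e2, intervalIntegral.integral_add
    (hp.continuousOn.fun_mul ((contDiffOn_dI hf).continuousOn.fun_mul (continuousOn_dI hg))).ii
    (hq.fun_mul (hf.continuousOn.fun_mul hg.continuousOn)).ii]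
  ring

theorem ip_LOp_comm (hp : ContDiffOn ℝ 1 p (Icc 0 1)) (hq : ContinuousOn q (Icc 0 1))
    (hf : ContDiffOn ℝ 2 f (Icc 0 1)) (hg : ContDiffOn ℝ 2 g (Icc 0 1)) :
    ip (LOp p q f) g = ip f (LOp p q g) + p 0 * (dI f 0 * g 0 - f 0 * dI g 0)
      - p 1 * (dI f 1 * g 1 - f 1 * dI g 1) := by
  rw [ip_comm f, ip_LOp_left hp hq hf (hg.of_le (by norm_num)),
    ip_LOp_left hp hq hg (hf.of_le (by norm_num))]
  have : (∫ x in (0 : ℝ)..1, (p x * (dI f x * dI g x) + q x * (f x * g x))) =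
      ∫ x in (0 : ℝ)..1, (p x * (dI g x * dI f x) + q x * (g x * f x)) := by
    simp only [mul_comm]
  rw [this]
  ring

theorem sq_ip_le (hf : ContinuousOn f (Icc 0 1)) (hg : ContinuousOn g (Icc 0 1)) :
    ip f g ^ 2 ≤ ip f f * ip g g := by
  have key : ∀ r : ℝ, 0 ≤ ip g g * (r * r) + 2 * ip f g * r + ip f f := by
    intro r
    have h := ip_self_nonneg fun x => f x + r * g x
    have hrg : ContinuousOn (fun x => r * g x) (Icc 0 1) := continuousOn_const.mul hg
    rw [ip_add_left hf hrg (hf.fun_add hrg), ip_add_right hf hf hrg, ip_add_right hrg hf hrg,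
      ip_const_mul_left, ip_const_mul_left, ip_const_mul_right, ip_const_mul_right,
      ip_comm g f] at h
    linarith
  have := discrim_le_zero key
  rw [discrim] at this
  nlinarith

end interval

/-- The eigenstructure of a regular Sturm–Liouville operator with Robin boundary conditions. -/
structure SturmLiouville (p q : ℝ → ℝ) (θ₁ θ₂ : ℝ) (lam : ℕ → ℝ) (phi : ℕ → ℝ → ℝ) : Prop where
  hθ₁ : θ₁ ∈ Set.Ico 0 (π / 2)
  hθ₂ : θ₂ ∈ Set.Icc 0 (π / 2)
  hp : ContDiffOn ℝ 2 p (Icc 0 1)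
  hppos : ∀ x ∈ Icc (0 : ℝ) 1, 0 < p x
  hqc : ContinuousOn q (Icc 0 1)
  hqpos : ∀ x ∈ Icc (0 : ℝ) 1, 0 < q x
  hlampos : ∀ n ≥ 1, 0 < lam n
  hphireg : ∀ n ≥ 1, ContDiffOn ℝ 2 (phi n) (Icc 0 1)
  hphieig : ∀ n ≥ 1, ∀ x ∈ Icc (0 : ℝ) 1,
    -(dI (fun y => p y * dI (phi n) y) x) + q x * phi n x = lam n * phi n x
  hphibc : ∀ n ≥ 1,
    Real.cos θ₁ * phi n 0 - Real.sin θ₁ * dI (phi n) 0 = 0 ∧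
    Real.cos θ₂ * phi n 1 + Real.sin θ₂ * dI (phi n) 1 = 0
  horth : ∀ m ≥ 1, ∀ n ≥ 1, ip (phi m) (phi n) = if m = n then 1 else 0
  hparseval : ∀ f : ℝ → ℝ, ContinuousOn f (Icc 0 1) →
    (∫ x in (0 : ℝ)..1, (f x) ^ 2) = ∑' k : ℕ, (ip f (phi (k + 1))) ^ 2

/-- The Robin boundary conditions. -/
def RobinBC (θ₁ θ₂ : ℝ) (f : ℝ → ℝ) : Prop :=
  Real.cos θ₁ * f 0 - Real.sin θ₁ * dI f 0 = 0 ∧ Real.cos θ₂ * f 1 + Real.sin θ₂ * dI f 1 = 0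

/-- A cut-off function equal to `1` at `0` with vanishing derivative there, vanishing to second
order at `1`. -/
def cutoff (x : ℝ) : ℝ := (1 - x) ^ 2 * (1 + 2 * x)

theorem contDiff_cutoff : ContDiff ℝ 2 cutoff := by unfold cutoff; fun_prop

theorem hasDerivAt_cutoff (x : ℝ) : HasDerivAt cutoff (-6 * x * (1 - x)) x := by
  have := (((hasDerivAt_id x).const_sub 1).pow 2).mul (((hasDerivAt_id x).const_mul 2).const_add 1)
  refine this.congr_deriv ?_
  simp
  ring

theorem sq_boundary_le {f : ℝ → ℝ} (hf : ContDiffOn ℝ 1 f (Icc 0 1)) :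
    f 0 ^ 2 ≤ 2 * (ip f f + ip (dI f) (dI f)) ∧ f 1 ^ 2 ≤ 2 * (ip f f + ip (dI f) (dI f)) := by
  have key : ∀ s r : ℝ, (∀ x ∈ Icc (0 : ℝ) 1, |s + r * x| ≤ 1) →
      |(s + r) * f 1 ^ 2 - s * f 0 ^ 2 - r * ip f f| ≤ ip f f + ip (dI f) (dI f) := by
    intro s r hsr
    have hg : ContDiffOn ℝ 1 (fun x => (s + r * x) * f x) (Icc 0 1) :=
      ContDiffOn.mul (by fun_prop) hf
    have h := ip_dI_left hg hf
    have hd : ∀ x ∈ Icc (0 : ℝ) 1, dI (fun x => (s + r * x) * f x) x =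
        r * f x + (s + r * x) * dI f x := by
      intro x hx
      refine HasDerivWithinAt.dI_eq hx ?_
      have := ((((hasDerivAt_id x).const_mul r).const_add s).hasDerivWithinAt
        (s := Icc 0 1)).fun_mul
        (hasDerivWithinAt_dI hf hx)
      simpa using this
    have hc := hf.continuousOn
    have hc' := continuousOn_dI hf
    have hm : ContinuousOn (fun x => (s + r * x) * dI f x) (Icc 0 1) :=
      ContinuousOn.mul (by fun_prop) hc'
    rw [ip_congr hd (fun _ _ => rfl), ip_add_left (continuousOn_const.fun_mul hc) hm hc,
      ip_const_mul_left] at h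
    have e : ip (fun x => (s + r * x) * f x) (dI f) = ip (fun x => (s + r * x) * dI f x) f := by
      simp only [ip]
      congr 1
      funext x
      ring
    rw [e] at h
    have e2 : (s + r) * f 1 ^ 2 - s * f 0 ^ 2 - r * ip f f
        = ∫ x in (0 : ℝ)..1, 2 * ((s + r * x) * dI f x * f x) := by
      rw [intervalIntegral.integral_const_mul]
      simp only [ip] at h ⊢
      linarith
    rw [e2]
    have hi : IntervalIntegrable (fun x => f x * f x + dI f x * dI f x) volume 0 1 :=
      ((hc.mul hc).add (hc'.mul hc')).ii
    have e3 : ip f f + ip (dI f) (dI f) = ∫ x in (0 : ℝ)..1, (f x * f x + dI f x * dI f x) :=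
      (intervalIntegral.integral_add (hc.mul hc).ii (hc'.mul hc').ii).symm
    rw [e3]
    rw [← Real.norm_eq_abs]
    refine intervalIntegral.norm_integral_le_of_norm_le zero_le_one ?_ hi
    refine Filter.Eventually.of_forall fun x hx => ?_
    have h1 := hsr x (Ioc_subset_Icc_self hx)
    rw [Real.norm_eq_abs, abs_mul, abs_mul, abs_mul, abs_two]
    have h2 := two_mul_le_add_sq |dI f x| |f x|
    rw [sq_abs, sq_abs] at h2
    have h3 : 0 ≤ |dI f x| * |f x| := by positivity
    nlinarith [mul_le_mul_of_nonneg_right h1 h3]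
  have hn := ip_self_nonneg (dI f)
  constructor
  · have := key 1 (-1) fun x hx => by rw [abs_le]; constructor <;> linarith [hx.1, hx.2]
    linarith [(abs_le.1 this).1]
  · have := key 0 1 fun x hx => by rw [abs_le]; constructor <;> linarith [hx.1, hx.2]
    linarith [(abs_le.1 this).2]

namespace SturmLiouville

variable {p q : ℝ → ℝ} {θ₁ θ₂ : ℝ} {lam : ℕ → ℝ} {phi : ℕ → ℝ → ℝ} {f g : ℝ → ℝ}
  (H : SturmLiouville p q θ₁ θ₂ lam phi)
include H

theorem hp1 : ContDiffOn ℝ 1 p (Icc 0 1) := H.hp.of_le (by norm_num)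

theorem cphi {n : ℕ} (hn : 1 ≤ n) : ContinuousOn (phi n) (Icc 0 1) := (H.hphireg n hn).continuousOn

theorem continuousOn_LOp (hf : ContDiffOn ℝ 2 f (Icc 0 1)) : ContinuousOn (LOp p q f) (Icc 0 1) :=
  _root_.continuousOn_LOp H.hp1 H.hqc hf

theorem sin_cos : 0 < cos θ₁ ∧ 0 ≤ sin θ₁ ∧ 0 ≤ cos θ₂ ∧ 0 ≤ sin θ₂ := by
  have h1 := H.hθ₁
  have h2 := H.hθ₂
  have := Real.pi_pos
  exact ⟨cos_pos_of_mem_Ioo ⟨by linarith [h1.1], h1.2⟩,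
    sin_nonneg_of_nonneg_of_le_pi h1.1 (by linarith [h1.2]),
    cos_nonneg_of_mem_Icc ⟨by linarith [h2.1], h2.2⟩,
    sin_nonneg_of_nonneg_of_le_pi h2.1 (by linarith [h2.2])⟩

theorem denom_pos : 0 < cos θ₂ + 2 * sin θ₂ := by
  obtain ⟨-, -, h3, h4⟩ := H.sin_cos
  by_contra hcon
  have e1 : cos θ₂ = 0 := by linarith
  have e2 : sin θ₂ = 0 := by linarith
  have := Real.sin_sq_add_cos_sq θ₂
  rw [e1, e2] at this
  norm_num at this

theorem hasSum_sq (hf : ContinuousOn f (Icc 0 1)) :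
    HasSum (fun k => ip f (phi (k + 1)) ^ 2) (ip f f) := by
  have h := H.hparseval f hf
  rw [← ip_self] at h
  by_cases hs : Summable fun k => ip f (phi (k + 1)) ^ 2
  · rw [h]
    exact hs.hasSum
  · rw [tsum_eq_zero_of_not_summable hs] at h
    refine absurd ?_ hs
    have : ∀ k, ip f (phi (k + 1)) ^ 2 = 0 := fun k => by
      have := sq_ip_le hf (H.cphi (Nat.le_add_left 1 k))
      rw [h, zero_mul] at this
      exact le_antisymm this (sq_nonneg _)
    simp only [this]
    exact summable_zero

theorem hasSum_mul (hf : ContinuousOn f (Icc 0 1)) (hg : ContinuousOn g (Icc 0 1)) :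
    HasSum (fun k => ip f (phi (k + 1)) * ip g (phi (k + 1))) (ip f g) := by
  have h := ((H.hasSum_sq (hf.fun_add hg)).sub ((H.hasSum_sq hf).add (H.hasSum_sq hg))).div_const 2
  have e : ip (fun x => f x + g x) (fun x => f x + g x) = ip f f + 2 * ip f g + ip g g := by
    rw [ip_add_left hf hg (hf.fun_add hg), ip_add_right hf hf hg, ip_add_right hg hf hg,
      ip_comm g f]
    ring
  rw [e] at h
  have e2 : (ip f f + 2 * ip f g + ip g g - (ip f f + ip g g)) / 2 = ip f g := by ring
  rw [e2] at h
  refine h.congr_fun ?_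
  intro k
  rw [ip_add_left hf hg (H.cphi (Nat.le_add_left 1 k))]
  ring

theorem sum_sq_le (hf : ContinuousOn f (Icc 0 1)) (s : Finset ℕ) (hs : ∀ n ∈ s, 1 ≤ n) :
    ∑ n ∈ s, ip f (phi n) ^ 2 ≤ ip f f := by
  have h := sum_le_hasSum (s.image fun n => n - 1) (fun k _ => sq_nonneg _) (H.hasSum_sq hf)
  rw [Finset.sum_image] at h
  · refine le_trans (le_of_eq (Finset.sum_congr rfl fun n hn => ?_)) h
    rw [Nat.sub_add_cancel (hs n hn)]
  · intro a ha b hb hab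
    have := hs a ha
    have := hs b hb
    simp only at hab
    omega

theorem abs_sum_mul_le (hf : ContinuousOn f (Icc 0 1)) (hg : ContinuousOn g (Icc 0 1))
    (s : Finset ℕ) (hs : ∀ n ∈ s, 1 ≤ n) :
    |∑ n ∈ s, ip f (phi n) * ip g (phi n)| ≤ ip f f + ip g g := by
  have h1 := H.sum_sq_le hf s hs
  have h2 := H.sum_sq_le hg s hs
  refine (Finset.abs_sum_le_sum_abs _ _).trans ?_
  have : ∀ n, |ip f (phi n) * ip g (phi n)| ≤ ip f (phi n) ^ 2 + ip g (phi n) ^ 2 := fun n => by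
    rw [abs_le]
    constructor <;> nlinarith [sq_nonneg (ip f (phi n) + ip g (phi n)),
      sq_nonneg (ip f (phi n) - ip g (phi n))]
  refine (Finset.sum_le_sum fun n _ => this n).trans ?_
  rw [Finset.sum_add_distrib]
  linarith

theorem sq_ip_phi_le (hf : ContinuousOn f (Icc 0 1)) {n : ℕ} (hn : 1 ≤ n) :
    ip f (phi n) ^ 2 ≤ ip f f := by
  simpa using H.sum_sq_le hf {n} (by simpa using hn)

theorem ip_LOp_phi (hf : ContDiffOn ℝ 2 f (Icc 0 1)) (hbc : RobinBC θ₁ θ₂ f) {n : ℕ} (hn : 1 ≤ n) :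
    ip (LOp p q f) (phi n) = lam n * ip f (phi n) := by
  have h := ip_LOp_comm H.hp1 H.hqc hf (H.hphireg n hn)
  have e : ip f (LOp p q (phi n)) = lam n * ip f (phi n) := by
    rw [← ip_const_mul_right]
    exact ip_congr (fun _ _ => rfl) (H.hphieig n hn)
  obtain ⟨b1, b2⟩ := hbc
  obtain ⟨c1, c2⟩ := H.hphibc n hn
  have hs1 := Real.sin_sq_add_cos_sq θ₁
  have hs2 := Real.sin_sq_add_cos_sq θ₂
  have d1 : dI f 0 * phi n 0 - f 0 * dI (phi n) 0 = 0 := by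
    linear_combination (-(dI f 0 * phi n 0 - f 0 * dI (phi n) 0)) * hs1
      + (cos θ₁ * dI f 0 + sin θ₁ * f 0) * c1 - (cos θ₁ * dI (phi n) 0 + sin θ₁ * phi n 0) * b1
  have d2 : dI f 1 * phi n 1 - f 1 * dI (phi n) 1 = 0 := by
    linear_combination (-(dI f 1 * phi n 1 - f 1 * dI (phi n) 1)) * hs2
      + (cos θ₂ * dI f 1 - sin θ₂ * f 1) * c2 - (cos θ₂ * dI (phi n) 1 - sin θ₂ * phi n 1) * b2
  rw [h, e, d1, d2]
  ring

theorem ip_LOp_cutoff (hf : ContDiffOn ℝ 2 f (Icc 0 1)) :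
    p 0 * dI f 0 = ip (LOp p q f) cutoff - ip f (LOp p q cutoff) := by
  have h := ip_LOp_comm H.hp1 H.hqc hf contDiff_cutoff.contDiffOn
  have e0 : dI cutoff 0 = 0 := HasDerivWithinAt.dI_eq (by simp) <| by
    simpa using (hasDerivAt_cutoff 0).hasDerivWithinAt
  have e1 : dI cutoff 1 = 0 := HasDerivWithinAt.dI_eq (by simp) <| by
    simpa using (hasDerivAt_cutoff 1).hasDerivWithinAt
  rw [e0, e1] at h
  simp only [show cutoff 0 = 1 by simp [cutoff], show cutoff 1 = 0 by simp [cutoff]] at h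
  linarith

theorem trace_phi {n : ℕ} (hn : 1 ≤ n) :
    p 0 * dI (phi n) 0 = lam n * ip cutoff (phi n) - ip (LOp p q cutoff) (phi n) := by
  rw [H.ip_LOp_cutoff (H.hphireg n hn), ip_comm _ (phi n), ip_comm _ (phi n), ← ip_const_mul_left]
  congr 1
  exact ip_congr (H.hphieig n hn) (fun _ _ => rfl)

theorem hasSum_trace (hf : ContinuousOn f (Icc 0 1)) (hg : ContinuousOn g (Icc 0 1))
    (hfg : ∀ n ≥ 1, ip g (phi n) = lam n * ip f (phi n)) :
    HasSum (fun k => dI (phi (k + 1)) 0 * ip f (phi (k + 1)))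
      ((ip g cutoff - ip f (LOp p q cutoff)) / p 0) := by
  have hψ : ContDiffOn ℝ 2 cutoff (Icc 0 1) := contDiff_cutoff.contDiffOn
  have hp0 := H.hppos 0 (by simp)
  refine (((H.hasSum_mul hg hψ.continuousOn).sub
    (H.hasSum_mul hf (H.continuousOn_LOp hψ))).div_const (p 0)).congr_fun fun k => ?_
  have := H.trace_phi (Nat.le_add_left 1 k)
  rw [hfg _ (Nat.le_add_left 1 k), eq_div_iff hp0.ne']
  linear_combination (ip f (phi (k + 1))) * this

theorem abs_sum_trace_le (hf : ContinuousOn f (Icc 0 1)) (hg : ContinuousOn g (Icc 0 1))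
    (hfg : ∀ n ≥ 1, ip g (phi n) = lam n * ip f (phi n)) (s : Finset ℕ) (hs : ∀ n ∈ s, 1 ≤ n) :
    |∑ n ∈ s, dI (phi n) 0 * ip f (phi n)| ≤ (ip g g + ip cutoff cutoff +
      (ip f f + ip (LOp p q cutoff) (LOp p q cutoff))) / p 0 := by
  have hψ : ContDiffOn ℝ 2 cutoff (Icc 0 1) := contDiff_cutoff.contDiffOn
  have hp0 := H.hppos 0 (by simp)
  have e : p 0 * ∑ n ∈ s, dI (phi n) 0 * ip f (phi n) =
      ∑ n ∈ s, ip g (phi n) * ip cutoff (phi n) -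
        ∑ n ∈ s, ip f (phi n) * ip (LOp p q cutoff) (phi n) := by
    rw [Finset.mul_sum, ← Finset.sum_sub_distrib]
    refine Finset.sum_congr rfl fun n hn => ?_
    rw [hfg n (hs n hn)]
    linear_combination (ip f (phi n)) * H.trace_phi (hs n hn)
  rw [le_div_iff₀ hp0, mul_comm, ← abs_of_pos hp0, ← abs_mul, e]
  exact (abs_sub _ _).trans (add_le_add (H.abs_sum_mul_le hg hψ.continuousOn s hs)
    (H.abs_sum_mul_le hf (H.continuousOn_LOp hψ) s hs))

end SturmLiouville

theorem contDiff_bFun (θ₂ : ℝ) : ContDiff ℝ 2 (bFun θ₂) := by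
  unfold bFun
  fun_prop

theorem dI_bFun (θ₂ : ℝ) {x : ℝ} (hx : x ∈ Icc (0 : ℝ) 1) :
    dI (bFun θ₂) x = -2 * x / (Real.cos θ₂ + 2 * Real.sin θ₂) := by
  refine HasDerivWithinAt.dI_eq hx ?_
  have := (((hasDerivAt_pow 2 x).neg).div_const (Real.cos θ₂ + 2 * Real.sin θ₂)).hasDerivWithinAt
    (s := Icc 0 1)
  exact (this.congr_deriv (by push_cast; ring))

theorem dI_add_const_mul {f g : ℝ → ℝ} (hf : ContDiffOn ℝ 1 f (Icc 0 1))
    (hg : ContDiffOn ℝ 1 g (Icc 0 1)) (r : ℝ) {x : ℝ} (hx : x ∈ Icc (0 : ℝ) 1) :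
    dI (fun x => f x + r * g x) x = dI f x + r * dI g x :=
  HasDerivWithinAt.dI_eq hx ((hasDerivWithinAt_dI hf hx).add
    ((hasDerivWithinAt_dI hg hx).const_mul r))

theorem dI_congr {f g : ℝ → ℝ} (h : ∀ x ∈ Icc (0 : ℝ) 1, f x = g x) {x : ℝ}
    (hx : x ∈ Icc (0 : ℝ) 1) : dI f x = dI g x :=
  derivWithin_congr h (h x hx)

theorem LOp_add_const_mul {p q f g : ℝ → ℝ} (hp : ContDiffOn ℝ 1 p (Icc 0 1))
    (hf : ContDiffOn ℝ 2 f (Icc 0 1)) (hg : ContDiffOn ℝ 2 g (Icc 0 1)) (r : ℝ) {x : ℝ}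
    (hx : x ∈ Icc (0 : ℝ) 1) :
    LOp p q (fun x => f x + r * g x) x = LOp p q f x + r * LOp p q g x := by
  have e : dI (fun y => p y * dI (fun x => f x + r * g x) y) x =
      dI (fun y => p y * dI f y + r * (p y * dI g y)) x := by
    refine dI_congr (fun y hy => ?_) hx
    rw [dI_add_const_mul (hf.of_le (by norm_num)) (hg.of_le (by norm_num)) r hy]
    ring
  simp only [LOp]
  rw [e, dI_add_const_mul (contDiffOn_flux hp hf) (contDiffOn_flux hp hg) r hx]
  ring

theorem LOp_bFun {p q qt : ℝ → ℝ} {q_c θ₂ : ℝ} (hp : ContDiffOn ℝ 1 p (Icc 0 1))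
    (hqt : ∀ x, qt x = q x - q_c) {x : ℝ} (hx : x ∈ Icc (0 : ℝ) 1) :
    LOp p q (bFun θ₂) x = aFun p qt θ₂ x + q_c * bFun θ₂ x := by
  have e : dI (fun y => p y * dI (bFun θ₂) y) x =
      dI (fun y => p y * (-2 * y / (Real.cos θ₂ + 2 * Real.sin θ₂))) x :=
    dI_congr (fun y hy => by rw [dI_bFun θ₂ hy]) hx
  have h1 : HasDerivWithinAt (fun y : ℝ => -2 * y / (Real.cos θ₂ + 2 * Real.sin θ₂))
      (-2 * 1 / (Real.cos θ₂ + 2 * Real.sin θ₂)) (Icc 0 1) x :=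
    (((hasDerivAt_id x).const_mul (-2)).div_const _).hasDerivWithinAt
  simp only [LOp]
  rw [e, HasDerivWithinAt.dI_eq hx ((hasDerivWithinAt_dI hp hx).fun_mul h1)]
  simp only [aFun, bFun, hqt]
  ring

theorem continuousOn_aFun {p q qt : ℝ → ℝ} {q_c : ℝ} (θ₂ : ℝ) (hp : ContDiffOn ℝ 1 p (Icc 0 1))
    (hq : ContinuousOn q (Icc 0 1)) (hqt : ∀ x, qt x = q x - q_c) :
    ContinuousOn (aFun p qt θ₂) (Icc 0 1) := by
  have h1 := hp.continuousOn
  have h2 := continuousOn_dI hp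
  unfold aFun
  simp only [hqt]
  fun_prop

namespace SturmLiouville

variable {p q : ℝ → ℝ} {θ₁ θ₂ : ℝ} {lam : ℕ → ℝ} {phi : ℕ → ℝ → ℝ} {f g : ℝ → ℝ}
  (H : SturmLiouville p q θ₁ θ₂ lam phi)
include H

theorem robinBC_add_bFun (hf : ContDiffOn ℝ 2 f (Icc 0 1)) {U : ℝ}
    (h1 : Real.cos θ₁ * f 0 - Real.sin θ₁ * dI f 0 = 0)
    (h2 : Real.cos θ₂ * f 1 + Real.sin θ₂ * dI f 1 = U) :
    RobinBC θ₁ θ₂ (fun x => f x + U * bFun θ₂ x) := by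
  have hf1 : ContDiffOn ℝ 1 f (Icc 0 1) := hf.of_le (by norm_num)
  have hb1 : ContDiffOn ℝ 1 (bFun θ₂) (Icc 0 1) := (contDiff_bFun θ₂).contDiffOn.of_le (by norm_num)
  have hD := H.denom_pos.ne'
  constructor
  · rw [dI_add_const_mul hf1 hb1 U (by simp), dI_bFun θ₂ (by simp)]
    simp only [bFun]
    linear_combination h1
  · rw [dI_add_const_mul hf1 hb1 U (by simp), dI_bFun θ₂ (by simp)]
    simp only [bFun]
    have e : (cos θ₂ + 2 * sin θ₂) * (cos θ₂ + 2 * sin θ₂)⁻¹ = 1 := mul_inv_cancel₀ hD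
    simp only [div_eq_mul_inv]
    linear_combination h2 - U * e

theorem hasSum_lam_sq (hf : ContDiffOn ℝ 2 f (Icc 0 1)) (hbc : RobinBC θ₁ θ₂ f) :
    HasSum (fun k => lam (k + 1) * ip f (phi (k + 1)) ^ 2) (ip (LOp p q f) f) := by
  refine (H.hasSum_mul (H.continuousOn_LOp hf) hf.continuousOn).congr_fun fun k => ?_
  rw [H.ip_LOp_phi hf hbc (Nat.le_add_left 1 k)]
  ring

theorem energy_eq (hf : ContDiffOn ℝ 2 f (Icc 0 1)) (hbc : RobinBC θ₁ θ₂ f) :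
    ip (LOp p q f) f = (∫ x in (0 : ℝ)..1, (p x * (dI f x * dI f x) + q x * (f x * f x)))
      + p 0 * (cos θ₁ / sin θ₁ * f 0 ^ 2) + p 1 * (cos θ₂ / sin θ₂ * f 1 ^ 2) := by
  rw [ip_LOp_left H.hp1 H.hqc hf (hf.of_le (by norm_num))]
  obtain ⟨b1, b2⟩ := hbc
  have d1 : dI f 0 * f 0 = cos θ₁ / sin θ₁ * f 0 ^ 2 := by
    by_cases hs : sin θ₁ = 0
    · have : f 0 = 0 := by
        rw [hs, zero_mul, sub_zero] at b1
        exact (mul_eq_zero.1 b1).resolve_left H.sin_cos.1.ne'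
      simp [this]
    · field_simp
      linear_combination (-f 0) * b1
  have d2 : dI f 1 * f 1 = -(cos θ₂ / sin θ₂ * f 1 ^ 2) := by
    by_cases hs : sin θ₂ = 0
    · have hc : cos θ₂ ≠ 0 := fun hc => by
        have := H.denom_pos
        rw [hs, hc] at this
        norm_num at this
      have : f 1 = 0 := by
        rw [hs, zero_mul, add_zero] at b2
        exact (mul_eq_zero.1 b2).resolve_left hc
      simp [this]
    · field_simp
      linear_combination (f 1) * b2
  linear_combination p 0 * d1 - p 1 * d2

theorem exists_energy_ge : ∃ C > 0, ∀ f, ContDiffOn ℝ 2 f (Icc 0 1) → RobinBC θ₁ θ₂ f →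
    C * (ip f f + ip (dI f) (dI f)) ≤ ip (LOp p q f) f := by
  obtain ⟨x₁, hx₁, m₁⟩ := isCompact_Icc.exists_isMinOn (nonempty_Icc.2 zero_le_one)
    (H.hp.continuousOn : ContinuousOn p (Icc 0 1))
  obtain ⟨x₂, hx₂, m₂⟩ := isCompact_Icc.exists_isMinOn (nonempty_Icc.2 zero_le_one)
    (H.hqc : ContinuousOn q (Icc 0 1))
  refine ⟨min (p x₁) (q x₂), lt_min (H.hppos _ hx₁) (H.hqpos _ hx₂), fun f hf hbc => ?_⟩
  rw [H.energy_eq hf hbc]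
  have hc := hf.continuousOn
  have hc' := (contDiffOn_dI hf).continuousOn
  obtain ⟨s1, s2, s3, s4⟩ := H.sin_cos
  have n1 := (H.hppos 0 (by simp)).le
  have n2 := (H.hppos 1 (by simp)).le
  have t1 : 0 ≤ p 0 * (cos θ₁ / sin θ₁ * f 0 ^ 2) := by positivity
  have t2 : 0 ≤ p 1 * (cos θ₂ / sin θ₂ * f 1 ^ 2) := by positivity
  have e : ip f f + ip (dI f) (dI f) = ∫ x in (0 : ℝ)..1, (f x * f x + dI f x * dI f x) :=
    (intervalIntegral.integral_add (hc.mul hc).ii (hc'.mul hc').ii).symm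
  rw [e, ← intervalIntegral.integral_const_mul]
  have hi1 : ContinuousOn (fun x => min (p x₁) (q x₂) * (f x * f x + dI f x * dI f x))
      (Icc 0 1) := by
    fun_prop
  have hpc := H.hp.continuousOn
  have hqc := H.hqc
  have hi2 : ContinuousOn (fun x => p x * (dI f x * dI f x) + q x * (f x * f x)) (Icc 0 1) := by
    fun_prop
  have := intervalIntegral.integral_mono_on zero_le_one hi1.ii hi2.ii fun x hx => by
    have i1 : min (p x₁) (q x₂) ≤ p x := (min_le_left _ _).trans (m₁ hx)
    have i2 : min (p x₁) (q x₂) ≤ q x := (min_le_right _ _).trans (m₂ hx)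
    nlinarith [mul_le_mul_of_nonneg_right i1 (mul_self_nonneg (dI f x)),
      mul_le_mul_of_nonneg_right i2 (mul_self_nonneg (f x))]
  linarith

theorem exists_energy_le : ∃ C > 0, ∀ f, ContDiffOn ℝ 2 f (Icc 0 1) → RobinBC θ₁ θ₂ f →
    ip (LOp p q f) f ≤ C * (ip f f + ip (dI f) (dI f)) := by
  obtain ⟨x₁, hx₁, m₁⟩ := isCompact_Icc.exists_isMaxOn (nonempty_Icc.2 zero_le_one)
    (H.hp.continuousOn : ContinuousOn p (Icc 0 1))
  obtain ⟨x₂, hx₂, m₂⟩ := isCompact_Icc.exists_isMaxOn (nonempty_Icc.2 zero_le_one)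
    (H.hqc : ContinuousOn q (Icc 0 1))
  obtain ⟨s1, s2, s3, s4⟩ := H.sin_cos
  have n0 := H.hppos _ hx₁
  have n1 := (H.hppos 0 (by simp)).le
  have n2 := (H.hppos 1 (by simp)).le
  refine ⟨max (p x₁) (q x₂) + p 0 * (cos θ₁ / sin θ₁ * 2) + p 1 * (cos θ₂ / sin θ₂ * 2), ?_,
    fun f hf hbc => ?_⟩
  · have : 0 < max (p x₁) (q x₂) := lt_max_of_lt_left n0
    positivity
  rw [H.energy_eq hf hbc]
  have hc := hf.continuousOn
  have hc' := (contDiffOn_dI hf).continuousOn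
  obtain ⟨tr1, tr2⟩ := sq_boundary_le (hf.of_le (by norm_num))
  have t1 : p 0 * (cos θ₁ / sin θ₁ * f 0 ^ 2) ≤
      p 0 * (cos θ₁ / sin θ₁ * (2 * (ip f f + ip (dI f) (dI f)))) := by gcongr
  have t2 : p 1 * (cos θ₂ / sin θ₂ * f 1 ^ 2) ≤
      p 1 * (cos θ₂ / sin θ₂ * (2 * (ip f f + ip (dI f) (dI f)))) := by gcongr
  have e : max (p x₁) (q x₂) * (ip f f + ip (dI f) (dI f)) =
      ∫ x in (0 : ℝ)..1, max (p x₁) (q x₂) * (f x * f x + dI f x * dI f x) := by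
    rw [intervalIntegral.integral_const_mul]
    congr 1
    exact (intervalIntegral.integral_add (hc.mul hc).ii (hc'.mul hc').ii).symm
  have hi1 : ContinuousOn (fun x => max (p x₁) (q x₂) * (f x * f x + dI f x * dI f x))
      (Icc 0 1) := by
    fun_prop
  have hpc := H.hp.continuousOn
  have hqc := H.hqc
  have hi2 : ContinuousOn (fun x => p x * (dI f x * dI f x) + q x * (f x * f x)) (Icc 0 1) := by
    fun_prop
  have := intervalIntegral.integral_mono_on zero_le_one hi2.ii hi1.ii fun x hx => by
    have i1 : p x ≤ max (p x₁) (q x₂) := (m₁ hx).trans (le_max_left _ _)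
    have i2 : q x ≤ max (p x₁) (q x₂) := (m₂ hx).trans (le_max_right _ _)
    nlinarith [mul_le_mul_of_nonneg_right i1 (mul_self_nonneg (dI f x)),
      mul_le_mul_of_nonneg_right i2 (mul_self_nonneg (f x))]
  nlinarith

end SturmLiouville

theorem continuousOn_integral_of_continuousOn_prod {F : ℝ → ℝ → ℝ} {a : ℝ}
    (hF : ContinuousOn (fun r : ℝ × ℝ => F r.1 r.2) (Ici a ×ˢ Icc 0 1)) :
    ContinuousOn (fun t => ∫ x in (0 : ℝ)..1, F t x) (Ici a) := by
  have hG : Continuous fun r : ℝ × ℝ => F (max r.1 a) (projIcc 0 1 zero_le_one r.2 : ℝ) := by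
    have hm : Continuous fun r : ℝ × ℝ =>
        ((max r.1 a, (projIcc 0 1 zero_le_one r.2 : ℝ)) : ℝ × ℝ) := by fun_prop
    exact hF.comp_continuous hm fun r => ⟨mem_Ici.2 (le_max_right _ _),
      (projIcc 0 1 zero_le_one r.2).2⟩
  have hc := intervalIntegral.continuous_parametric_intervalIntegral_of_continuous' (μ := volume)
    (f := fun t x => F (max t a) (projIcc 0 1 zero_le_one x : ℝ)) hG 0 1
  refine hc.continuousOn.congr fun t ht => ?_
  refine intervalIntegral.integral_congr fun x hx => ?_
  rw [uIcc_of_le zero_le_one] at hx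
  simp only [max_eq_left (mem_Ici.1 ht), projIcc_of_mem _ hx]

theorem continuousOn_ip {F : ℝ → ℝ → ℝ} {a : ℝ} {g : ℝ → ℝ}
    (hF : ContinuousOn (fun r : ℝ × ℝ => F r.1 r.2) (Ici a ×ˢ Icc 0 1))
    (hg : ContinuousOn g (Icc 0 1)) : ContinuousOn (fun t => ip (F t) g) (Ici a) :=
  continuousOn_integral_of_continuousOn_prod
    (hF.mul (hg.comp continuousOn_snd fun _ hr => hr.2))

theorem continuousOn_ip_self {F : ℝ → ℝ → ℝ} {a : ℝ}
    (hF : ContinuousOn (fun r : ℝ × ℝ => F r.1 r.2) (Ici a ×ˢ Icc 0 1)) :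
    ContinuousOn (fun t => ip (F t) (F t)) (Ici a) :=
  continuousOn_integral_of_continuousOn_prod (F := fun t x => F t x * F t x) (hF.mul hF)

theorem hasDerivAt_ip {F G : ℝ → ℝ → ℝ} {g : ℝ → ℝ} {t : ℝ} (ht : 0 < t)
    (hF : ∀ s > 0, ContinuousOn (F s) (Icc 0 1))
    (hF' : ContinuousOn (fun r : ℝ × ℝ => deriv (fun s => F s r.2) r.1) (Ioi 0 ×ˢ Icc 0 1))
    (hd : ∀ s > 0, ∀ x ∈ Ioo (0 : ℝ) 1, HasDerivAt (fun s => F s x) (G s x) s)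
    (hg : ContinuousOn g (Icc 0 1)) :
    HasDerivAt (fun s => ip (F s) g) (ip (G t) g) t := by
  have hsub : Icc (t / 2) (2 * t) ×ˢ Icc (0 : ℝ) 1 ⊆ Ioi 0 ×ˢ Icc 0 1 :=
    prod_mono (fun s hs => lt_of_lt_of_le (by linarith) hs.1) subset_rfl
  have hgr : ContinuousOn (fun r : ℝ × ℝ => deriv (fun s => F s r.2) r.1 * g r.2)
      (Ioi 0 ×ˢ Icc 0 1) := hF'.mul (hg.comp continuousOn_snd fun _ hr => hr.2)
  obtain ⟨C, hC⟩ := (isCompact_Icc.prod isCompact_Icc).exists_bound_of_continuousOn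
    (hgr.mono hsub)
  have hslice : ContinuousOn (fun x => deriv (fun s => F s x) t * g x) (Icc 0 1) :=
    hgr.comp (f := fun x : ℝ => ((t, x) : ℝ × ℝ)) (by fun_prop) fun x hx => ⟨ht, hx⟩
  have hIcc : ∀ {f : ℝ → ℝ}, ContinuousOn f (Icc 0 1) →
      AEStronglyMeasurable f (volume.restrict (uIoc (0 : ℝ) 1)) := fun hf => by
    rw [uIoc_of_le zero_le_one]
    exact (hf.mono Ioc_subset_Icc_self).aestronglyMeasurable measurableSet_Ioc
  have hae : ∀ᵐ x : ℝ, x ≠ 1 := by simp [ae_iff]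
  have key := intervalIntegral.hasDerivAt_integral_of_dominated_loc_of_deriv_le (μ := volume)
    (F := fun s x => F s x * g x) (F' := fun s x => deriv (fun s => F s x) s * g x)
    (bound := fun _ => C) (x₀ := t) (a := 0) (b := 1)
    (Icc_mem_nhds (by linarith : t / 2 < t) (by linarith : t < 2 * t))
    (by
      filter_upwards [Ioi_mem_nhds ht] with s hs
      exact hIcc ((hF s hs).mul hg))
    (((hF t ht).mul hg).ii) (hIcc hslice)
    (by
      refine .of_forall fun x hx s hs => ?_
      rw [uIoc_of_le zero_le_one] at hx
      exact hC (s, x) ⟨hs, Ioc_subset_Icc_self hx⟩)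
    (by simp)
    (by
      filter_upwards [hae] with x hx1 hx s hs
      rw [uIoc_of_le zero_le_one] at hx
      have hs0 : 0 < s := lt_of_lt_of_le (by linarith) hs.1
      have := hd s hs0 x ⟨hx.1, lt_of_le_of_ne hx.2 hx1⟩
      exact this.differentiableAt.hasDerivAt.mul_const _)
  refine key.2.congr_deriv ?_
  refine intervalIntegral.integral_congr_Ioo_of_le zero_le_one fun x hx => ?_
  simp only [(hd t ht x hx).deriv]

theorem eq_add_prim_of_hasDerivAt {f g : ℝ → ℝ} (hf : ContinuousOn f (Ici 0))
    (hg : Continuous g) (hd : ∀ t > 0, HasDerivAt f (g t) t) {t : ℝ} (ht : 0 ≤ t) :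
    f t = f 0 + prim g t := by
  have := intervalIntegral.integral_eq_sub_of_hasDerivAt_of_le ht
    (hf.mono Icc_subset_Ici_self) (fun s hs => hd s hs.1) (hg.intervalIntegrable 0 t)
  rw [prim, this]
  ring

theorem ContinuousOn.continuous_max {f : ℝ → ℝ} {a : ℝ} (hf : ContinuousOn f (Ici a)) :
    Continuous fun t => f (max t a) :=
  hf.comp_continuous (by fun_prop) fun _ => mem_Ici.2 (le_max_right _ _)

theorem prim_of_const {f : ℝ → ℝ} {t r : ℝ} (ht : t ≤ 0) (h : ∀ s ∈ Icc t 0, f s = r) :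
    prim f t = t * r := by
  have : prim f t = ∫ _s in (0 : ℝ)..t, r := by
    refine intervalIntegral.integral_congr fun x hx => ?_
    rw [uIcc_of_ge ht] at hx
    exact h x hx
  rw [this]
  simp

theorem prim_add {f g : ℝ → ℝ} (hf : Continuous f) (hg : Continuous g) (t : ℝ) :
    prim (fun s => f s + g s) t = prim f t + prim g t :=
  intervalIntegral.integral_add (hf.intervalIntegrable _ _) (hg.intervalIntegrable _ _)

theorem prim_const_mul (r : ℝ) (f : ℝ → ℝ) (t : ℝ) :
    prim (fun s => r * f s) t = r * prim f t :=
  intervalIntegral.integral_const_mul r f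

theorem prim_sum {ι : Type} (A : Finset ι) {f : ι → ℝ → ℝ} (hf : ∀ i, Continuous (f i)) (t : ℝ) :
    prim (fun s => ∑ i ∈ A, f i s) t = ∑ i ∈ A, prim (f i) t :=
  intervalIntegral.integral_finsetSum fun i _ => (hf i).intervalIntegrable _ _

/-- Classical solutions of the delayed reaction–diffusion equation with Robin boundary input. -/
structure PlantSolution (p q : ℝ → ℝ) (θ₁ θ₂ q_c c h : ℝ) (z : ℝ → ℝ → ℝ) (u : ℝ → ℝ) : Prop where
  hh : 0 < h
  reg : ∀ t ≥ -h, ContDiffOn ℝ 2 (z t) (Icc 0 1)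
  cont : ContinuousOn (fun r : ℝ × ℝ => z r.1 r.2) (Ici (-h) ×ˢ Icc 0 1)
  cont_deriv : ContinuousOn (fun r : ℝ × ℝ => deriv (fun s => z s r.2) r.1) (Ioi 0 ×ˢ Icc 0 1)
  pde : ∀ t > 0, ∀ x ∈ Ioo (0 : ℝ) 1,
    HasDerivAt (fun s => z s x) (-(LOp p q (z t) x) + q_c * z t x + c * z (t - h) x) t
  bc0 : ∀ t ≥ 0, Real.cos θ₁ * z t 0 - Real.sin θ₁ * dI (z t) 0 = 0
  bc1 : ∀ t ≥ 0, Real.cos θ₂ * z t 1 + Real.sin θ₂ * dI (z t) 1 = u t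
  cont_u : ContinuousOn u (Ici (-h))

/-- The homogenized state `z + u b`. -/
def lifted (θ₂ : ℝ) (z : ℝ → ℝ → ℝ) (u : ℝ → ℝ) (t x : ℝ) : ℝ := z t x + u t * bFun θ₂ x

/-- The zeroth-order terms of the equation for the homogenized state. -/
def forcing (p qt : ℝ → ℝ) (θ₂ q_c c h : ℝ) (z : ℝ → ℝ → ℝ) (u : ℝ → ℝ) (t x : ℝ) : ℝ :=
  u t * aFun p qt θ₂ x + (q_c * lifted θ₂ z u t x + c * z (t - h) x)

namespace PlantSolution

variable {p q qt : ℝ → ℝ} {θ₁ θ₂ q_c c h : ℝ} {z : ℝ → ℝ → ℝ} {u : ℝ → ℝ} {lam : ℕ → ℝ}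
  {phi : ℕ → ℝ → ℝ} (D : PlantSolution p q θ₁ θ₂ q_c c h z u)
  (H : SturmLiouville p q θ₁ θ₂ lam phi)
include D

theorem contDiffOn_lifted {t : ℝ} (ht : -h ≤ t) : ContDiffOn ℝ 2 (lifted θ₂ z u t) (Icc 0 1) :=
  (D.reg t ht).add (contDiffOn_const.mul (contDiff_bFun θ₂).contDiffOn)

theorem neg_h_le {t : ℝ} (ht : 0 ≤ t) : -h ≤ t := by linarith [D.hh]

theorem continuousOn_lifted :
    ContinuousOn (fun r : ℝ × ℝ => lifted θ₂ z u r.1 r.2) (Ici (-h) ×ˢ Icc 0 1) :=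
  D.cont.add ((D.cont_u.comp continuousOn_fst fun _ hr => hr.1).mul
    ((contDiff_bFun θ₂).continuous.comp continuous_snd).continuousOn)

theorem ip_lifted {t : ℝ} (ht : -h ≤ t) {g : ℝ → ℝ} (hg : ContinuousOn g (Icc 0 1)) :
    ip (lifted θ₂ z u t) g = ip (z t) g + u t * ip (bFun θ₂) g := by
  rw [← ip_const_mul_left]
  exact ip_add_left (D.reg t ht).continuousOn
    (continuousOn_const.mul (contDiff_bFun θ₂).contDiffOn.continuousOn) hg

theorem continuousOn_delayed :
    ContinuousOn (fun r : ℝ × ℝ => z (r.1 - h) r.2) (Ici 0 ×ˢ Icc 0 1) :=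
  D.cont.comp (f := fun r : ℝ × ℝ => ((r.1 - h, r.2) : ℝ × ℝ)) (by fun_prop)
    fun r hr => ⟨by have := mem_Ici.1 hr.1; exact mem_Ici.2 (by linarith), hr.2⟩

theorem dI_lifted_zero {t : ℝ} (ht : 0 ≤ t) : dI (lifted θ₂ z u t) 0 = dI (z t) 0 := by
  have h0 : (0 : ℝ) ∈ Icc (0 : ℝ) 1 := by simp
  have := dI_add_const_mul ((D.reg t (D.neg_h_le ht)).of_le (by norm_num))
    ((contDiff_bFun θ₂).contDiffOn.of_le (by norm_num)) (u t) h0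
  rw [dI_bFun θ₂ h0] at this
  exact this.trans (by simp)

include H

theorem robinBC_lifted {t : ℝ} (ht : 0 ≤ t) : RobinBC θ₁ θ₂ (lifted θ₂ z u t) :=
  H.robinBC_add_bFun (D.reg t (D.neg_h_le ht)) (D.bc0 t ht) (D.bc1 t ht)

variable (hqt : ∀ x, qt x = q x - q_c)
include hqt

theorem continuousOn_forcing :
    ContinuousOn (fun r : ℝ × ℝ => forcing p qt θ₂ q_c c h z u r.1 r.2) (Ici 0 ×ˢ Icc 0 1) := by
  have hsub : Ici (0 : ℝ) ×ˢ Icc (0 : ℝ) 1 ⊆ Ici (-h) ×ˢ Icc 0 1 :=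
    prod_mono (Ici_subset_Ici.2 (by linarith [D.hh])) subset_rfl
  have h1 : ContinuousOn (fun r : ℝ × ℝ => aFun p qt θ₂ r.2) (Ici (0 : ℝ) ×ˢ Icc 0 1) :=
    (continuousOn_aFun θ₂ H.hp1 H.hqc hqt).comp continuousOn_snd fun _ hr => hr.2
  have h2 : ContinuousOn (fun r : ℝ × ℝ => u r.1) (Ici (0 : ℝ) ×ˢ Icc 0 1) :=
    D.cont_u.comp continuousOn_fst fun _ hr => (hsub hr).1
  exact (h2.mul h1).add ((continuousOn_const.mul (D.continuousOn_lifted.mono hsub)).add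
    (continuousOn_const.mul D.continuousOn_delayed))

theorem continuousOn_forcing_slice {t : ℝ} (ht : 0 ≤ t) :
    ContinuousOn (forcing p qt θ₂ q_c c h z u t) (Icc 0 1) :=
  (D.continuousOn_forcing H hqt).comp (f := fun x : ℝ => ((t, x) : ℝ × ℝ)) (by fun_prop)
    fun _ hx => ⟨ht, hx⟩

theorem ip_forcing {t : ℝ} (ht : 0 ≤ t) {g : ℝ → ℝ} (hg : ContinuousOn g (Icc 0 1)) :
    ip (forcing p qt θ₂ q_c c h z u t) g =
      u t * ip (aFun p qt θ₂) g + (q_c * ip (lifted θ₂ z u t) g + c * ip (z (t - h)) g) := by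
  have h1 := (D.contDiffOn_lifted (D.neg_h_le ht)).continuousOn
  have h2 := (D.reg (t - h) (by linarith)).continuousOn
  have h3 := continuousOn_aFun θ₂ H.hp1 H.hqc hqt
  rw [← ip_const_mul_left, ← ip_const_mul_left, ← ip_const_mul_left,
    ← ip_add_left (continuousOn_const.fun_mul h1) (continuousOn_const.fun_mul h2) hg]
  exact ip_add_left (continuousOn_const.mul h3)
    ((continuousOn_const.mul h1).add (continuousOn_const.mul h2)) hg

theorem hasDerivAt_ip_state {t : ℝ} (ht : 0 < t) {g : ℝ → ℝ} (hg : ContinuousOn g (Icc 0 1)) :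
    HasDerivAt (fun s => ip (z s) g)
      (-ip (LOp p q (lifted θ₂ z u t)) g + ip (forcing p qt θ₂ q_c c h z u t) g) t := by
  have key := hasDerivAt_ip ht (fun s hs => (D.reg s (D.neg_h_le (le_of_lt hs))).continuousOn)
    D.cont_deriv D.pde hg
  refine key.congr_deriv ?_
  have hL := H.continuousOn_LOp (D.contDiffOn_lifted (D.neg_h_le ht.le))
  have e : ∀ x ∈ Icc (0 : ℝ) 1, -(LOp p q (z t) x) + q_c * z t x + c * z (t - h) x =
      (-1) * LOp p q (lifted θ₂ z u t) x + forcing p qt θ₂ q_c c h z u t x := by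
    intro x hx
    have := LOp_add_const_mul (q := q) H.hp1 (D.reg t (D.neg_h_le ht.le))
      (contDiff_bFun θ₂).contDiffOn (u t) hx
    rw [LOp_bFun H.hp1 hqt hx] at this
    simp only [lifted, forcing]
    rw [show LOp p q (lifted θ₂ z u t) x = LOp p q (fun x => z t x + u t * bFun θ₂ x) x from rfl,
      this]
    ring
  rw [ip_congr e (fun _ _ => rfl), ip_add_left (continuousOn_const.fun_mul hL)
    (D.continuousOn_forcing_slice H hqt ht.le) hg, ip_const_mul_left]
  ring

theorem hasDerivAt_mode {t : ℝ} (ht : 0 < t) {n : ℕ} (hn : 1 ≤ n) :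
    HasDerivAt (fun s => ip (z s) (phi n))
      (-lam n * ip (lifted θ₂ z u t) (phi n) + ip (forcing p qt θ₂ q_c c h z u t) (phi n)) t := by
  refine (D.hasDerivAt_ip_state H hqt ht (H.cphi hn)).congr_deriv ?_
  rw [H.ip_LOp_phi (D.contDiffOn_lifted (D.neg_h_le ht.le)) (D.robinBC_lifted H ht.le) hn]
  ring

omit hqt H in
theorem continuous_ip_lifted {g : ℝ → ℝ} (hg : ContinuousOn g (Icc 0 1)) :
    Continuous fun t => ip (lifted θ₂ z u (max t 0)) g :=
  ((continuousOn_ip D.continuousOn_lifted hg).mono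
    (Ici_subset_Ici.2 (by linarith [D.hh]))).continuous_max

theorem continuous_ip_forcing {g : ℝ → ℝ} (hg : ContinuousOn g (Icc 0 1)) :
    Continuous fun t => ip (forcing p qt θ₂ q_c c h z u (max t 0)) g :=
  (continuousOn_ip (D.continuousOn_forcing H hqt) hg).continuous_max

theorem lam_mul_prim {t : ℝ} (ht : 0 ≤ t) {n : ℕ} (hn : 1 ≤ n) :
    lam n * prim (fun s => ip (lifted θ₂ z u (max s 0)) (phi n)) t =
      prim (fun s => ip (forcing p qt θ₂ q_c c h z u (max s 0)) (phi n)) t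
        - (ip (z t) (phi n) - ip (z 0) (phi n)) := by
  have hc1 := D.continuous_ip_lifted (H.cphi hn)
  have hc2 := D.continuous_ip_forcing H hqt (H.cphi hn)
  have := eq_add_prim_of_hasDerivAt (f := fun s => ip (z s) (phi n))
    (g := fun s => -lam n * ip (lifted θ₂ z u (max s 0)) (phi n)
      + ip (forcing p qt θ₂ q_c c h z u (max s 0)) (phi n))
    ((continuousOn_ip D.cont (H.cphi hn)).mono (Ici_subset_Ici.2 (by linarith [D.hh])))
    (by fun_prop) (fun s hs => by
      simpa only [max_eq_left hs.le] using D.hasDerivAt_mode H hqt hs hn) ht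
  rw [prim_add (continuous_const.fun_mul hc1) hc2, prim_const_mul] at this
  linarith

end PlantSolution

namespace SturmLiouville

variable {p q f g : ℝ → ℝ} {θ₁ θ₂ : ℝ} {lam : ℕ → ℝ} {phi : ℕ → ℝ → ℝ}
  (H : SturmLiouville p q θ₁ θ₂ lam phi)
include H

theorem abs_sum_range_mul_le (hf : ContinuousOn f (Icc 0 1))
    (hg : ContinuousOn g (Icc 0 1)) (m : ℕ) :
    |∑ k ∈ Finset.range m, ip f (phi (k + 1)) * ip g (phi (k + 1))| ≤ ip f f + ip g g := by
  have := H.abs_sum_mul_le hf hg ((Finset.range m).image (· + 1)) (by simp)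
  rwa [Finset.sum_image (by simp)] at this

end SturmLiouville

/-- The time integral `∫₀ᵗ z_x(s,0) ds`, expressed without boundary terms. -/
def traceInt (p q qt : ℝ → ℝ) (θ₂ q_c c h : ℝ) (z : ℝ → ℝ → ℝ) (u : ℝ → ℝ) (t : ℝ) : ℝ :=
  (prim (fun s => ip (forcing p qt θ₂ q_c c h z u (max s 0)) cutoff
      - ip (lifted θ₂ z u (max s 0)) (LOp p q cutoff)) (max t 0)
    - (ip (z (max t 0)) cutoff - ip (z 0) cutoff)) / p 0 + min t 0 * dI (z 0) 0

namespace PlantSolution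

variable {p q qt : ℝ → ℝ} {θ₁ θ₂ q_c c h : ℝ} {z : ℝ → ℝ → ℝ} {u : ℝ → ℝ} {lam : ℕ → ℝ}
  {phi : ℕ → ℝ → ℝ} (D : PlantSolution p q θ₁ θ₂ q_c c h z u)
  (H : SturmLiouville p q θ₁ θ₂ lam phi) (hqt : ∀ x, qt x = q x - q_c)
include D H hqt

theorem continuous_traceInt_rate : Continuous fun s =>
    ip (forcing p qt θ₂ q_c c h z u (max s 0)) cutoff
      - ip (lifted θ₂ z u (max s 0)) (LOp p q cutoff) :=
  (D.continuous_ip_forcing H hqt contDiff_cutoff.continuous.continuousOn).sub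
    (D.continuous_ip_lifted (H.continuousOn_LOp contDiff_cutoff.contDiffOn))

theorem continuous_traceInt : Continuous (traceInt p q qt θ₂ q_c c h z u) := by
  have h1 := (continuous_prim (D.continuous_traceInt_rate H hqt)).comp
    (continuous_id.max (continuous_const (y := (0 : ℝ))))
  have h2 : Continuous fun t => ip (z (max t 0)) cutoff :=
    ((continuousOn_ip D.cont contDiff_cutoff.continuous.continuousOn).mono
      (Ici_subset_Ici.2 (by linarith [D.hh]))).continuous_max
  exact ((h1.sub (h2.sub continuous_const)).div_const _).add
    ((continuous_id.min continuous_const).mul continuous_const)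

theorem hasDerivAt_traceInt {t : ℝ} (ht : 0 < t) :
    HasDerivAt (traceInt p q qt θ₂ q_c c h z u) (dI (z t) 0) t := by
  have hψ : ContDiffOn ℝ 2 cutoff (Icc 0 1) := contDiff_cutoff.contDiffOn
  have hp0 := H.hppos 0 (by simp)
  have h1 := hasDerivAt_prim (D.continuous_traceInt_rate H hqt) t
  have h2 := D.hasDerivAt_ip_state H hqt ht hψ.continuousOn
  have h3 := (h1.sub (h2.sub_const (ip (z 0) cutoff))).div_const (p 0)
  have h4 := H.ip_LOp_cutoff (D.contDiffOn_lifted (D.neg_h_le ht.le))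
  rw [D.dI_lifted_zero ht.le] at h4
  refine (h3.congr_deriv ?_).congr_of_eventuallyEq ?_
  · rw [max_eq_left ht.le]
    field_simp
    linarith
  · filter_upwards [Ioi_mem_nhds ht] with s hs
    have hs0 : 0 ≤ s := le_of_lt hs
    simp [traceInt, max_eq_left hs0, min_eq_right hs0]

omit D hqt in
theorem trace_phi_mul_prim (f : ℝ → ℝ → ℝ) (V : ℝ → ℝ) {r t : ℝ} {n : ℕ} (hn : 1 ≤ n)
    (hf : Continuous fun s => ip (f s) (phi n)) (hV : Continuous V)
    (h : lam n * prim (fun s => ip (f s) (phi n)) t = prim V t - r) :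
    p 0 * (dI (phi n) 0 * prim (fun s => ip (f s) (phi n)) t) =
      prim (fun s => V s * ip cutoff (phi n) - ip (f s) (phi n) * ip (LOp p q cutoff) (phi n)) t
        - r * ip cutoff (phi n) := by
  have e : prim (fun s => V s * ip cutoff (phi n)
      - ip (f s) (phi n) * ip (LOp p q cutoff) (phi n)) t =
      prim (fun s => ip cutoff (phi n) * V s
        + (-ip (LOp p q cutoff) (phi n)) * ip (f s) (phi n)) t := by
    congr 1
    ext s
    ring
  rw [e, prim_add (continuous_const.fun_mul hV) (continuous_const.fun_mul hf), prim_const_mul,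
    prim_const_mul, ← mul_assoc, H.trace_phi hn, sub_mul, mul_right_comm, h]
  ring

theorem exists_bound_ip_self (T : ℝ) : ∃ C, ∀ s ∈ Icc 0 T,
    ip (lifted θ₂ z u s) (lifted θ₂ z u s) ≤ C ∧
    ip (forcing p qt θ₂ q_c c h z u s) (forcing p qt θ₂ q_c c h z u s) ≤ C ∧
    ip (z s) (z s) ≤ C := by
  have hs : Ici (0 : ℝ) ⊆ Ici (-h) := Ici_subset_Ici.2 (by linarith [D.hh])
  have hI : Icc 0 T ⊆ Ici (0 : ℝ) := fun _ hs => hs.1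
  obtain ⟨A, hA⟩ := isCompact_Icc.exists_bound_of_continuousOn
    ((continuousOn_ip_self D.continuousOn_lifted).mono (hI.trans hs))
  obtain ⟨B, hB⟩ := isCompact_Icc.exists_bound_of_continuousOn
    ((continuousOn_ip_self (D.continuousOn_forcing H hqt)).mono hI)
  obtain ⟨E, hE⟩ := isCompact_Icc.exists_bound_of_continuousOn
    ((continuousOn_ip_self D.cont).mono (hI.trans hs))
  refine ⟨max A (max B E), fun s hs => ⟨?_, ?_, ?_⟩⟩
  · exact ((le_abs_self _).trans (hA s hs)).trans (le_max_left _ _)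
  · exact ((le_abs_self _).trans (hB s hs)).trans ((le_max_left _ _).trans (le_max_right _ _))
  · exact ((le_abs_self _).trans (hE s hs)).trans ((le_max_right _ _).trans (le_max_right _ _))

theorem sum_trace_eq {t : ℝ} (ht : 0 ≤ t) (m : ℕ) :
    p 0 * ∑ k ∈ Finset.range m, dI (phi (k + 1)) 0
        * prim (fun s => ip (lifted θ₂ z u (max s 0)) (phi (k + 1))) t =
      prim (fun s => ∑ k ∈ Finset.range m,
          (ip (forcing p qt θ₂ q_c c h z u (max s 0)) (phi (k + 1)) * ip cutoff (phi (k + 1))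
            - ip (lifted θ₂ z u (max s 0)) (phi (k + 1)) * ip (LOp p q cutoff) (phi (k + 1)))) t
        - (∑ k ∈ Finset.range m, ip (z t) (phi (k + 1)) * ip cutoff (phi (k + 1))
          - ∑ k ∈ Finset.range m, ip (z 0) (phi (k + 1)) * ip cutoff (phi (k + 1))) := by
  have hn : ∀ k : ℕ, 1 ≤ k + 1 := fun k => Nat.le_add_left 1 k
  have hc1 := fun k => D.continuous_ip_lifted (H.cphi (hn k))
  have hc2 := fun k => D.continuous_ip_forcing H hqt (H.cphi (hn k))
  rw [prim_sum _ (fun k => ((hc2 k).fun_mul continuous_const).fun_sub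
    ((hc1 k).fun_mul continuous_const)), Finset.mul_sum,
    ← Finset.sum_sub_distrib, ← Finset.sum_sub_distrib]
  refine Finset.sum_congr rfl fun k _ => ?_
  rw [← sub_mul]
  exact trace_phi_mul_prim H _ _ (hn k) (hc1 k) (hc2 k) (D.lam_mul_prim H hqt ht (hn k))

theorem bddTendsto_trace_rate (T : ℝ) : BddTendsto T (fun m s => ∑ k ∈ Finset.range m,
      (ip (forcing p qt θ₂ q_c c h z u (max s 0)) (phi (k + 1)) * ip cutoff (phi (k + 1))
        - ip (lifted θ₂ z u (max s 0)) (phi (k + 1)) * ip (LOp p q cutoff) (phi (k + 1))))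
    (fun s => ip (forcing p qt θ₂ q_c c h z u (max s 0)) cutoff
      - ip (lifted θ₂ z u (max s 0)) (LOp p q cutoff)) := by
  have hn : ∀ k : ℕ, 1 ≤ k + 1 := fun k => Nat.le_add_left 1 k
  have hc1 := fun k => D.continuous_ip_lifted (H.cphi (hn k))
  have hc2 := fun k => D.continuous_ip_forcing H hqt (H.cphi (hn k))
  have hψ : ContDiffOn ℝ 2 cutoff (Icc 0 1) := contDiff_cutoff.contDiffOn
  have hLψ := H.continuousOn_LOp hψ
  have hw : ∀ s, 0 ≤ s → ContinuousOn (lifted θ₂ z u s) (Icc 0 1) := fun s hs =>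
    (D.contDiffOn_lifted (D.neg_h_le hs)).continuousOn
  refine ⟨fun m => continuous_finsetSum _ fun k _ => ((hc2 k).fun_mul continuous_const).fun_sub
    ((hc1 k).fun_mul continuous_const), ?_, fun s hs => ?_⟩
  · obtain ⟨C, hC⟩ := D.exists_bound_ip_self H hqt T
    refine ⟨(C + ip cutoff cutoff) + (C + ip (LOp p q cutoff) (LOp p q cutoff)), fun m s hs => ?_⟩
    obtain ⟨h1, h2, -⟩ := hC s hs
    rw [max_eq_left hs.1, Finset.sum_sub_distrib]
    refine (abs_sub _ _).trans (add_le_add ?_ ?_)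
    · exact (H.abs_sum_range_mul_le (D.continuousOn_forcing_slice H hqt hs.1)
        hψ.continuousOn m).trans (by linarith)
    · exact (H.abs_sum_range_mul_le (hw s hs.1) hLψ m).trans (by linarith)
  · rw [max_eq_left hs.1.le]
    exact ((H.hasSum_mul (D.continuousOn_forcing_slice H hqt hs.1.le) hψ.continuousOn).sub
      (H.hasSum_mul (hw s hs.1.le) hLψ)).tendsto_sum_nat

omit D H hqt in
theorem sum_trace_of_nonpos {t : ℝ} (ht : t ≤ 0) (m : ℕ) :
    ∑ k ∈ Finset.range m, dI (phi (k + 1)) 0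
        * prim (fun s => ip (lifted θ₂ z u (max s 0)) (phi (k + 1))) t =
      t * ∑ k ∈ Finset.range m, dI (phi (k + 1)) 0 * ip (lifted θ₂ z u 0) (phi (k + 1)) := by
  rw [Finset.mul_sum]
  refine Finset.sum_congr rfl fun k _ => ?_
  rw [prim_of_const ht fun s hs => by rw [max_eq_right hs.2]]
  ring

omit hqt in
theorem hasSum_trace_zero : HasSum
    (fun k => dI (phi (k + 1)) 0 * ip (lifted θ₂ z u 0) (phi (k + 1))) (dI (z 0) 0) := by
  have hp0 := H.hppos 0 (by simp)
  have hw := D.contDiffOn_lifted (D.neg_h_le le_rfl)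
  have := H.hasSum_trace hw.continuousOn (H.continuousOn_LOp hw)
    fun n hn => H.ip_LOp_phi hw (D.robinBC_lifted H le_rfl) hn
  rwa [← H.ip_LOp_cutoff hw, D.dI_lifted_zero le_rfl, mul_div_cancel_left₀ _ hp0.ne'] at this

theorem tendsto_trace (t : ℝ) : Filter.Tendsto (fun m => ∑ k ∈ Finset.range m, dI (phi (k + 1)) 0
        * prim (fun s => ip (lifted θ₂ z u (max s 0)) (phi (k + 1))) t) Filter.atTop
      (nhds (traceInt p q qt θ₂ q_c c h z u t)) := by
  have hψ : ContDiffOn ℝ 2 cutoff (Icc 0 1) := contDiff_cutoff.contDiffOn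
  rcases le_total 0 t with ht | ht
  · have hp0 := H.hppos 0 (by simp)
    have hz : ∀ s, 0 ≤ s → ContinuousOn (z s) (Icc 0 1) := fun s hs =>
      (D.reg s (D.neg_h_le hs)).continuousOn
    have key := (((D.bddTendsto_trace_rate H hqt t).integral ht).sub
      ((H.hasSum_mul (hz t ht) hψ.continuousOn).tendsto_sum_nat.sub
        (H.hasSum_mul (hz 0 le_rfl) hψ.continuousOn).tendsto_sum_nat)).div_const (p 0)
    have e : traceInt p q qt θ₂ q_c c h z u t = (prim (fun s =>
        ip (forcing p qt θ₂ q_c c h z u (max s 0)) cutoff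
          - ip (lifted θ₂ z u (max s 0)) (LOp p q cutoff)) t
        - (ip (z t) cutoff - ip (z 0) cutoff)) / p 0 := by
      simp [traceInt, max_eq_left ht, min_eq_right ht]
    rw [e]
    refine key.congr fun m => ?_
    rw [div_eq_iff hp0.ne', mul_comm _ (p 0)]
    exact (D.sum_trace_eq H hqt ht m).symm
  · have e : traceInt p q qt θ₂ q_c c h z u t = t * dI (z 0) 0 := by
      simp [traceInt, max_eq_right ht, min_eq_left ht, prim]
    rw [e]
    exact ((D.hasSum_trace_zero H).tendsto_sum_nat.const_mul t).congr fun m =>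
      (sum_trace_of_nonpos ht m).symm

theorem trace_bdd (T : ℝ) : ∃ C, ∀ t ∈ Icc (-1) T, ∀ m, |∑ k ∈ Finset.range m,
    dI (phi (k + 1)) 0 * prim (fun s => ip (lifted θ₂ z u (max s 0)) (phi (k + 1))) t| ≤ C := by
  have hψ : ContDiffOn ℝ 2 cutoff (Icc 0 1) := contDiff_cutoff.contDiffOn
  have hp0 := H.hppos 0 (by simp)
  obtain ⟨A, hA⟩ := (D.bddTendsto_trace_rate H hqt T).bdd
  obtain ⟨B, hB⟩ := D.exists_bound_ip_self H hqt T
  have hw := D.contDiffOn_lifted (D.neg_h_le le_rfl)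
  have hneg := fun m => H.abs_sum_trace_le hw.continuousOn (H.continuousOn_LOp hw)
    (fun n hn => H.ip_LOp_phi hw (D.robinBC_lifted H le_rfl) hn)
    ((Finset.range m).image (· + 1)) (by simp)
  simp only [Finset.sum_image (add_left_injective 1).injOn] at hneg
  obtain ⟨E, hE⟩ : ∃ E, ∀ m, |∑ k ∈ Finset.range m,
      dI (phi (k + 1)) 0 * ip (lifted θ₂ z u 0) (phi (k + 1))| ≤ E := ⟨_, hneg⟩
  refine ⟨max ((A * T + (B + ip cutoff cutoff + (B + ip cutoff cutoff))) / p 0) E,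
    fun t ht m => ?_⟩
  rcases le_total 0 t with h0 | h0
  · refine le_trans ?_ (le_max_left _ _)
    have hz : ∀ s, 0 ≤ s → ContinuousOn (z s) (Icc 0 1) := fun s hs =>
      (D.reg s (D.neg_h_le hs)).continuousOn
    have hA0 : 0 ≤ A := (abs_nonneg _).trans (hA 0 0 ⟨le_rfl, h0.trans ht.2⟩)
    have h1 : |prim (fun s => ∑ k ∈ Finset.range m,
        (ip (forcing p qt θ₂ q_c c h z u (max s 0)) (phi (k + 1)) * ip cutoff (phi (k + 1))
          - ip (lifted θ₂ z u (max s 0)) (phi (k + 1)) * ip (LOp p q cutoff) (phi (k + 1)))) t|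
        ≤ A * T := by
      have := intervalIntegral.norm_integral_le_of_norm_le_const (a := 0) (b := t) (C := A)
        (f := fun s => ∑ k ∈ Finset.range m,
        (ip (forcing p qt θ₂ q_c c h z u (max s 0)) (phi (k + 1)) * ip cutoff (phi (k + 1))
          - ip (lifted θ₂ z u (max s 0)) (phi (k + 1)) * ip (LOp p q cutoff) (phi (k + 1))))
        (fun s hs => by
          rw [uIoc_of_le h0] at hs
          exact hA m s ⟨hs.1.le, hs.2.trans ht.2⟩)
      rw [sub_zero, abs_of_nonneg h0] at this
      exact this.trans (mul_le_mul_of_nonneg_left ht.2 hA0)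
    have h2 := H.abs_sum_range_mul_le (hz t h0) hψ.continuousOn m
    have h3 := H.abs_sum_range_mul_le (hz 0 le_rfl) hψ.continuousOn m
    have h4 := (hB t ⟨h0, ht.2⟩).2.2
    have h5 := (hB 0 ⟨le_rfl, h0.trans ht.2⟩).2.2
    rw [le_div_iff₀ hp0, mul_comm, ← abs_of_pos hp0, ← abs_mul,
      D.sum_trace_eq H hqt h0 m]
    refine (abs_sub _ _).trans (add_le_add h1 ((abs_sub _ _).trans (add_le_add ?_ ?_)))
    · exact h2.trans (by linarith)
    · exact h3.trans (by linarith)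
  · refine le_trans ?_ (le_max_right _ _)
    rw [sum_trace_of_nonpos h0 m, abs_mul]
    refine le_trans ?_ (hE m)
    refine mul_le_of_le_one_left (abs_nonneg _) ?_
    rw [abs_of_nonpos h0]
    linarith [ht.1]

end PlantSolution

theorem sum_Icc_one_eq_sum_range (f : ℕ → ℝ) (N : ℕ) :
    ∑ k ∈ Finset.Icc 1 N, f k = ∑ k ∈ Finset.range N, f (k + 1) := by
  induction N with
  | zero => simp
  | succ n ih => rw [Finset.sum_Icc_succ_top (Nat.le_add_left 1 n), ih, Finset.sum_range_succ]

theorem sum_range_eq_sum_fin_add {N₀ N : ℕ} (hN : N₀ ≤ N) (f : ℕ → ℝ) :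
    ∑ k ∈ Finset.range N, f (k + 1) =
      ∑ i : Fin N₀, f (i.val + 1) + ∑ j : Fin (N - N₀), f (N₀ + j.val + 1) := by
  obtain ⟨r, rfl⟩ := Nat.exists_eq_add_of_le hN
  rw [Finset.sum_range_add, Nat.add_sub_cancel_left, Finset.sum_range, Finset.sum_range]

theorem F1_mulVec (N₀ : ℕ) (lam : ℕ → ℝ) (q_c : ℝ) (B C K L X Y : Fin N₀ → ℝ) :
    F1 N₀ lam q_c B C K L *ᵥ Sum.elim X Y = Sum.elim
      (fun i => (-lam (i.val + 1) + q_c) * X i + B i * (K ⬝ᵥ X) + L i * (C ⬝ᵥ Y))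
      (fun i => (-lam (i.val + 1) + q_c) * Y i - L i * (C ⬝ᵥ Y)) := by
  rw [F1, fromBlocks_mulVec, Sum.elim_comp_inl, Sum.elim_comp_inr, add_mulVec, sub_mulVec,
    vecMulVec_mulVec, vecMulVec_mulVec, zero_mulVec, zero_add]
  congr 1 <;> ext i <;> simp [A0, mulVec_diagonal, mul_comm]

theorem F2_mulVec (N₀ N : ℕ) (L : Fin N₀ → ℝ) (C Y : Fin (N - N₀) → ℝ) :
    F2 N₀ N L C *ᵥ Y = Sum.elim (fun i => L i * (C ⬝ᵥ Y)) fun i => -(L i * (C ⬝ᵥ Y)) := by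
  ext (i | i) <;> simp [F2, mulVec, dotProduct, Finset.mul_sum, mul_assoc]

/-- The components of the observer in closed loop with the plant. -/
structure ObserverSolution (p qt : ℝ → ℝ) (θ₂ q_c c h : ℝ) (lam : ℕ → ℝ) (phi : ℕ → ℝ → ℝ)
    (N₀ N : ℕ) (K L : Fin N₀ → ℝ) (z : ℝ → ℝ → ℝ) (u : ℝ → ℝ) (zhat : ℕ → ℝ → ℝ) : Prop where
  cont : ∀ n, ContinuousOn (zhat n) (Ici (-h))
  history : ∀ n, ∀ τ ∈ Icc (-h) (0 : ℝ), zhat n τ = zhat n 0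
  low : ∀ i : Fin N₀, ∀ t > (0 : ℝ), HasDerivAt (zhat (i.val + 1))
    ((-lam (i.val + 1) + q_c) * zhat (i.val + 1) t + c * zhat (i.val + 1) (t - h)
      + betaC p qt θ₂ q_c lam phi (i.val + 1) * u t
      - L i * ((∑ k ∈ Finset.Icc 1 N, (zhat k t + ip (bFun θ₂) (phi k) * u t) * dI (phi k) 0)
        - dI (z t) 0)) t
  high : ∀ n, N₀ + 1 ≤ n → n ≤ N → ∀ t > (0 : ℝ), HasDerivAt (zhat n)
    ((-lam n + q_c) * zhat n t + c * zhat n (t - h) + betaC p qt θ₂ q_c lam phi n * u t) t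
  feedback : ∀ t ≥ (0 : ℝ), u t = ∑ i : Fin N₀, K i * zhat (i.val + 1) t

/-- The finite-dimensional part of the closed-loop state: observer modes, observation errors and
weighted observation errors. -/
def stateVec (N₀ N : ℕ) (lam : ℕ → ℝ) (phi : ℕ → ℝ → ℝ) (z : ℝ → ℝ → ℝ) (zhat : ℕ → ℝ → ℝ)
    (t : ℝ) : StateIdx N₀ N → ℝ :=
  Sum.elim
    (Sum.elim (fun i => zhat (i.val + 1) t)
      fun i => ip (z t) (phi (i.val + 1)) - zhat (i.val + 1) t)
    (Sum.elim
      (fun j => lam (N₀ + j.val + 1)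
        * (ip (z t) (phi (N₀ + j.val + 1)) - zhat (N₀ + j.val + 1) t))
      fun j => zhat (N₀ + j.val + 1) t)

/-- The part of the measured trace that is carried by the modes beyond the first `N`. -/
def residualTrace (θ₂ : ℝ) (phi : ℕ → ℝ → ℝ) (N : ℕ) (z : ℝ → ℝ → ℝ) (u : ℝ → ℝ) (t : ℝ) : ℝ :=
  dI (z t) 0 - ∑ k ∈ Finset.range N, dI (phi (k + 1)) 0 * ip (lifted θ₂ z u t) (phi (k + 1))

section

variable {p q qt : ℝ → ℝ} {θ₁ θ₂ q_c c h : ℝ} {z : ℝ → ℝ → ℝ} {u : ℝ → ℝ} {lam : ℕ → ℝ}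
  {phi : ℕ → ℝ → ℝ} {N₀ N : ℕ} {K L : Fin N₀ → ℝ} {zhat : ℕ → ℝ → ℝ}
  (O : ObserverSolution p qt θ₂ q_c c h lam phi N₀ N K L z u zhat)
  (D : PlantSolution p q θ₁ θ₂ q_c c h z u)
  (H : SturmLiouville p q θ₁ θ₂ lam phi) (hqt : ∀ x, qt x = q x - q_c) (hN : N₀ + 1 ≤ N)

theorem Kt_dot_stateVec (t : ℝ) : stateV (Kt N₀ K) ⬝ᵥ stateVec N₀ N lam phi z zhat t =
    ∑ i : Fin N₀, K i * zhat (i.val + 1) t := by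
  rw [stateVec, stateV_dot, Kt, sumElim_dotProduct_sumElim, zero_dotProduct, add_zero]
  rfl

include D H hqt

theorem PlantSolution.hasDerivAt_mode_closed {t : ℝ} (ht : 0 < t) {n : ℕ} (hn : 1 ≤ n) :
    HasDerivAt (fun s => ip (z s) (phi n)) ((-lam n + q_c) * ip (z t) (phi n)
      + c * ip (z (t - h)) (phi n) + betaC p qt θ₂ q_c lam phi n * u t) t := by
  refine (D.hasDerivAt_mode H hqt ht hn).congr_deriv ?_
  rw [D.ip_forcing H hqt ht.le (H.cphi hn), D.ip_lifted (D.neg_h_le ht.le) (H.cphi hn), betaC]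
  ring

include O hN

omit O hqt in
theorem innovation_eq {t : ℝ} (ht : 0 ≤ t) :
    (∑ k ∈ Finset.Icc 1 N, (zhat k t + ip (bFun θ₂) (phi k) * u t) * dI (phi k) 0) - dI (z t) 0 =
      -residualTrace θ₂ phi N z u t
        - (∑ i : Fin N₀, dI (phi (i.val + 1)) 0 * (ip (z t) (phi (i.val + 1)) - zhat (i.val + 1) t)
          + ∑ j : Fin (N - N₀), dI (phi (N₀ + j.val + 1)) 0 / lam (N₀ + j.val + 1)
            * (lam (N₀ + j.val + 1)
              * (ip (z t) (phi (N₀ + j.val + 1)) - zhat (N₀ + j.val + 1) t))) := by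
  have e : ∑ j : Fin (N - N₀), dI (phi (N₀ + j.val + 1)) 0 / lam (N₀ + j.val + 1)
      * (lam (N₀ + j.val + 1) * (ip (z t) (phi (N₀ + j.val + 1)) - zhat (N₀ + j.val + 1) t)) =
      ∑ j : Fin (N - N₀), dI (phi (N₀ + j.val + 1)) 0
        * (ip (z t) (phi (N₀ + j.val + 1)) - zhat (N₀ + j.val + 1) t) := by
    refine Finset.sum_congr rfl fun j _ => ?_
    have := (H.hlampos (N₀ + j.val + 1) (by omega)).ne'
    field_simp
  rw [e, ← sum_range_eq_sum_fin_add (by omega)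
    (fun k => dI (phi k) 0 * (ip (z t) (phi k) - zhat k t)), residualTrace,
    sum_Icc_one_eq_sum_range]
  have e2 : ∑ k ∈ Finset.range N, dI (phi (k + 1)) 0 * ip (lifted θ₂ z u t) (phi (k + 1)) =
      ∑ k ∈ Finset.range N, dI (phi (k + 1)) 0 * (ip (z t) (phi (k + 1)) - zhat (k + 1) t)
        + ∑ k ∈ Finset.range N,
          (zhat (k + 1) t + ip (bFun θ₂) (phi (k + 1)) * u t) * dI (phi (k + 1)) 0 := by
    rw [← Finset.sum_add_distrib]
    refine Finset.sum_congr rfl fun k _ => ?_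
    rw [D.ip_lifted (D.neg_h_le ht) (H.cphi (Nat.le_add_left 1 k))]
    ring
  rw [e2]
  ring

theorem hasDerivAt_stateVec {F1m : Matrix (Fin N₀ ⊕ Fin N₀) (Fin N₀ ⊕ Fin N₀) ℝ}
    {F2m : Matrix (Fin N₀ ⊕ Fin N₀) (Fin (N - N₀)) ℝ}
    (hF1m : F1m = F1 N₀ lam q_c (B0 N₀ p qt θ₂ q_c lam phi)
      (fun i => dI (phi (i.val + 1)) 0) K L)
    (hF2m : F2m = F2 N₀ N L
      (fun i => dI (phi (N₀ + i.val + 1)) 0 / lam (N₀ + i.val + 1)))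
    {t : ℝ} (ht : 0 < t) (i : StateIdx N₀ N) :
    HasDerivAt (fun s => stateVec N₀ N lam phi z zhat s i)
      ((stateF F1m F2m (fun j => -lam (N₀ + j.val + 1) + q_c)
          (fun j => betaC p qt θ₂ q_c lam phi (N₀ + j.val + 1)) (Kt N₀ K)
            *ᵥ stateVec N₀ N lam phi z zhat t) i
        + residualTrace θ₂ phi N z u t * stateV (Lv N₀ L) i
        + c * stateVec N₀ N lam phi z zhat (t - h) i) t := by
  have hu : u t = K ⬝ᵥ fun i => zhat (i.val + 1) t := O.feedback t ht.le
  have hinn := innovation_eq (zhat := zhat) D H hN ht.le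
  have hz := fun n (hn : 1 ≤ n) => D.hasDerivAt_mode_closed H hqt ht hn
  have hlow := fun i => O.low i t ht
  have hkt : Kt N₀ K ⬝ᵥ Sum.elim (fun i => zhat (i.val + 1) t)
      (fun i => ip (z t) (phi (i.val + 1)) - zhat (i.val + 1) t) = u t := by
    rw [Kt, sumElim_dotProduct_sumElim, zero_dotProduct, add_zero, hu]
  rw [show stateVec N₀ N lam phi z zhat t = _ from rfl, stateVec, stateF_mulVec, hkt]
  simp only [hinn] at hlow
  rw [hF1m, hF2m, F1_mulVec, F2_mulVec, ← hu]
  rcases i with (i | i) | (j | j)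
  · refine (hlow i).congr_deriv ?_
    simp only [Sum.elim_inl, Pi.add_apply, stateV, Lv, stateVec, B0, dotProduct]
    ring
  · refine ((hz _ (Nat.le_add_left 1 i.val)).sub (hlow i)).congr_deriv ?_
    simp only [Sum.elim_inl, Sum.elim_inr, Pi.add_apply, stateV, Lv, stateVec, dotProduct]
    ring
  · have hn : N₀ + j.val + 1 ≤ N := by omega
    refine (((hz (N₀ + j.val + 1) (by omega)).sub
      (O.high _ (by omega) hn t ht)).const_mul (lam (N₀ + j.val + 1))).congr_deriv ?_
    simp only [Sum.elim_inl, Sum.elim_inr, stateV, stateVec, Pi.zero_apply]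
    ring
  · have hn : N₀ + j.val + 1 ≤ N := by omega
    refine (O.high _ (by omega) hn t ht).congr_deriv ?_
    simp only [Sum.elim_inr, stateV, stateVec, Pi.zero_apply]
    ring

end

theorem prim_mulVec {ι : Type} [Fintype ι] (F : Matrix ι ι ℝ) {x : ℝ → ι → ℝ}
    (hx : ∀ j, Continuous fun t => x t j) (t : ℝ) (i : ι) :
    prim (fun s => (F *ᵥ x s) i) t = (F *ᵥ fun j => prim (fun s => x s j) t) i := by
  simp only [mulVec, dotProduct]
  rw [prim_sum _ fun j => continuous_const.fun_mul (hx j)]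
  exact Finset.sum_congr rfl fun j _ => prim_const_mul _ _ _

theorem prim_dotProduct {ι : Type} [Fintype ι] (v : ι → ℝ) {x : ℝ → ι → ℝ}
    (hx : ∀ j, Continuous fun t => x t j) (t : ℝ) :
    prim (fun s => v ⬝ᵥ x s) t = v ⬝ᵥ fun j => prim (fun s => x s j) t := by
  simp only [dotProduct]
  rw [prim_sum _ fun j => continuous_const.fun_mul (hx j)]
  exact Finset.sum_congr rfl fun j _ => prim_const_mul _ _ _

@[simp]
theorem prim_zero (f : ℝ → ℝ) : prim f 0 = 0 := by simp [prim]

/-- The time integral of `residualTrace`. -/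
def residualInt (p q qt : ℝ → ℝ) (θ₂ q_c c h : ℝ) (phi : ℕ → ℝ → ℝ) (N : ℕ) (z : ℝ → ℝ → ℝ)
    (u : ℝ → ℝ) (t : ℝ) : ℝ :=
  traceInt p q qt θ₂ q_c c h z u t - ∑ k ∈ Finset.range N, dI (phi (k + 1)) 0
    * prim (fun s => ip (lifted θ₂ z u (max s 0)) (phi (k + 1))) t

namespace PlantSolution

variable {p q qt : ℝ → ℝ} {θ₁ θ₂ q_c c h : ℝ} {z : ℝ → ℝ → ℝ} {u : ℝ → ℝ} {lam : ℕ → ℝ}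
  {phi : ℕ → ℝ → ℝ} (D : PlantSolution p q θ₁ θ₂ q_c c h z u)
  (H : SturmLiouville p q θ₁ θ₂ lam phi) (hqt : ∀ x, qt x = q x - q_c)
include D H hqt

theorem continuous_residualInt (N : ℕ) :
    Continuous (residualInt p q qt θ₂ q_c c h phi N z u) :=
  (D.continuous_traceInt H hqt).sub (continuous_finsetSum _ fun k _ =>
    continuous_const.mul (continuous_prim (D.continuous_ip_lifted (H.cphi (Nat.le_add_left 1 k)))))

theorem hasDerivAt_residualInt (N : ℕ) {t : ℝ} (ht : 0 < t) :
    HasDerivAt (residualInt p q qt θ₂ q_c c h phi N z u) (residualTrace θ₂ phi N z u t) t := by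
  refine (D.hasDerivAt_traceInt H hqt ht).sub (HasDerivAt.fun_sum fun k _ => ?_)
  have := hasDerivAt_prim (D.continuous_ip_lifted (H.cphi (Nat.le_add_left 1 k))) t
  simpa only [max_eq_left ht.le] using this.const_mul (dI (phi (k + 1)) 0)

omit D H hqt in
theorem residualInt_of_nonpos (N : ℕ) {t : ℝ} (ht : t ≤ 0) :
    residualInt p q qt θ₂ q_c c h phi N z u t = t * residualTrace θ₂ phi N z u 0 := by
  rw [residualInt, sum_trace_of_nonpos ht, residualTrace, mul_sub]
  congr 1
  simp [traceInt, max_eq_right ht, min_eq_left ht, prim]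

theorem tendsto_residual_trace (N : ℕ) (t : ℝ) : Filter.Tendsto
    (fun m => ∑ k ∈ Finset.range m, dI (phi (N + 1 + k)) 0
      * prim (fun s => ip (lifted θ₂ z u (max s 0)) (phi (N + 1 + k))) t) Filter.atTop
    (nhds (residualInt p q qt θ₂ q_c c h phi N z u t)) := by
  have := ((Filter.tendsto_add_atTop_iff_nat N).2 (D.tendsto_trace H hqt t)).sub_const
    (∑ k ∈ Finset.range N, dI (phi (k + 1)) 0
      * prim (fun s => ip (lifted θ₂ z u (max s 0)) (phi (k + 1))) t)
  refine this.congr fun m => ?_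
  rw [add_comm m N, Finset.sum_range_add, add_sub_cancel_left]
  simp only [Nat.add_right_comm N 1]

theorem residual_trace_bdd (N : ℕ) (T : ℝ) : ∃ C, ∀ t ∈ Icc (-1) T, ∀ m,
    |∑ k ∈ Finset.range m, dI (phi (N + 1 + k)) 0
      * prim (fun s => ip (lifted θ₂ z u (max s 0)) (phi (N + 1 + k))) t| ≤ C := by
  obtain ⟨C, hC⟩ := D.trace_bdd H hqt T
  refine ⟨C + C, fun t ht m => ?_⟩
  have h1 := hC t ht (N + m)
  rw [Finset.sum_range_add] at h1
  simp only [Nat.add_right_comm N 1]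
  have h2 := hC t ht N
  rw [abs_le] at *
  constructor <;> linarith

end PlantSolution

section

variable {p q qt : ℝ → ℝ} {θ₁ θ₂ q_c c h : ℝ} {z : ℝ → ℝ → ℝ} {u : ℝ → ℝ} {lam : ℕ → ℝ}
  {phi : ℕ → ℝ → ℝ} {N₀ N : ℕ} {K L : Fin N₀ → ℝ} {zhat : ℕ → ℝ → ℝ}
  (O : ObserverSolution p qt θ₂ q_c c h lam phi N₀ N K L z u zhat)
  (D : PlantSolution p q θ₁ θ₂ q_c c h z u)
  (H : SturmLiouville p q θ₁ θ₂ lam phi) (hqt : ∀ x, qt x = q x - q_c) (hN : N₀ + 1 ≤ N)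

include O D H

theorem continuousOn_stateVec (i : StateIdx N₀ N) :
    ContinuousOn (fun t => stateVec N₀ N lam phi z zhat t i) (Ici (-h)) := by
  have hz : ∀ n, ContinuousOn (fun t => ip (z t) (phi (n + 1))) (Ici (-h)) := fun n =>
    continuousOn_ip D.cont (H.cphi (Nat.le_add_left 1 n))
  rcases i with (i | i) | (j | j)
  · exact O.cont _
  · exact (hz _).sub (O.cont _)
  · exact continuousOn_const.mul ((hz _).sub (O.cont _))
  · exact O.cont _

omit O H D in
theorem continuous_comp_max_sub {f : ℝ → ℝ} (hf : ContinuousOn f (Ici (-h))) :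
    Continuous fun t => f (max t 0 - h) :=
  hf.comp_continuous (by fun_prop) fun t => mem_Ici.2 (by linarith [le_max_right t 0])

include hqt hN

theorem ModalLMI.weakSol_of_plantSolution
    {F1m : Matrix (Fin N₀ ⊕ Fin N₀) (Fin N₀ ⊕ Fin N₀) ℝ}
    {F2m : Matrix (Fin N₀ ⊕ Fin N₀) (Fin (N - N₀)) ℝ}
    (hF1m : F1m = F1 N₀ lam q_c (B0 N₀ p qt θ₂ q_c lam phi)
      (fun i => dI (phi (i.val + 1)) 0) K L)
    (hF2m : F2m = F2 N₀ N L
      (fun i => dI (phi (N₀ + i.val + 1)) 0 / lam (N₀ + i.val + 1)))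
    {S : ModalLMI (StateIdx N₀ N)} (hSc : S.c = c) (hSq : S.qc = q_c)
    (hSF : S.F = stateF F1m F2m (fun j => -lam (N₀ + j.val + 1) + q_c)
      (fun j => betaC p qt θ₂ q_c lam phi (N₀ + j.val + 1)) (Kt N₀ K))
    (hSG : S.G = stateV (Lv N₀ L)) (hSκ : S.κ = stateV (Kt N₀ K))
    (hSlam : S.lam = fun k => lam (N + 1 + k))
    (hSa : S.a = fun k => ip (aFun p qt θ₂) (phi (N + 1 + k)))
    (hSb : S.b = fun k => ip (bFun θ₂) (phi (N + 1 + k)))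
    (hSφ : S.φ = fun k => dI (phi (N + 1 + k)) 0) :
    ∃ rX rW, S.WeakSol (fun t => stateVec N₀ N lam phi z zhat (max t 0))
      (fun t => stateVec N₀ N lam phi z zhat (max t 0 - h))
      (fun k t => ip (lifted θ₂ z u (max t 0)) (phi (N + 1 + k)))
      (fun k t => ip (lifted θ₂ z u (max t 0 - h)) (phi (N + 1 + k)))
      (fun t => u (max t 0 - h) - S.κ ⬝ᵥ stateVec N₀ N lam phi z zhat (max t 0 - h))
      (residualInt p q qt θ₂ q_c c h phi N z u) rX rW := by
  have hn : ∀ k, 1 ≤ N + 1 + k := fun k => by omega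
  set X := stateVec N₀ N lam phi z zhat with hX
  set Z := residualInt p q qt θ₂ q_c c h phi N z u with hZ
  set ζ₀ := residualTrace θ₂ phi N z u 0 with hζ₀
  have hneg : Ici (0 : ℝ) ⊆ Ici (-h) := Ici_subset_Ici.2 (by linarith [D.hh])
  have hXc : ∀ i, Continuous fun t => X (max t 0) i := fun i =>
    ((continuousOn_stateVec O D H i).mono hneg).continuous_max
  have hXhc : ∀ i, Continuous fun t => X (max t 0 - h) i := fun i =>
    continuous_comp_max_sub (continuousOn_stateVec O D H i)
  have huc : Continuous fun t => u (max t 0 - h) := continuous_comp_max_sub D.cont_u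
  have hwc : ∀ k, Continuous fun t => ip (lifted θ₂ z u (max t 0)) (phi (N + 1 + k)) := fun k =>
    D.continuous_ip_lifted (H.cphi (hn k))
  have hwhc : ∀ k, Continuous fun t => ip (lifted θ₂ z u (max t 0 - h)) (phi (N + 1 + k)) :=
    fun k => continuous_comp_max_sub (continuousOn_ip D.continuousOn_lifted (H.cphi (hn k)))
  have hdc : Continuous fun t => u (max t 0 - h) - S.κ ⬝ᵥ X (max t 0 - h) := by
    simp only [dotProduct]
    exact huc.sub (continuous_finsetSum _ fun i _ => continuous_const.mul (hXhc i))
  have hZc : Continuous Z := D.continuous_residualInt H hqt N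
  have hZ0 : Z 0 = 0 := by rw [hZ, PlantSolution.residualInt_of_nonpos N le_rfl, zero_mul]
  have hZneg : ∀ t ≤ 0, Z t = t * ζ₀ := fun t ht => PlantSolution.residualInt_of_nonpos N ht
  have hfb : ∀ t ≥ 0, u t = S.κ ⬝ᵥ X t := fun t ht => by
    rw [hSκ, hX, Kt_dot_stateVec, O.feedback t ht]
  have hκX : Continuous fun t => S.κ ⬝ᵥ X (max t 0) := by
    simp only [dotProduct]
    exact continuous_finsetSum _ fun i _ => continuous_const.mul (hXc i)
  have hFX : ∀ i, Continuous fun t => (S.F *ᵥ X (max t 0)) i := fun i => by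
    simp only [mulVec, dotProduct]
    exact continuous_finsetSum _ fun j _ => continuous_const.mul (hXc j)
  have hxpos : ∀ t ≥ 0, ∀ i, X t i = X 0 i + (S.F *ᵥ fun j => prim (fun s => X (max s 0) j) t) i
      + Z t * S.G i + S.c * prim (fun s => X (max s 0 - h) i) t := by
    intro t ht i
    have := eq_add_prim_of_hasDerivAt (f := fun s => X s i - Z s * S.G i)
      (g := fun s => (S.F *ᵥ X (max s 0)) i + S.c * X (max s 0 - h) i)
      (((continuousOn_stateVec O D H i).mono hneg).sub (by fun_prop))
      ((hFX i).add (continuous_const.mul (hXhc i)))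
      (fun s hs => by
        refine ((hasDerivAt_stateVec O D H hqt hN hF1m hF2m hs i).sub
          ((D.hasDerivAt_residualInt H hqt N hs).mul_const (S.G i))).congr_deriv ?_
        rw [hSF, hSG, hSc, max_eq_left hs.le]
        ring) ht
    rw [prim_add (hFX i) (continuous_const.fun_mul (hXhc i)), prim_const_mul,
      prim_mulVec S.F hXc, hZ0] at this
    linarith
  set rX : StateIdx N₀ N → ℝ := fun i => (S.F *ᵥ X 0) i + ζ₀ * S.G i + S.c * X (0 - h) i with hrX
  set rW : ℕ → ℝ := fun k => (-S.lam k + S.qc) * ip (lifted θ₂ z u 0) (phi (N + 1 + k))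
    + S.c * ip (lifted θ₂ z u (0 - h)) (phi (N + 1 + k)) + S.a k * (S.κ ⬝ᵥ X 0)
    + S.b k * (S.κ ⬝ᵥ (S.F *ᵥ X 0 + ζ₀ • S.G) - S.c * (u (0 - h) - S.κ ⬝ᵥ X (0 - h))) with hrW
  refine ⟨rX, rW, ?_⟩
  have hpX : ∀ t ≤ 0, (fun j => prim (fun s => X (max s 0) j) t) = t • X 0 := fun t ht => by
    ext j
    rw [prim_of_const ht fun s hs => by rw [max_eq_right hs.2]]
    rfl
  have hpos : ∀ t ≥ 0, ∀ n, 1 ≤ n → ip (lifted θ₂ z u t) (phi n) = ip (lifted θ₂ z u 0) (phi n)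
      + (-lam n + q_c) * prim (fun s => ip (lifted θ₂ z u (max s 0)) (phi n)) t
      + c * prim (fun s => ip (lifted θ₂ z u (max s 0 - h)) (phi n)) t
      + ip (aFun p qt θ₂) (phi n) * (S.κ ⬝ᵥ fun j => prim (fun s => X (max s 0) j) t)
      + ip (bFun θ₂) (phi n) * (S.κ ⬝ᵥ (S.F *ᵥ (fun j => prim (fun s => X (max s 0) j) t)
        + Z t • S.G) - c * prim (fun s => u (max s 0 - h) - S.κ ⬝ᵥ X (max s 0 - h)) t) := by
    intro t ht n hn
    have hb := fun s (hs : -h ≤ s) => D.ip_lifted hs (H.cphi hn)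
    have hwn : Continuous fun s => ip (lifted θ₂ z u (max s 0)) (phi n) :=
      D.continuous_ip_lifted (H.cphi hn)
    have hwhn : Continuous fun s => ip (lifted θ₂ z u (max s 0 - h)) (phi n) :=
      continuous_comp_max_sub (continuousOn_ip D.continuousOn_lifted (H.cphi hn))
    have hκXh : Continuous fun s => S.κ ⬝ᵥ X (max s 0 - h) := by
      simp only [dotProduct]
      exact continuous_finsetSum _ fun i _ => continuous_const.mul (hXhc i)
    have e1 : (fun s => ip (forcing p qt θ₂ q_c c h z u (max s 0)) (phi n)) = fun s =>
        ip (aFun p qt θ₂) (phi n) * (S.κ ⬝ᵥ X (max s 0))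
          + (q_c * ip (lifted θ₂ z u (max s 0)) (phi n)
            + (c * ip (lifted θ₂ z u (max s 0 - h)) (phi n)
              + -(c * ip (bFun θ₂) (phi n)) * u (max s 0 - h))) := by
      funext s
      have hs := le_max_right s 0
      rw [D.ip_forcing H hqt hs (H.cphi hn), hb (max s 0 - h) (by linarith), hfb _ hs]
      ring
    have h1 := D.lam_mul_prim H hqt ht hn
    have k1 := continuous_const (y := c).fun_mul hwhn
    have k2 := continuous_const (y := -(c * ip (bFun θ₂) (phi n))).fun_mul huc
    have k3 := continuous_const (y := q_c).fun_mul hwn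
    rw [e1, prim_add (continuous_const.fun_mul hκX) (k3.fun_add (k1.fun_add k2)),
      prim_add k3 (k1.fun_add k2), prim_add k1 k2, prim_const_mul, prim_const_mul, prim_const_mul,
      prim_const_mul, prim_dotProduct _ hXc] at h1
    have h2 : prim (fun s => u (max s 0 - h)) t =
        prim (fun s => u (max s 0 - h) - S.κ ⬝ᵥ X (max s 0 - h)) t
          + S.κ ⬝ᵥ fun j => prim (fun s => X (max s 0 - h) j) t := by
      rw [← prim_dotProduct _ hXhc, ← prim_add hdc hκXh]
      simp only [sub_add_cancel]
    have h3 : u t = u 0 + S.κ ⬝ᵥ (S.F *ᵥ (fun j => prim (fun s => X (max s 0) j) t) + Z t • S.G)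
        + c * S.κ ⬝ᵥ fun j => prim (fun s => X (max s 0 - h) j) t := by
      rw [hfb t ht, hfb 0 le_rfl, ← smul_eq_mul, ← dotProduct_smul, ← dotProduct_add,
        ← dotProduct_add]
      congr 1
      funext i
      simp only [Pi.add_apply, Pi.smul_apply, smul_eq_mul]
      rw [hxpos t ht i, hSc]
      ring
    rw [hb t (D.neg_h_le ht), hb 0 (D.neg_h_le le_rfl), h3]
    rw [h2] at h1
    linear_combination h1
  constructor
  · exact hXc
  · exact hXhc
  · exact hwc
  · exact hwhc
  · exact hdc
  · exact hZc
  · intro i t ht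
    simp only [max_eq_right ht, max_self]
  · intro k t ht
    simp only [max_eq_right ht, max_self]
  · intro t i
    rcases le_total 0 t with ht | ht
    · simp only [max_eq_left ht, max_self, min_eq_right ht, zero_mul, sub_zero]
      exact hxpos t ht i
    · simp only [max_eq_right ht, max_self, min_eq_left ht]
      rw [hpX t ht, mulVec_smul, hZneg t ht, hrX,
        prim_of_const (r := X (0 - h) i) ht fun s hs => by rw [max_eq_right hs.2]]
      simp only [Pi.smul_apply, smul_eq_mul]
      ring
  · intro t k
    rcases le_total 0 t with ht | ht
    · simp only [max_eq_left ht, max_self, min_eq_right ht, zero_mul, sub_zero]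
      rw [hSlam, hSq, hSc, hSa, hSb]
      exact hpos t ht _ (hn k)
    · simp only [max_eq_right ht, max_self, min_eq_left ht]
      rw [hpX t ht, mulVec_smul, hZneg t ht, hrW,
        prim_of_const (r := ip (lifted θ₂ z u 0) (phi (N + 1 + k))) ht
          fun s hs => by rw [max_eq_right hs.2],
        prim_of_const (r := ip (lifted θ₂ z u (0 - h)) (phi (N + 1 + k))) ht
          fun s hs => by rw [max_eq_right hs.2],
        prim_of_const (r := u (0 - h) - S.κ ⬝ᵥ X (0 - h)) ht
          fun s hs => by rw [max_eq_right hs.2],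
        mul_smul, ← smul_add, dotProduct_smul, dotProduct_smul]
      simp only [smul_eq_mul]
      ring
  · have h0 := D.neg_h_le le_rfl
    have hh : -h ≤ 0 - h := by linarith
    have hw0 := D.contDiffOn_lifted h0
    have c1 := (H.continuousOn_LOp hw0)
    have c2 := hw0.continuousOn
    have c3 := (D.contDiffOn_lifted hh).continuousOn
    have c4 := continuousOn_aFun θ₂ H.hp1 H.hqc hqt
    have c5 : ContinuousOn (bFun θ₂) (Icc 0 1) := (contDiff_bFun θ₂).continuous.continuousOn
    set r := S.κ ⬝ᵥ (S.F *ᵥ X 0 + ζ₀ • S.G) - S.c * (u (0 - h) - S.κ ⬝ᵥ X (0 - h)) with hr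
    have m1 := continuousOn_const (c := -1).fun_mul c1
    have m2 := continuousOn_const (c := q_c).fun_mul c2
    have m3 := continuousOn_const (c := c).fun_mul c3
    have m4 := continuousOn_const (c := u 0).fun_mul c4
    have m5 := continuousOn_const (c := r).fun_mul c5
    have hg := m1.fun_add (m2.fun_add (m3.fun_add (m4.fun_add m5)))
    have e : ∀ k, rW k = ip (fun x => -1 * LOp p q (lifted θ₂ z u 0) x
        + (q_c * lifted θ₂ z u 0 x + (c * lifted θ₂ z u (0 - h) x
          + (u 0 * aFun p qt θ₂ x + r * bFun θ₂ x)))) (phi (N + 1 + k)) := fun k => by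
      have hφ := H.cphi (hn k)
      rw [ip_add_left m1 (m2.fun_add (m3.fun_add (m4.fun_add m5))) hφ,
        ip_add_left m2 (m3.fun_add (m4.fun_add m5)) hφ, ip_add_left m3 (m4.fun_add m5) hφ,
        ip_add_left m4 m5 hφ, ip_const_mul_left, ip_const_mul_left, ip_const_mul_left,
        ip_const_mul_left, ip_const_mul_left, H.ip_LOp_phi hw0 (D.robinBC_lifted H le_rfl) (hn k),
        hrW, hfb 0 le_rfl, hSlam, hSq, hSc, hSa, hSb]
      ring
    have hs := fun m => H.sum_sq_le hg ((Finset.range m).image (N + 1 + ·)) (by simp; omega)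
    simp only [Finset.sum_image (add_right_injective (N + 1)).injOn, ← e] at hs
    exact ⟨_, hs⟩
  · intro t
    rw [hSφ]
    exact D.tendsto_residual_trace H hqt N t
  · intro T
    rw [hSφ]
    exact D.residual_trace_bdd H hqt N T

end

section

theorem ip_self_le_of_eq {f g k : ℝ → ℝ} {r : ℝ} (hg : ContinuousOn g (Icc 0 1))
    (hk : ContinuousOn k (Icc 0 1)) (e : ∀ x ∈ Icc (0 : ℝ) 1, f x = g x + r * k x) :
    ip f f ≤ 2 * ip g g + 2 * r ^ 2 * ip k k := by
  have hk' := continuousOn_const (c := r).fun_mul hk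
  have hk'' := continuousOn_const (c := -r).fun_mul hk
  have h1 := ip_self_nonneg fun x => g x + -r * k x
  rw [ip_congr e e]
  rw [ip_add_left hg hk' (hg.fun_add hk'), ip_add_right hg hg hk', ip_add_right hk' hg hk',
    ip_const_mul_left, ip_const_mul_left, ip_const_mul_right, ip_const_mul_right]
  rw [ip_add_left hg hk'' (hg.fun_add hk''), ip_add_right hg hg hk'', ip_add_right hk'' hg hk'',
    ip_const_mul_left, ip_const_mul_left, ip_const_mul_right, ip_const_mul_right] at h1
  linarith

theorem sq_le_dotProduct_self {ι : Type} [Fintype ι] (x : ι → ℝ) (i : ι) : x i ^ 2 ≤ x ⬝ᵥ x := by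
  rw [sq]
  exact Finset.single_le_sum (f := fun i => x i * x i) (fun i _ => mul_self_nonneg (x i))
    (Finset.mem_univ i)

variable {p q qt : ℝ → ℝ} {θ₁ θ₂ q_c c h : ℝ} {lam : ℕ → ℝ} {phi : ℕ → ℝ → ℝ} {N₀ N : ℕ}
  {K L : Fin N₀ → ℝ} (H : SturmLiouville p q θ₁ θ₂ lam phi)

include H

theorem exists_stateVec_dot_le (hN : N₀ + 1 ≤ N) : ∃ C > 0, ∀ (z : ℝ → ℝ → ℝ) (zhat : ℕ → ℝ → ℝ)
    (s J : ℝ), ContinuousOn (z s) (Icc 0 1) → ip (z s) (z s) ≤ J →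
    (∀ n ∈ Finset.Icc 1 N, zhat n s ^ 2 ≤ J) →
    stateVec N₀ N lam phi z zhat s ⬝ᵥ stateVec N₀ N lam phi z zhat s ≤ C * J := by
  set ω : StateIdx N₀ N → ℝ := Sum.elim (Sum.elim (fun _ => 1) fun _ => 4)
    (Sum.elim (fun j => 4 * lam (N₀ + j.val + 1) ^ 2) fun _ => 1) with hω
  refine ⟨∑ i, ω i + 1, ?_, fun z zhat s J hz hJ hzh => ?_⟩
  · have : 0 ≤ ∑ i, ω i := Finset.sum_nonneg fun i _ => by
      rcases i with (i | i) | (j | j) <;> simp only [hω, Sum.elim_inl, Sum.elim_inr] <;> positivity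
    linarith
  have hJ0 : 0 ≤ J := (ip_self_nonneg _).trans hJ
  have hz2 : ∀ n ≥ 1, ip (z s) (phi n) ^ 2 ≤ J := fun n hn => (H.sq_ip_phi_le hz hn).trans hJ
  have he : ∀ n ∈ Finset.Icc 1 N, (ip (z s) (phi n) - zhat n s) ^ 2 ≤ 4 * J := fun n hn => by
    have h1 := hz2 n (Finset.mem_Icc.1 hn).1
    have h2 := hzh n hn
    nlinarith [sq_nonneg (ip (z s) (phi n) + zhat n s)]
  calc stateVec N₀ N lam phi z zhat s ⬝ᵥ stateVec N₀ N lam phi z zhat s ≤ ∑ i, ω i * J := by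
        refine Finset.sum_le_sum fun i _ => ?_
        rw [← sq]
        rcases i with (i | i) | (j | j) <;> simp only [hω, Sum.elim_inl, Sum.elim_inr, stateVec]
        · rw [one_mul]
          exact hzh _ (Finset.mem_Icc.2 (by omega))
        · exact he _ (Finset.mem_Icc.2 (by omega))
        · rw [mul_pow]
          have := mul_le_mul_of_nonneg_left (he (N₀ + j.val + 1) (Finset.mem_Icc.2 (by omega)))
            (sq_nonneg (lam (N₀ + j.val + 1)))
          linarith
        · rw [one_mul]
          exact hzh _ (Finset.mem_Icc.2 (by omega))
    _ ≤ (∑ i, ω i + 1) * J := by rw [← Finset.sum_mul]; linarith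

theorem exists_norm_le (hN : N₀ + 1 ≤ N) :
    ∃ C > 0, ∀ (z : ℝ → ℝ → ℝ) (u : ℝ → ℝ) (zhat : ℕ → ℝ → ℝ),
      PlantSolution p q θ₁ θ₂ q_c c h z u →
      ObserverSolution p qt θ₂ q_c c h lam phi N₀ N K L z u zhat →
      ∀ t ≥ 0, ∀ Y, (∀ m, stateVec N₀ N lam phi z zhat t ⬝ᵥ stateVec N₀ N lam phi z zhat t
        + ∑ k ∈ Finset.range m, lam (N + 1 + k) * ip (lifted θ₂ z u t) (phi (N + 1 + k)) ^ 2 ≤ Y) →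
      ip (z t) (z t) + ip (dI (z t)) (dI (z t)) + ∑ n ∈ Finset.Icc 1 N, zhat n t ^ 2 ≤ C * Y := by
  obtain ⟨C₀, hC₀, hC⟩ := H.exists_energy_ge
  set κ := stateV (N := N) (Kt N₀ K) with hκ
  set A : ℝ := ∑ n ∈ Finset.range N, lam (n + 1)
    * (4 * (1 + (1 + (lam (n + 1))⁻¹ ^ 2)) + 2 * ip (bFun θ₂) (phi (n + 1)) ^ 2 * (κ ⬝ᵥ κ)) with hA
  have hκ0 : 0 ≤ κ ⬝ᵥ κ := Finset.sum_nonneg fun i _ => mul_self_nonneg _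
  have hb0 := ip_self_nonneg (bFun θ₂)
  have hb1 := ip_self_nonneg (dI (bFun θ₂))
  have hA0 : 0 ≤ A := Finset.sum_nonneg fun n _ => by
    have := H.hlampos (n + 1) (by omega)
    positivity
  refine ⟨2 * ((A + 1) / C₀) + 2 * (κ ⬝ᵥ κ) * (ip (bFun θ₂) (bFun θ₂)
    + ip (dI (bFun θ₂)) (dI (bFun θ₂))) + N, ?_, fun z u zhat D O t ht Y hY => ?_⟩
  · positivity
  set X := stateVec N₀ N lam phi z zhat t with hX
  have hw := D.contDiffOn_lifted (D.neg_h_le ht)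
  have hXX : X ⬝ᵥ X ≤ Y := by simpa using hY 0
  have hX0 : 0 ≤ X ⬝ᵥ X := Finset.sum_nonneg fun i _ => mul_self_nonneg _
  have hY0 : 0 ≤ Y := hX0.trans hXX
  have hu : u t ^ 2 ≤ κ ⬝ᵥ κ * Y := by
    rw [O.feedback t ht, ← Kt_dot_stateVec (N := N) (lam := lam) (phi := phi) (z := z)]
    exact (sq_dotProduct_le _ _).trans (mul_le_mul_of_nonneg_left hXX hκ0)
  have hcomp : ∀ n, 1 ≤ n → n ≤ N → zhat n t ^ 2 ≤ Y ∧
      (ip (z t) (phi n) - zhat n t) ^ 2 ≤ (1 + (lam n)⁻¹ ^ 2) * Y := fun n hn hnN => by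
    rcases le_or_gt n N₀ with hn0 | hn0
    · obtain ⟨i, rfl⟩ : ∃ i : Fin N₀, n = i.val + 1 := ⟨⟨n - 1, by omega⟩, by simp; omega⟩
      have h1 := sq_le_dotProduct_self X (Sum.inl (Sum.inl i))
      have h2 := sq_le_dotProduct_self X (Sum.inl (Sum.inr i))
      simp only [hX, stateVec, Sum.elim_inl, Sum.elim_inr] at h1 h2
      refine ⟨h1.trans hXX, h2.trans (hXX.trans ?_)⟩
      nlinarith [sq_nonneg (lam (i.val + 1))⁻¹, mul_nonneg (sq_nonneg (lam (i.val + 1))⁻¹) hY0]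
    · obtain ⟨j, rfl⟩ : ∃ j : Fin (N - N₀), n = N₀ + j.val + 1 :=
        ⟨⟨n - N₀ - 1, by omega⟩, by simp; omega⟩
      have h1 := sq_le_dotProduct_self X (Sum.inr (Sum.inr j))
      have h2 := sq_le_dotProduct_self X (Sum.inr (Sum.inl j))
      simp only [hX, stateVec, Sum.elim_inl, Sum.elim_inr] at h1 h2
      refine ⟨h1.trans hXX, ?_⟩
      have hl := H.hlampos (N₀ + j.val + 1) (by omega)
      have h3 := mul_le_mul_of_nonneg_left (h2.trans hXX) (sq_nonneg (lam (N₀ + j.val + 1))⁻¹)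
      rw [← mul_pow, inv_mul_cancel_left₀ hl.ne'] at h3
      linarith
  have hlow : ∑ n ∈ Finset.range N, lam (n + 1) * ip (lifted θ₂ z u t) (phi (n + 1)) ^ 2
      ≤ A * Y := by
    rw [hA, Finset.sum_mul]
    refine Finset.sum_le_sum fun n hn => ?_
    have hl := H.hlampos (n + 1) (by omega)
    rw [mul_assoc]
    refine mul_le_mul_of_nonneg_left ?_ hl.le
    obtain ⟨h1, h2⟩ := hcomp (n + 1) (by omega) (Finset.mem_range.1 hn)
    rw [D.ip_lifted (D.neg_h_le ht) (H.cphi (by omega))]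
    have h3 := mul_le_mul_of_nonneg_left hu (sq_nonneg (ip (bFun θ₂) (phi (n + 1))))
    set e := ip (z t) (phi (n + 1)) - zhat (n + 1) t with he
    set v := u t * ip (bFun θ₂) (phi (n + 1)) with hv
    have h4 : v ^ 2 ≤ ip (bFun θ₂) (phi (n + 1)) ^ 2 * (κ ⬝ᵥ κ * Y) := by
      rw [hv, mul_pow, mul_comm]
      exact h3
    have h5 : ip (z t) (phi (n + 1)) = e + zhat (n + 1) t := by rw [he]; ring
    rw [h5]
    nlinarith [sq_nonneg (e - zhat (n + 1) t), sq_nonneg (e + zhat (n + 1) t - v)]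
  have hE : ip (LOp p q (lifted θ₂ z u t)) (lifted θ₂ z u t) ≤ (A + 1) * Y := by
    have hs := H.hasSum_lam_sq hw (D.robinBC_lifted H ht)
    refine le_of_tendsto ((Filter.tendsto_add_atTop_iff_nat N).2 hs.tendsto_sum_nat)
      (Filter.Eventually.of_forall fun m => ?_)
    rw [add_comm m N, Finset.sum_range_add]
    have := hY m
    simp only [Nat.add_right_comm N 1] at this
    linarith
  have hH1 := hC _ hw (D.robinBC_lifted H ht)
  have hH2 : ip (lifted θ₂ z u t) (lifted θ₂ z u t) + ip (dI (lifted θ₂ z u t))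
      (dI (lifted θ₂ z u t)) ≤ (A + 1) / C₀ * Y := by
    rw [div_mul_eq_mul_div, le_div_iff₀ hC₀]
    linarith
  have hbc : ContDiffOn ℝ 2 (bFun θ₂) (Icc 0 1) := (contDiff_bFun θ₂).contDiffOn
  have hz1 : ip (z t) (z t) ≤ 2 * ip (lifted θ₂ z u t) (lifted θ₂ z u t)
      + 2 * (-u t) ^ 2 * ip (bFun θ₂) (bFun θ₂) :=
    ip_self_le_of_eq hw.continuousOn hbc.continuousOn fun x _ => by rw [lifted]; ring
  have hz2 : ip (dI (z t)) (dI (z t)) ≤ 2 * ip (dI (lifted θ₂ z u t)) (dI (lifted θ₂ z u t))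
      + 2 * (-u t) ^ 2 * ip (dI (bFun θ₂)) (dI (bFun θ₂)) := by
    refine ip_self_le_of_eq (continuousOn_dI (hw.of_le (by norm_num)))
      (continuousOn_dI (hbc.of_le (by norm_num))) fun x hx => ?_
    rw [show lifted θ₂ z u t = fun x => z t x + u t * bFun θ₂ x from rfl,
      dI_add_const_mul ((D.reg t (D.neg_h_le ht)).of_le (by norm_num)) (hbc.of_le (by norm_num))
      (u t) hx]
    ring
  have hzh : ∑ n ∈ Finset.Icc 1 N, zhat n t ^ 2 ≤ N * Y := by
    refine (Finset.sum_le_sum fun n hn => (hcomp n (Finset.mem_Icc.1 hn).1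
      (Finset.mem_Icc.1 hn).2).1).trans_eq ?_
    simp
  rw [neg_sq] at hz1 hz2
  have h5 := mul_le_mul_of_nonneg_right hu (add_nonneg hb0 hb1)
  linarith

end

section

variable {p q qt : ℝ → ℝ} {θ₁ θ₂ q_c c h : ℝ} {lam : ℕ → ℝ} {phi : ℕ → ℝ → ℝ} {N₀ N : ℕ}
  {K L : Fin N₀ → ℝ} (H : SturmLiouville p q θ₁ θ₂ lam phi)

include H

theorem SturmLiouville.hasSum_tail_sq {f : ℝ → ℝ} (hf : ContinuousOn f (Icc 0 1)) (N : ℕ) :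
    HasSum (fun k => ip f (phi (N + 1 + k)) ^ 2)
      (ip f f - ∑ k ∈ Finset.range N, ip f (phi (k + 1)) ^ 2) := by
  refine ((hasSum_nat_add_iff' N).2 (H.hasSum_sq hf)).congr_fun fun k => ?_
  rw [show N + 1 + k = k + N + 1 by ring]

theorem exists_exponential_decay (hqt : ∀ x, qt x = q x - q_c) (hN : N₀ + 1 ≤ N) (hh : 0 < h)
    {F1m : Matrix (Fin N₀ ⊕ Fin N₀) (Fin N₀ ⊕ Fin N₀) ℝ}
    {F2m : Matrix (Fin N₀ ⊕ Fin N₀) (Fin (N - N₀)) ℝ}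
    (hF1m : F1m = F1 N₀ lam q_c (B0 N₀ p qt θ₂ q_c lam phi)
      (fun i => dI (phi (i.val + 1)) 0) K L)
    (hF2m : F2m = F2 N₀ N L
      (fun i => dI (phi (N₀ + i.val + 1)) 0 / lam (N₀ + i.val + 1)))
    {S : ModalLMI (StateIdx N₀ N)} (hSc : S.c = c) (hSq : S.qc = q_c)
    (hSF : S.F = stateF F1m F2m (fun j => -lam (N₀ + j.val + 1) + q_c)
      (fun j => betaC p qt θ₂ q_c lam phi (N₀ + j.val + 1)) (Kt N₀ K))
    (hSG : S.G = stateV (Lv N₀ L)) (hSκ : S.κ = stateV (Kt N₀ K))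
    (hSlam : S.lam = fun k => lam (N + 1 + k))
    (hSa : S.a = fun k => ip (aFun p qt θ₂) (phi (N + 1 + k)))
    (hSb : S.b = fun k => ip (bFun θ₂) (phi (N + 1 + k)))
    (hSφ : S.φ = fun k => dI (phi (N + 1 + k)) 0) (hSP : S.P.PosDef) (hSα₃ : 0 ≤ S.α₃)
    (hSRb : 0 ≤ S.Rb) (hSδ : 0 ≤ S.δ) (hSσ : S.σ = Real.exp (2 * S.δ * h)) :
    ∃ M > 0, ∀ (z : ℝ → ℝ → ℝ) (u : ℝ → ℝ) (zhat : ℕ → ℝ → ℝ),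
      PlantSolution p q θ₁ θ₂ q_c c h z u →
      ObserverSolution p qt θ₂ q_c c h lam phi N₀ N K L z u zhat →
      ∀ J, (∀ s ∈ Icc (-h) 0, ip (z s) (z s) ≤ J) → (∀ s ∈ Icc (-h) 0, u s ^ 2 ≤ J) →
      (∀ n ∈ Finset.Icc 1 N, zhat n 0 ^ 2 ≤ J) → ip (z 0) (z 0) + ip (dI (z 0)) (dI (z 0)) ≤ J →
      ∀ t ≥ 0, ip (z t) (z t) + ip (dI (z t)) (dI (z t)) + ∑ n ∈ Finset.Icc 1 N, zhat n t ^ 2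
        ≤ M * Real.exp (-2 * S.δ * t) * J := by
  obtain ⟨C₁, hC₁, h1⟩ := exists_stateVec_dot_le H hN
  obtain ⟨C₂, hC₂, h2⟩ := exists_norm_le (h := h) (c := c) (qt := qt) (q_c := q_c) (K := K) (L := L)
    H hN
  obtain ⟨C₃, hC₃, h3⟩ := S.P.dotProduct_mulVec_le
  obtain ⟨C₄, hC₄, h4⟩ := H.exists_energy_le
  obtain ⟨μ, hμ, h5⟩ := hSP.exists_coercive
  have hγ := S.hγ
  have hα₁ := S.hα₁
  set b₀ := ip (bFun θ₂) (bFun θ₂) with hb₀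
  set b₁ := ip (dI (bFun θ₂)) (dI (bFun θ₂)) with hb₁
  have hb₀0 : 0 ≤ b₀ := ip_self_nonneg _
  have hb₁0 : 0 ≤ b₁ := ip_self_nonneg _
  have hκ0 : 0 ≤ S.κ ⬝ᵥ S.κ := Finset.sum_nonneg fun i _ => mul_self_nonneg _
  set v := C₃ * C₁ + S.γ * (C₄ * (2 + 2 * (b₀ + b₁))) with hv
  set B := |S.c| * (C₃ * C₁) + S.γ * S.α₁ * |S.c| * (2 + 2 * b₀)
    + 4 * S.α₃ * S.γ * S.Rb * S.c ^ 2 * (2 + 2 * (S.κ ⬝ᵥ S.κ * C₁)) with hB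
  have hB0 : 0 ≤ B := by positivity
  set ν := min μ S.γ with hν
  have hν0 : 0 < ν := lt_min hμ hγ
  refine ⟨C₂ * ((v + h * Real.exp (2 * S.δ * h) * B) / ν), ?_,
    fun z u zhat D O J hz hu hzh hz0 t ht => ?_⟩
  · positivity
  obtain ⟨rX, rW, hs⟩ := ModalLMI.weakSol_of_plantSolution O D H hqt hN hF1m hF2m hSc hSq hSF hSG
    hSκ hSlam hSa hSb hSφ
  set X := stateVec N₀ N lam phi z zhat with hX
  have hJ0 : 0 ≤ J := (ip_self_nonneg _).trans (hz 0 ⟨by linarith, le_rfl⟩)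
  have hlam : ∀ k, 0 ≤ S.lam k := fun k => by
    rw [hSlam]
    exact (H.hlampos _ (by omega)).le
  have hwc : ∀ s, -h ≤ s → ContinuousOn (lifted θ₂ z u s) (Icc 0 1) := fun s hs =>
    (D.contDiffOn_lifted hs).continuousOn
  have hbc : ContDiffOn ℝ 2 (bFun θ₂) (Icc 0 1) := (contDiff_bFun θ₂).contDiffOn
  have hXJ : ∀ s ∈ Icc (-h) 0, X s ⬝ᵥ X s ≤ C₁ * J := fun s hs =>
    h1 z zhat s J (D.reg s hs.1).continuousOn (hz s hs) fun n hn => by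
      rw [O.history n s hs]
      exact hzh n hn
  have hPJ : ∀ s ∈ Icc (-h) 0, X s ⬝ᵥ S.P *ᵥ X s ≤ C₃ * C₁ * J := fun s hs => by
    rw [mul_assoc]
    exact (h3 _).trans (mul_le_mul_of_nonneg_left (hXJ s hs) hC₃.le)
  have hwJ : ∀ s ∈ Icc (-h) 0, ip (lifted θ₂ z u s) (lifted θ₂ z u s) ≤ (2 + 2 * b₀) * J :=
    fun s hs => by
      have := ip_self_le_of_eq (f := lifted θ₂ z u s) (r := u s) (D.reg s hs.1).continuousOn
        hbc.continuousOn fun x _ => rfl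
      nlinarith [hz s hs, mul_le_mul_of_nonneg_right (hu s hs) hb₀0]
  have hdJ : ∀ s ∈ Icc (-h) 0, (u s - S.κ ⬝ᵥ X s) ^ 2 ≤ (2 + 2 * (S.κ ⬝ᵥ S.κ * C₁)) * J :=
    fun s hs => by
      have := (sq_dotProduct_le S.κ (X s)).trans (mul_le_mul_of_nonneg_left (hXJ s hs) hκ0)
      nlinarith [hu s hs, sq_nonneg (u s + S.κ ⬝ᵥ X s)]
  have h00 : (0 : ℝ) ∈ Icc (-h) 0 := ⟨by linarith, le_rfl⟩
  have hV : ∀ m, S.energy m (X (max 0 0))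
      (fun k => ip (lifted θ₂ z u (max 0 0)) (phi (N + 1 + k))) ≤ v * J := fun m => by
    rw [max_self, ModalLMI.energy, hSlam]
    have hw0 := D.contDiffOn_lifted (D.neg_h_le le_rfl)
    have hr0 := D.robinBC_lifted H le_rfl
    have e1 : ∑ k ∈ Finset.range m, lam (N + 1 + k)
        * ip (lifted θ₂ z u 0) (phi (N + 1 + k)) ^ 2
        ≤ ip (LOp p q (lifted θ₂ z u 0)) (lifted θ₂ z u 0) := by
      have hpos : ∀ k, 0 ≤ lam (k + 1) * ip (lifted θ₂ z u 0) (phi (k + 1)) ^ 2 := fun k =>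
        mul_nonneg (H.hlampos _ (by omega)).le (sq_nonneg _)
      have := sum_le_hasSum (Finset.range (N + m)) (fun k _ => hpos k) (H.hasSum_lam_sq hw0 hr0)
      rw [Finset.sum_range_add] at this
      simp only [Nat.add_right_comm N 1]
      linarith [Finset.sum_nonneg fun k (_ : k ∈ Finset.range N) => hpos k]
    have e2 := h4 _ hw0 hr0
    have e3 := ip_self_le_of_eq (f := lifted θ₂ z u 0) (r := u 0) (D.reg 0 h00.1).continuousOn
        hbc.continuousOn fun x _ => rfl
    have e4 := ip_self_le_of_eq (f := dI (lifted θ₂ z u 0)) (r := u 0)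
      (continuousOn_dI ((D.reg 0 h00.1).of_le (by norm_num)))
      (continuousOn_dI (hbc.of_le (by norm_num))) fun x hx =>
        dI_add_const_mul ((D.reg 0 h00.1).of_le (by norm_num)) (hbc.of_le (by norm_num)) (u 0) hx
    have e5 : ip (lifted θ₂ z u 0) (lifted θ₂ z u 0)
        + ip (dI (lifted θ₂ z u 0)) (dI (lifted θ₂ z u 0)) ≤ (2 + 2 * (b₀ + b₁)) * J := by
      have := mul_le_mul_of_nonneg_right (hu 0 h00) (add_nonneg hb₀0 hb₁0)
      linarith
    have e6 := mul_le_mul_of_nonneg_left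
      (e1.trans (e2.trans (mul_le_mul_of_nonneg_left e5 hC₄.le))) hγ.le
    have e7 := hPJ 0 h00
    rw [hv]
    linarith
  have hcW : Continuous fun s => ip (lifted θ₂ z u (max s 0)) (lifted θ₂ z u (max s 0))
      - ∑ k ∈ Finset.range N, ip (lifted θ₂ z u (max s 0)) (phi (k + 1)) ^ 2 := by
    refine Continuous.sub ?_ (continuous_finsetSum _ fun k _ =>
      (D.continuous_ip_lifted (H.cphi (by omega))).pow 2)
    exact ((continuousOn_ip_self D.continuousOn_lifted).mono
      (Ici_subset_Ici.2 (by linarith [D.hh]))).continuous_max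
  have hcWh : Continuous fun s => ip (lifted θ₂ z u (max s 0 - h)) (lifted θ₂ z u (max s 0 - h))
      - ∑ k ∈ Finset.range N, ip (lifted θ₂ z u (max s 0 - h)) (phi (k + 1)) ^ 2 :=
    (continuous_comp_max_sub (continuousOn_ip_self D.continuousOn_lifted)).sub
      (continuous_finsetSum _ fun k _ => (continuous_comp_max_sub
        (continuousOn_ip D.continuousOn_lifted (H.cphi (by omega)))).pow 2)
  have key := fun n => hs.exp_mul_energy_le hSRb hlam hSδ hh hSσ hcW hcWh
    (fun s => H.hasSum_tail_sq (hwc _ (D.neg_h_le (le_max_right s 0))) N)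
    (fun m s => sum_le_hasSum _ (fun k _ => sq_nonneg _)
      (H.hasSum_tail_sq (hwc (max s 0 - h) (by linarith [le_max_right s 0])) N))
    (fun s hs => by
      rw [max_eq_left (hh.le.trans hs), max_eq_left (sub_nonneg.2 hs)])
    (fun s hs => by
      simp only [max_eq_left (hh.le.trans hs), max_eq_left (sub_nonneg.2 hs)])
    (fun s hs => by
      rw [max_eq_left (hh.le.trans hs), O.feedback _ (sub_nonneg.2 hs), hSκ, Kt_dot_stateVec,
        sub_self])
    (mul_nonneg hB0 hJ0)
    (fun s hs => by
      have hs' : s - h ∈ Icc (-h) 0 := ⟨by linarith [hs.1], by linarith [hs.2]⟩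
      simp only [max_eq_left hs.1]
      have e1 := mul_le_mul_of_nonneg_left (hPJ _ hs') (abs_nonneg S.c)
      have e2 : ip (lifted θ₂ z u (s - h)) (lifted θ₂ z u (s - h))
          - ∑ k ∈ Finset.range N, ip (lifted θ₂ z u (s - h)) (phi (k + 1)) ^ 2
          ≤ (2 + 2 * b₀) * J := by
        linarith [hwJ _ hs', Finset.sum_nonneg fun k (_ : k ∈ Finset.range N) =>
          sq_nonneg (ip (lifted θ₂ z u (s - h)) (phi (k + 1)))]
      have e3 := mul_le_mul_of_nonneg_left e2
        (mul_nonneg (mul_nonneg hγ.le hα₁.le) (abs_nonneg S.c))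
      have e4 := mul_le_mul_of_nonneg_left (hdJ _ hs')
        (show 0 ≤ 4 * S.α₃ * S.γ * S.Rb * S.c ^ 2 by positivity)
      rw [hB]
      linarith)
    hV ht n
  simp only [max_eq_left ht] at key
  refine (h2 z u zhat D O t ht (Real.exp (-2 * S.δ * t)
    * ((v + h * Real.exp (2 * S.δ * h) * B) / ν * J)) fun m => ?_).trans_eq (by ring)
  have e1 := key m
  rw [ModalLMI.energy, hSlam] at e1
  have hsum : 0 ≤ ∑ k ∈ Finset.range m, lam (N + 1 + k)
      * ip (lifted θ₂ z u t) (phi (N + 1 + k)) ^ 2 := Finset.sum_nonneg fun k _ =>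
    mul_nonneg (H.hlampos _ (by omega)).le (sq_nonneg _)
  have hX0 : 0 ≤ X t ⬝ᵥ X t := Finset.sum_nonneg fun i _ => mul_self_nonneg _
  have e2 := mul_le_mul_of_nonneg_right (min_le_left μ S.γ) hX0
  have e3 := mul_le_mul_of_nonneg_right (min_le_right μ S.γ) hsum
  have e4 : ν * (X t ⬝ᵥ X t + ∑ k ∈ Finset.range m, lam (N + 1 + k)
      * ip (lifted θ₂ z u t) (phi (N + 1 + k)) ^ 2) ≤ Real.exp (-2 * S.δ * t)
        * ((v + h * Real.exp (2 * S.δ * h) * B) * J) := by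
    have hexp : Real.exp (-2 * S.δ * t) * Real.exp (2 * S.δ * t) = 1 := by
      rw [← Real.exp_add]
      simp
    have e5 := mul_le_mul_of_nonneg_left e1 (Real.exp_pos (-2 * S.δ * t)).le
    rw [← mul_assoc, hexp, one_mul] at e5
    have e6 := h5 (X t)
    linarith
  rw [div_mul_eq_mul_div, mul_div_assoc', le_div_iff₀ hν0]
  linarith

end

/-- Theorem 2 (stability), Neumann measurement: under the LMI conditions
`Ψ ≺ 0`, `Θ₁ ≺ 0`, `Θ₂ ≺ 0`, `Θ₃ < 0`, `Θ₄ < 0`, `Θ₅ > 0`, for any delay `h > 0` the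
closed-loop system (plant + finite-dimensional observer-based controller with output
`y_N(t) = z_x(t,0)`) is exponentially stable in `H¹` norm. -/
theorem stmt_17
    -- plant data
    (θ₁ θ₂ : ℝ) (hθ₁ : θ₁ ∈ Set.Ico 0 (π/2)) (hθ₂ : θ₂ ∈ Set.Icc 0 (π/2))
    (p q qt : ℝ → ℝ) (q_c c : ℝ) (hc : c ≠ 0)
    (hp : ContDiffOn ℝ 2 p (Set.Icc 0 1)) (hppos : ∀ x ∈ Set.Icc (0:ℝ) 1, 0 < p x)
    (hqc : ContinuousOn q (Set.Icc 0 1)) (hqpos : ∀ x ∈ Set.Icc (0:ℝ) 1, 0 < q x)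
    (hqt : ∀ x, qt x = q x - q_c)
    -- eigenstructure of the Sturm–Liouville operator A f = -(p f')' + q f
    (lam : ℕ → ℝ) (phi : ℕ → ℝ → ℝ)
    (hlampos : ∀ n ≥ 1, 0 < lam n)
    (hlammono : ∀ n ≥ 1, lam n < lam (n+1))
    (hlamtop : Filter.Tendsto lam Filter.atTop Filter.atTop)
    (hphireg : ∀ n ≥ 1, ContDiffOn ℝ 2 (phi n) (Set.Icc 0 1))
    (hphieig : ∀ n ≥ 1, ∀ x ∈ Set.Icc (0:ℝ) 1,
      -(dI (fun y => p y * dI (phi n) y) x) + q x * phi n x = lam n * phi n x)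
    (hphibc : ∀ n ≥ 1,
      Real.cos θ₁ * phi n 0 - Real.sin θ₁ * dI (phi n) 0 = 0 ∧
      Real.cos θ₂ * phi n 1 + Real.sin θ₂ * dI (phi n) 1 = 0)
    (horth : ∀ m ≥ 1, ∀ n ≥ 1, ip (phi m) (phi n) = if m = n then 1 else 0)
    (hparseval : ∀ f : ℝ → ℝ, ContinuousOn f (Set.Icc 0 1) →
      (∫ x in (0:ℝ)..1, (f x)^2) = ∑' k : ℕ, (ip f (phi (k+1)))^2)
    -- dimensions
    (N₀ N : ℕ) (hN₀ : 1 ≤ N₀) (hN : N₀ + 1 ≤ N)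
    (hspec : ∀ n ≥ N₀ + 1, -lam n + q_c + |c| < 0)
    -- gains, with all eigenvalues of F₁ of real part < -|c|
    (K L : Fin N₀ → ℝ)
    (F1m : Matrix (Fin N₀ ⊕ Fin N₀) (Fin N₀ ⊕ Fin N₀) ℝ)
    (hF1m : F1m = F1 N₀ lam q_c (B0 N₀ p qt θ₂ q_c lam phi)
      (fun i => dI (phi (i.val + 1)) 0) K L)
    (hF1spec : ∀ μ : ℂ, μ ∈ spectrum ℂ (F1m.map (Complex.ofReal : ℝ → ℂ)) → μ.re < -|c|)
    -- Young parameters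
    (α₁ α₂ α₃ α₄ cf : ℝ) (hα₁ : 0 < α₁) (hα₂ : 0 < α₂) (hα₃ : 0 < α₃) (hα₄ : 0 < α₄)
    (hcf : cf = 1 - (|c|/α₁ + 1/α₂ + 1/α₃ + |c|/α₄)/2) (hcfpos : 0 < cf)
    -- the exponent ε and the Neumann trace series M_φ(ε)
    (ε : ℝ) (hε : ε ∈ Set.Ioc (0:ℝ) (1/2))
    (RNa2 RNb2 Mphi : ℝ)
    (hRNa2 : RNa2 = RN2 (aFun p qt θ₂) phi N) (hRNb2 : RNb2 = RN2 (bFun θ₂) phi N)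
    (hMphisum : Summable fun k : ℕ =>
      (dI (phi (N + 1 + k)) 0)^2 / lam (N + 1 + k) ^ ((3:ℝ)/2 + ε))
    (hMphi : Mphi = ∑' k : ℕ,
      (dI (phi (N + 1 + k)) 0)^2 / lam (N + 1 + k) ^ ((3:ℝ)/2 + ε))
    -- derived matrices
    (F2m : Matrix (Fin N₀ ⊕ Fin N₀) (Fin (N - N₀)) ℝ)
    (hF2m : F2m = F2 N₀ N L
      (fun i => dI (phi (N₀ + i.val + 1)) 0 / lam (N₀ + i.val + 1)))
    (Em : SIdx N₀ N → ℝ) (hEm : Em = Erow N₀ N F1m F2m (Lv N₀ L) (Kt N₀ K))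
    -- LMI decision variables and constraints
    (P Q1 : Matrix (Fin N₀ ⊕ Fin N₀) (Fin N₀ ⊕ Fin N₀) ℝ)
    (Q2 : Matrix (Fin (N - N₀)) (Fin (N - N₀)) ℝ)
    (r₁ r₂ βs γ : ℝ) (hr₁ : 0 < r₁) (hr₂ : 0 < r₂) (hβs : 0 < βs) (hγ : 0 < γ)
    (hP : P.PosDef) (hQ1 : Q1.PosSemidef) (hQ2 : Q2.PosSemidef)
    (hPsi : (-(PsiM N₀ N P Q1 F1m Q2 (A1 N₀ N lam q_c) F2m (Lv N₀ L) (Kt N₀ K) Em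
      c r₁ βs γ α₂ α₃ RNa2 RNb2)).PosDef)
    (hTh1 : (-(Theta1 N₀ P Q1 (Kt N₀ K) c γ α₃ α₄ RNb2)).PosDef)
    (hTh2 : (-(Theta2 N₀ N Q2 r₁ c)).PosDef)
    (hTh3 : γ * α₁ * |c| - r₂ < 0)
    (hTh4 : 2*γ*(-cf * lam (N+1) + q_c) + βs * Mphi * lam (N+1) ^ ((1:ℝ)/2 + ε)
      + r₂ / lam (N+1) < 0)
    (hTh5 : 0 < 2*γ*cf - βs * Mphi / lam (N+1) ^ ((1:ℝ)/2 - ε))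
    -- state delay
    (h : ℝ) (hh : 0 < h) :
    ∃ δ > (0:ℝ), ∃ M > (0:ℝ),
      ∀ (z : ℝ → ℝ → ℝ) (u : ℝ → ℝ) (zhat : ℕ → ℝ → ℝ),
      -- regularity of the classical solution
      (∀ t ≥ -h, ContDiffOn ℝ 2 (z t) (Set.Icc 0 1)) →
      ContinuousOn (fun pr : ℝ × ℝ => z pr.1 pr.2) (Set.Ici (-h) ×ˢ Set.Icc 0 1) →
      ContinuousOn (fun pr : ℝ × ℝ => deriv (fun s => z s pr.2) pr.1)
        (Set.Ioi 0 ×ˢ Set.Icc 0 1) →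
      ContinuousOn (fun pr : ℝ × ℝ => dI (z pr.1) pr.2) (Set.Ioi 0 ×ˢ Set.Icc 0 1) →
      ContinuousOn (fun pr : ℝ × ℝ => dI (dI (z pr.1)) pr.2) (Set.Ioi 0 ×ˢ Set.Icc 0 1) →
      (∀ n, ContinuousOn (zhat n) (Set.Ici (-h))) →
      -- Lipschitz regularity of the initial data z₀ (in L²) and u₀
      (∃ Kz, ∀ τ₁ ∈ Set.Icc (-h) (0:ℝ), ∀ τ₂ ∈ Set.Icc (-h) (0:ℝ),
        (∫ x in (0:ℝ)..1, (z τ₁ x - z τ₂ x)^2) ≤ Kz * (τ₁ - τ₂)^2) →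
      (∃ Ku, ∀ τ₁ ∈ Set.Icc (-h) (0:ℝ), ∀ τ₂ ∈ Set.Icc (-h) (0:ℝ),
        |u τ₁ - u τ₂| ≤ Ku * |τ₁ - τ₂|) →
      -- the PDE in the domain
      (∀ t > (0:ℝ), ∀ x ∈ Set.Ioo (0:ℝ) 1,
        HasDerivAt (fun s => z s x)
          (dI (fun y => p y * dI (z t) y) x - qt x * z t x + c * z (t-h) x) t) →
      -- boundary conditions (and compatibility at t = 0)
      (∀ t ≥ (0:ℝ), Real.cos θ₁ * z t 0 - Real.sin θ₁ * dI (z t) 0 = 0) →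
      -- Robin actuation at x = 1; for τ ∈ [-h,0] this defines u₀
      (∀ t ≥ -h, Real.cos θ₂ * z t 1 + Real.sin θ₂ * dI (z t) 1 = u t) →
      -- observer initial data constant on [-h,0]
      (∀ n, ∀ τ ∈ Set.Icc (-h) (0:ℝ), zhat n τ = zhat n 0) →
      -- observer dynamics with Neumann output innovation, modes 1..N₀
      (∀ i : Fin N₀, ∀ t > (0:ℝ),
        HasDerivAt (zhat (i.val + 1))
          ((-lam (i.val + 1) + q_c) * zhat (i.val + 1) t + c * zhat (i.val + 1) (t-h)
            + betaC p qt θ₂ q_c lam phi (i.val + 1) * u t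
            - L i * ((∑ k ∈ Finset.Icc 1 N,
                (zhat k t + ip (bFun θ₂) (phi k) * u t) * dI (phi k) 0)
              - dI (z t) 0)) t) →
      -- observer dynamics, modes N₀+1..N
      (∀ n, N₀ + 1 ≤ n → n ≤ N → ∀ t > (0:ℝ),
        HasDerivAt (zhat n)
          ((-lam n + q_c) * zhat n t + c * zhat n (t-h)
            + betaC p qt θ₂ q_c lam phi n * u t) t) →
      -- feedback law (including the compatibility condition u₀(0) = K Ẑ(0))
      (∀ t ≥ (0:ℝ), u t = ∑ i : Fin N₀, K i * zhat (i.val + 1) t) →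
      -- exponential stability estimate in H¹ norm
      ∀ t ≥ (0:ℝ),
        ((∫ x in (0:ℝ)..1, (z t x)^2) + ∫ x in (0:ℝ)..1, (dI (z t) x)^2)
            + ∑ n ∈ Finset.Icc 1 N, (zhat n t)^2
          ≤ M * Real.exp (-2*δ*t) *
            (sSup ((fun τ => ∫ x in (0:ℝ)..1, (z τ x)^2) '' Set.Icc (-h) 0)
              + ((∫ x in (0:ℝ)..1, (z 0 x)^2) + ∫ x in (0:ℝ)..1, (dI (z 0) x)^2)
              + (sSup ((fun τ => |u τ|) '' Set.Icc (-h) 0))^2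
              + ∑ n ∈ Finset.Icc 1 N, (zhat n 0)^2) := by
  have H : SturmLiouville p q θ₁ θ₂ lam phi :=
    ⟨hθ₁, hθ₂, hp, hppos, hqc, hqpos, hlampos, hphireg, hphieig, hphibc, horth, hparseval⟩
  have hsa := (H.hasSum_tail_sq (continuousOn_aFun θ₂ H.hp1 H.hqc hqt) N).summable
  have hsb := (H.hasSum_tail_sq (contDiff_bFun θ₂).continuous.continuousOn N).summable
  have hRa : ∀ m, ∑ n ∈ Finset.range m, ip (aFun p qt θ₂) (phi (N + 1 + n)) ^ 2 ≤ RNa2 :=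
    fun m => hRNa2 ▸ hsa.sum_le_tsum _ fun _ _ => sq_nonneg _
  have hRb : ∀ m, ∑ n ∈ Finset.range m, ip (bFun θ₂) (phi (N + 1 + n)) ^ 2 ≤ RNb2 :=
    fun m => hRNb2 ▸ hsb.sum_le_tsum _ fun _ _ => sq_nonneg _
  have hRb0 : 0 ≤ RNb2 := by simpa using hRb 0
  have hmono : ∀ m ≥ 1, ∀ n, lam m ≤ lam (m + n) := fun m hm n => by
    induction n with
    | zero => exact le_rfl
    | succ n ih => exact ih.trans (hlammono (m + n) (by omega)).le
  have hω : 0 < lam (N₀ + 1) - q_c - |c| := by linarith [hspec (N₀ + 1) le_rfl]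
  have hd : ∀ j : Fin (N - N₀),
      -lam (N₀ + j.val + 1) + q_c ≤ -(|c| + (lam (N₀ + 1) - q_c - |c|)) := fun j => by
    have := hmono (N₀ + 1) (by omega) j.val
    rw [show N₀ + 1 + j.val = N₀ + j.val + 1 by ring] at this
    linarith
  have hs : 0 ≤ (2 * α₃ * |c| + α₄) * γ * |c| * RNb2 := by positivity
  have hM : HasSum (fun k => dI (phi (N + 1 + k)) 0 ^ 2 / lam (N + 1 + k) ^ ((3 : ℝ) / 2 + ε))
      Mphi := hMphi ▸ hMphisum.hasSum
  rw [hEm] at hPsi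
  obtain ⟨δ, hδ, r, hr, S, hSc, hSq, -, hSδ, hSσ, -, hSα₃, hSRb, hSP, hSF, hSG, hSκ, hSlam, hSa,
    hSb, hSφ⟩ := exists_modalLMI (fun j => betaC p qt θ₂ q_c lam phi (N₀ + j.val + 1)) hc hP hr₁ hr₂
    hβs hγ hα₁ hα₂ hα₃ hα₄ hcf hPsi hTh1 hs hTh2 hTh3 hω hd (hlampos (N + 1) (by omega))
    (hmono (N + 1) (by omega)) hε.2 hTh4 hTh5 hM hRa hRb hh
  obtain ⟨M, hM0, hdecay⟩ := exists_exponential_decay H hqt hN hh hF1m hF2m hSc hSq hSF hSG hSκ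
    hSlam hSa hSb hSφ (hSP ▸ stateP_posDef hP hr₁ hr) (hSα₃ ▸ hα₃.le) (hSRb ▸ hRb0) (hSδ ▸ hδ.le)
    (hSδ ▸ hSσ)
  refine ⟨δ, hδ, M, hM0, fun z u zhat hreg hcont hcontt _ _ hzc _ hLu hpde hbc0 hbc1 hhist hlow
    hhigh hfb t ht => ?_⟩
  have hcu : ContinuousOn u (Ici (-h)) := by
    rw [← Icc_union_Ici_eq_Ici (neg_nonpos.2 hh.le)]
    obtain ⟨Ku, hKu⟩ := hLu
    refine ContinuousOn.union_of_isClosed ?_ ?_ isClosed_Icc isClosed_Ici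
    · refine (LipschitzOnWith.of_dist_le_mul (K := Ku.toNNReal) fun x hx y hy => ?_).continuousOn
      rw [Real.dist_eq, Real.dist_eq]
      exact (hKu x hx y hy).trans
        (mul_le_mul_of_nonneg_right (Real.le_coe_toNNReal Ku) (abs_nonneg _))
    · refine ContinuousOn.congr (f := fun t => ∑ i : Fin N₀, K i * zhat (i.val + 1) t)
        (continuousOn_finsetSum _ fun i _ => continuousOn_const.mul
          ((hzc _).mono (Ici_subset_Ici.2 (by linarith)))) fun t ht => hfb t ht
  have D : PlantSolution p q θ₁ θ₂ q_c c h z u :=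
    { hh := hh
      reg := hreg
      cont := hcont
      cont_deriv := hcontt
      pde := fun t ht x hx => (hpde t ht x hx).congr_deriv (by rw [LOp, hqt]; ring)
      bc0 := hbc0
      bc1 := fun t ht => hbc1 t (by linarith [show (0 : ℝ) ≤ t from ht])
      cont_u := hcu }
  simp only [← ip_self]
  have hz : ∀ s ∈ Icc (-h) 0, ip (z s) (z s) ≤ sSup ((fun τ => ip (z τ) (z τ)) '' Icc (-h) 0) :=
    fun s hs => le_csSup (isCompact_Icc.bddAbove_image
      ((continuousOn_ip_self D.cont).mono Icc_subset_Ici_self)) (mem_image_of_mem _ hs)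
  have hu : ∀ s ∈ Icc (-h) 0, u s ^ 2 ≤ sSup ((fun τ => |u τ|) '' Icc (-h) 0) ^ 2 :=
    fun s hs => (sq_abs (u s)).symm.trans_le (pow_le_pow_left₀ (abs_nonneg _)
      (le_csSup (isCompact_Icc.bddAbove_image (hcu.abs.mono Icc_subset_Ici_self))
        (mem_image_of_mem _ hs)) 2)
  have hzh : ∀ n ∈ Finset.Icc 1 N, zhat n 0 ^ 2 ≤ ∑ n ∈ Finset.Icc 1 N, zhat n 0 ^ 2 :=
    fun n hn => Finset.single_le_sum (f := fun n => zhat n 0 ^ 2) (fun _ _ => sq_nonneg _) hn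
  have h1 := (ip_self_nonneg _).trans (hz 0 ⟨by linarith, le_rfl⟩)
  have h2 := ip_self_nonneg (z 0)
  have h3 := ip_self_nonneg (dI (z 0))
  have h4 := sq_nonneg (sSup ((fun τ => |u τ|) '' Icc (-h) 0))
  have h5 : 0 ≤ ∑ n ∈ Finset.Icc 1 N, zhat n 0 ^ 2 := Finset.sum_nonneg fun _ _ => sq_nonneg _
  rw [← hSδ]
  exact hdecay z u zhat D ⟨hzc, hhist, hlow, hhigh, hfb⟩ _
    (fun s hs => by linarith [hz s hs]) (fun s hs => by linarith [hu s hs])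
    (fun n hn => by linarith [hzh n hn]) (by linarith) t ht

end
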